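/- The fatness of strongly regular cellulations of the 3-sphere is unbounded: for every real number c there exists a finite strongly regular CW cellulation of S³ with f₁ + f₂ > c · (f₀ + f₃). -/

import Mathlib

noncomputable section

/-- The closed `n`-disk. -/
abbrev Disk (n : ℕ) : Set (EuclideanSpace ℝ (Fin n)) := Metric.closedBall 0 1
/-- The open `n`-disk. -/
abbrev OpenDisk (n : ℕ) : Set (EuclideanSpace ℝ (Fin n)) := Metric.ball 0 1
/-- The boundary sphere of the `n`-disk. -/
abbrev DiskBdry (n : ℕ) : Set (EuclideanSpace ℝ (Fin n)) := Metric.sphere 0 1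

/-- The 3-sphere, as a topological space. -/
abbrev Sphere3 : Type := ↥(Metric.sphere (0 : EuclideanSpace ℝ (Fin 4)) 1)

/-- A finite CW cellulation of the 3-sphere. -/
structure FinCellulation3 where
  /-- the number of cells of each dimension -/
  count : Fin 4 → ℕ
  /-- the characteristic maps -/
  char : ∀ n : Fin 4, Fin (count n) → EuclideanSpace ℝ (Fin (n : ℕ)) → Sphere3
  continuousOn : ∀ (n : Fin 4) (i : Fin (count n)), ContinuousOn (char n i) (Disk (n : ℕ))
  /-- each characteristic map is a homeomorphism from the open disk onto its image -/
  embeds_open : ∀ (n : Fin 4) (i : Fin (count n)),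
    Topology.IsEmbedding ((OpenDisk (n : ℕ)).restrict (char n i))
  /-- the open cells are pairwise disjoint -/
  disjoint_open : ∀ (n m : Fin 4) (i : Fin (count n)) (j : Fin (count m)),
    (⟨n, i⟩ : Σ k : Fin 4, Fin (count k)) ≠ ⟨m, j⟩ →
      Disjoint (char n i '' OpenDisk (n : ℕ)) (char m j '' OpenDisk (m : ℕ))
  /-- the open cells cover the 3-sphere -/
  covers : (⋃ (n : Fin 4) (i : Fin (count n)), char n i '' OpenDisk (n : ℕ)) = Set.univ
  /-- the boundary of each cell is contained in the cells of lower dimension -/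
  bdry : ∀ (n : Fin 4) (i : Fin (count n)),
    char n i '' DiskBdry (n : ℕ) ⊆
      ⋃ (m : Fin 4) (_ : (m : ℕ) < (n : ℕ)) (j : Fin (count m)), char m j '' Disk (m : ℕ)

/-- A cellulation is regular if every characteristic map is a homeomorphism
from the whole closed disk onto its image. -/
def FinCellulation3.Regular (C : FinCellulation3) : Prop :=
  ∀ (n : Fin 4) (i : Fin (C.count n)),
    Topology.IsEmbedding ((Disk (n : ℕ)).restrict (C.char n i))

/-- A cellulation is strongly regular if it is regular and the intersection of
any two closed cells is empty or a single closed cell. -/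
def FinCellulation3.StronglyRegular (C : FinCellulation3) : Prop :=
  C.Regular ∧
  ∀ (n m : Fin 4) (i : Fin (C.count n)) (j : Fin (C.count m)),
    (C.char n i '' Disk (n : ℕ)) ∩ (C.char m j '' Disk (m : ℕ)) = ∅ ∨
    ∃ (p : Fin 4) (k : Fin (C.count p)),
      (C.char n i '' Disk (n : ℕ)) ∩ (C.char m j '' Disk (m : ℕ)) =
        C.char p k '' Disk (p : ℕ)

noncomputable section

/-- A pair of sets which is a closed cell with its open part, parametrised by a convex body. -/
def IsCell {X : Type} [TopologicalSpace X] (n : ℕ) (A B : Set X) : Prop :=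
  ∃ (E : Type) (_ : NormedAddCommGroup E) (_ : NormedSpace ℝ E) (_ : FiniteDimensional ℝ E)
    (K : Set E) (φ : E → X), Module.finrank ℝ E = n ∧ Convex ℝ K ∧ IsCompact K ∧
    (interior K).Nonempty ∧ ContinuousOn φ K ∧ Set.InjOn φ K ∧ φ '' K = A ∧ φ '' interior K = B

theorem IsCell.disk {X : Type} [TopologicalSpace X] {n : ℕ} {A B : Set X} (hc : IsCell n A B) :
    ∃ φ : EuclideanSpace ℝ (Fin n) → X, ContinuousOn φ (Disk n) ∧ Set.InjOn φ (Disk n) ∧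
      φ '' Disk n = A ∧ φ '' OpenDisk n = B ∧ φ '' DiskBdry n = A \ B := by
  obtain ⟨E, i1, i2, i3, K, φ, hn, hK, hKc, hKi, hφ, hinj, hA, hB⟩ := hc
  let e : EuclideanSpace ℝ (Fin n) ≃L[ℝ] E :=
    ContinuousLinearEquiv.ofFinrankEq (by simp [hn])
  have hKint : interior (e ⁻¹' K) = e ⁻¹' interior K := (e.toHomeomorph.preimage_interior K).symm
  have hK'c : IsCompact (e ⁻¹' K) := e.toHomeomorph.isCompact_preimage.2 hKc
  have hK'i : (interior (e ⁻¹' K)).Nonempty := by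
    rw [hKint]; obtain ⟨x, hx⟩ := hKi; exact ⟨e.symm x, by simpa using hx⟩
  obtain ⟨h, h1, h2, h3⟩ := exists_homeomorph_image_interior_closure_frontier_eq_unitBall
    (hK.linear_preimage e.toLinearMap) hK'i hK'c.isBounded
  change h '' interior (e ⁻¹' K) = _ at h1
  change h '' closure (e ⁻¹' K) = _ at h2
  rw [hK'c.isClosed.closure_eq] at h2
  have hm : Set.MapsTo (fun x => e (h.symm x)) (Disk n) K := by
    intro x hx
    rw [Disk, ← h2] at hx
    obtain ⟨y, hy, rfl⟩ := hx
    simpa using hy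
  have inj : Set.InjOn (fun x => φ (e (h.symm x))) (Disk n) := by
    intro x hx y hy hxy
    have := hinj (hm hx) (hm hy) hxy
    simpa using this
  have im : ∀ S : Set (EuclideanSpace ℝ (Fin n)), (fun x => φ (e (h.symm x))) '' (h '' S)
      = φ '' (e '' S) := by
    intro S; ext y; simp
  have imA : (fun x => φ (e (h.symm x))) '' Disk n = A := by
    rw [Disk, ← h2, im, Set.image_preimage_eq _ e.surjective, hA]
  have imB : (fun x => φ (e (h.symm x))) '' OpenDisk n = B := by
    rw [OpenDisk, ← h1, im, hKint, Set.image_preimage_eq _ e.surjective, hB]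
  refine ⟨fun x => φ (e (h.symm x)), ?_, inj, imA, imB, ?_⟩
  · exact hφ.comp (by fun_prop) hm
  · rw [← imA, ← imB, ← (inj.mono subset_rfl).image_diff_subset Metric.ball_subset_closedBall]
    congr 1
    ext x; simp [le_antisymm_iff]

theorem emb_of {X : Type} [TopologicalSpace X] [T2Space X] {n : ℕ}
    {φ : EuclideanSpace ℝ (Fin n) → X} (h : ContinuousOn φ (Disk n)) (hi : Set.InjOn φ (Disk n)) :
    Topology.IsEmbedding ((Disk n).restrict φ) := by
  haveI : CompactSpace (Disk n) := isCompact_iff_compactSpace.1 (isCompact_closedBall _ _)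
  exact (Continuous.isClosedEmbedding (continuousOn_iff_continuous_restrict.1 h)
    (Set.injOn_iff_injective.1 hi)).isEmbedding

theorem build {ι : Type} [Fintype ι] (d : ι → Fin 4) (Cl Op : ι → Set Sphere3)
    (hcell : ∀ i, IsCell (d i : ℕ) (Cl i) (Op i))
    (hdisj : ∀ i j, i ≠ j → Disjoint (Op i) (Op j))
    (hcov : ∀ x, ∃ i, x ∈ Op i)
    (hbd : ∀ i, ∀ x ∈ Cl i, x ∉ Op i → ∃ j, d j < d i ∧ x ∈ Cl j)
    (hsr : ∀ i j, Cl i ∩ Cl j = ∅ ∨ ∃ k, Cl i ∩ Cl j = Cl k) :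
    ∃ C : FinCellulation3, C.StronglyRegular ∧ ∀ n, C.count n = Nat.card {i // d i = n} := by
  classical
  choose φ h1 h2 h3 h4 h5 using fun i => (hcell i).disk
  let e : ∀ n : Fin 4, Fin (Fintype.card {i // d i = n}) ≃ {i // d i = n} :=
    fun n => (Fintype.equivFin _).symm
  let ch : ∀ n : Fin 4, {i // d i = n} → EuclideanSpace ℝ (Fin (n : ℕ)) → Sphere3 :=
    fun n i => i.2 ▸ φ i.1
  have P : ∀ n (i : {i // d i = n}), ContinuousOn (ch n i) (Disk n) ∧ Set.InjOn (ch n i) (Disk n)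
      ∧ ch n i '' Disk n = Cl i ∧ ch n i '' OpenDisk n = Op i ∧
      ch n i '' DiskBdry n = Cl i \ Op i := by
    rintro n ⟨i, rfl⟩
    exact ⟨h1 i, h2 i, h3 i, h4 i, h5 i⟩
  refine ⟨⟨fun n => Fintype.card {i // d i = n}, fun n i => ch n (e n i), ?_, ?_, ?_, ?_, ?_⟩,
    ⟨?_, ?_⟩, ?_⟩
  · intro n i; exact (P n _).1
  · intro n i
    exact (emb_of (P n _).1 (P n _).2.1).comp
      (Topology.IsEmbedding.inclusion (Metric.ball_subset_closedBall))
  · intro n m i j hij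
    rw [(P _ _).2.2.2.1, (P _ _).2.2.2.1]
    apply hdisj
    intro h
    apply hij
    obtain rfl : n = m := by rw [← (e n i).2, ← (e m j).2, h]
    have := (e n).injective (Subtype.ext h)
    rw [this]
  · rw [Set.eq_univ_iff_forall]
    intro x
    obtain ⟨i, hi⟩ := hcov x
    rw [Set.mem_iUnion]; refine ⟨d i, ?_⟩
    rw [Set.mem_iUnion]; refine ⟨(e _).symm ⟨i, rfl⟩, ?_⟩
    rw [(P _ _).2.2.2.1]; simpa using hi
  · intro n i x hx
    rw [(P _ _).2.2.2.2] at hx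
    obtain ⟨j, hj, hxj⟩ := hbd _ x hx.1 hx.2
    rw [(e n i).2] at hj
    simp only [Set.mem_iUnion]
    refine ⟨d j, hj, (e _).symm ⟨j, rfl⟩, ?_⟩
    rw [(P _ _).2.2.1]; simpa using hxj
  · intro n i
    exact emb_of (P n _).1 (P n _).2.1
  · intro n m i j
    change ch n (e n i) '' _ ∩ ch m (e m j) '' _ = ∅ ∨ ∃ p k,
       ch n (e n i) '' _ ∩ ch m (e m j) '' _ = ch p (e p k) '' _
    rw [(P _ _).2.2.1, (P _ _).2.2.1]
    rcases hsr (e n i) (e m j) with h | ⟨k, hk⟩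
    · exact Or.inl h
    · refine Or.inr ⟨d k, (e _).symm ⟨k, rfl⟩, ?_⟩
      rw [(P _ _).2.2.1, hk]; simp
  · intro n; simp [Nat.card_eq_fintype_card]
end

noncomputable section
set_option linter.unusedSectionVars false
open Classical

namespace Arr
variable {V : Type} [AddCommGroup V] [Module ℝ V] {ι : Type} [Fintype ι] (f : ι → V →ₗ[ℝ] ℝ)

/-- Sign vector of a point with respect to an arrangement. -/
def sg (x : V) : ι → SignType := fun i => SignType.sign (f i x)

/-- Face order on sign vectors. -/
def Sub (σ τ : ι → SignType) : Prop := ∀ i, σ i = 0 ∨ σ i = τ i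

/-- Chosen representative of a sign vector. -/
def bp (σ : ι → SignType) : V := if h : ∃ x, sg f x = σ then h.choose else 0

theorem sg_bp (x : V) : sg f (bp f (sg f x)) = sg f x := by
  have h : ∃ y, sg f y = sg f x := ⟨x, rfl⟩
  rw [bp, dif_pos h]; exact h.choose_spec

/-- Realizable nonzero sign vectors. -/
def Real (σ : ι → SignType) : Prop := sg f (bp f σ) = σ ∧ σ ≠ 0

theorem Sub.refl (σ : ι → SignType) : Sub σ σ := fun _ => Or.inr rfl
theorem Sub.trans {σ τ ρ : ι → SignType} (h : Sub σ τ) (h' : Sub τ ρ) : Sub σ ρ := by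
  intro i
  rcases h i with h1 | h1
  · exact Or.inl h1
  · rcases h' i with h2 | h2
    · left; rw [h1, h2]
    · right; rw [h1, h2]
theorem Sub.antisymm {σ τ : ι → SignType} (h : Sub σ τ) (h' : Sub τ σ) : σ = τ := by
  funext i
  rcases h i with h1 | h1
  · rcases h' i with h2 | h2
    · rw [h1, h2]
    · rw [h2]
  · exact h1

/-- Single coefficient. -/
abbrev sing (σ : ι → SignType) (μ : ℝ) : (ι → SignType) → ℝ := Pi.single σ μ

/-- Valid coefficient systems. -/
structure Val (c : (ι → SignType) → ℝ) : Prop where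
  nn : ∀ σ, 0 ≤ c σ
  re : ∀ σ, c σ ≠ 0 → Real f σ
  ch : ∀ σ τ, c σ ≠ 0 → c τ ≠ 0 → Sub σ τ ∨ Sub τ σ

/-- Linear combination of representatives. -/
def comb (c : (ι → SignType) → ℝ) : V := ∑ σ, c σ • bp f σ

theorem exists_max (s : Finset (ι → SignType)) (hs : s.Nonempty)
    (hc : ∀ σ ∈ s, ∀ τ ∈ s, Sub σ τ ∨ Sub τ σ) : ∃ τ ∈ s, ∀ σ ∈ s, Sub σ τ := by
  induction hs using Finset.Nonempty.cons_induction with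
  | singleton a => exact ⟨a, by simp, by simp [Sub.refl]⟩
  | cons a s ha hs ih =>
    obtain ⟨τ, hτ, hm⟩ := ih (fun σ hσ τ hτ => hc σ (Finset.mem_cons_of_mem hσ) τ
      (Finset.mem_cons_of_mem hτ))
    rcases hc a (Finset.mem_cons_self _ _) τ (Finset.mem_cons_of_mem hτ) with h | h
    · refine ⟨τ, Finset.mem_cons_of_mem hτ, ?_⟩
      intro σ hσ
      rcases Finset.mem_cons.1 hσ with rfl | hσ
      · exact h
      · exact hm σ hσ
    · refine ⟨a, Finset.mem_cons_self _ _, ?_⟩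
      intro σ hσ
      rcases Finset.mem_cons.1 hσ with rfl | hσ
      · exact Sub.refl _
      · exact (hm σ hσ).trans h

variable {f}

theorem Val.sg_comb {c : (ι → SignType) → ℝ} (hc : Val f c) {τ : ι → SignType} (hτ : c τ ≠ 0)
    (hm : ∀ σ, c σ ≠ 0 → Sub σ τ) : sg f (comb f c) = τ := by
  funext i
  have hterm : ∀ σ, c σ ≠ 0 → SignType.sign (f i (bp f σ)) = σ i := fun σ h =>
    congrFun (hc.re σ h).1 i
  have hfi : f i (comb f c) = ∑ σ, c σ * f i (bp f σ) := by simp [comb]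
  rw [sg, hfi]
  have hpos : 0 < c τ := lt_of_le_of_ne (hc.nn τ) (Ne.symm hτ)
  have ht := hterm τ hτ
  rcases hτi : τ i with _ | _ | _
  · change _ = (0 : SignType)
    rw [sign_eq_zero_iff]
    apply Finset.sum_eq_zero
    intro σ _
    by_cases h : c σ = 0
    · simp [h]
    · have : σ i = 0 := by
        rcases hm σ h i with h | h
        · exact h
        · rw [h, hτi]; rfl
      have h2 := hterm σ h
      rw [this, sign_eq_zero_iff] at h2
      simp [h2]
  · change _ = (-1 : SignType)
    rw [sign_eq_neg_one_iff]
    apply Finset.sum_neg'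
    · intro σ _
      by_cases h : c σ = 0
      · simp [h]
      · have h2 := hterm σ h
        apply mul_nonpos_of_nonneg_of_nonpos (hc.nn σ)
        rcases hm σ h i with h' | h'
        · rw [h', sign_eq_zero_iff] at h2; exact h2.le
        · rw [h', hτi] at h2; exact (sign_eq_neg_one_iff.1 h2).le
    · refine ⟨τ, Finset.mem_univ _, ?_⟩
      rw [hτi] at ht
      exact mul_neg_of_pos_of_neg hpos (sign_eq_neg_one_iff.1 ht)
  · change _ = (1 : SignType)
    rw [sign_eq_one_iff]
    apply Finset.sum_pos'
    · intro σ _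
      by_cases h : c σ = 0
      · simp [h]
      · have h2 := hterm σ h
        apply mul_nonneg (hc.nn σ)
        rcases hm σ h i with h' | h'
        · rw [h', sign_eq_zero_iff] at h2; exact h2.ge
        · rw [h', hτi] at h2; exact (sign_eq_one_iff.1 h2).le
    · refine ⟨τ, Finset.mem_univ _, ?_⟩
      rw [hτi] at ht
      exact mul_pos hpos (sign_eq_one_iff.1 ht)

theorem Val.sg_comb' {c : (ι → SignType) → ℝ} (hc : Val f c) (h0 : c ≠ 0) :
    c (sg f (comb f c)) ≠ 0 ∧ ∀ σ, c σ ≠ 0 → Sub σ (sg f (comb f c)) := by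
  obtain ⟨τ, hτ, hm⟩ := exists_max (Finset.univ.filter (fun σ => c σ ≠ 0))
    (by obtain ⟨σ, hσ⟩ := Function.ne_iff.1 h0; exact ⟨σ, by simpa using hσ⟩)
    (fun σ hσ τ hτ => hc.ch σ τ (by simpa using hσ) (by simpa using hτ))
  have hτ' : c τ ≠ 0 := by simpa using hτ
  have hm' : ∀ σ, c σ ≠ 0 → Sub σ τ := fun σ h => hm σ (by simpa using h)
  rw [hc.sg_comb hτ' hm']
  exact ⟨hτ', hm'⟩

theorem sg_zero : sg f 0 = 0 := by funext i; simp [sg]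

theorem Val.comb_eq_zero {c : (ι → SignType) → ℝ} (hc : Val f c) (h : comb f c = 0) : c = 0 := by
  by_contra h0
  have := (hc.sg_comb' h0).1
  rw [h, sg_zero] at this
  exact (hc.re _ this).2 rfl

theorem Val.sub {c : (ι → SignType) → ℝ} (hc : Val f c) (σ : ι → SignType) {μ : ℝ}
    (h0 : 0 ≤ μ) (hμ : μ ≤ c σ) : Val f (c - sing σ μ) := by
  have key : ∀ τ, (c - sing σ μ) τ ≠ 0 → c τ ≠ 0 := by
    intro τ h h'
    apply h
    by_cases e : τ = σ
    · subst e
      have : μ = 0 := le_antisymm (by linarith) h0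
      simp [h', this]
    · simp [e, h']
  refine ⟨?_, fun τ h => hc.re τ (key τ h), fun τ τ' h h' => hc.ch τ τ' (key τ h) (key τ' h')⟩
  intro τ
  by_cases e : τ = σ
  · subst e; simpa using hμ
  · simpa [e] using hc.nn τ

theorem comb_sub (c : (ι → SignType) → ℝ) (σ : ι → SignType) (μ : ℝ) :
    comb f (c - sing σ μ) = comb f c - μ • bp f σ := by
  simp only [comb, Pi.sub_apply, sub_smul, Finset.sum_sub_distrib]
  congr 1
  rw [Finset.sum_eq_single σ]
  · simp
  · intro τ _ h; simp [h]
  · simp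

theorem Val.unique : ∀ (n : ℕ) {c c' : (ι → SignType) → ℝ}, Val f c → Val f c' →
    comb f c = comb f c' →
    (Finset.univ.filter (fun σ => c σ ≠ 0)).card + (Finset.univ.filter (fun σ => c' σ ≠ 0)).card ≤ n
    → c = c' := by
  intro n
  induction n with
  | zero =>
    intro c c' _ _ _ h
    have h1 : (Finset.univ.filter (fun σ => c σ ≠ 0)).card = 0 := by omega
    have h2 : (Finset.univ.filter (fun σ => c' σ ≠ 0)).card = 0 := by omega
    rw [Finset.card_eq_zero, Finset.filter_eq_empty_iff] at h1 h2
    funext σ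
    have := @h1 σ (Finset.mem_univ _); have := @h2 σ (Finset.mem_univ _)
    simp_all
  | succ n ih =>
    have main : ∀ {c c' : (ι → SignType) → ℝ}, Val f c → Val f c' → comb f c = comb f c' →
      (Finset.univ.filter (fun σ => c σ ≠ 0)).card +
        (Finset.univ.filter (fun σ => c' σ ≠ 0)).card ≤ n + 1 →
      ∀ τ, c τ ≠ 0 → c τ ≤ c' τ → c = c' := by
      intro c c' hc hc' he hn τ h0 hle
      have := ih (hc.sub τ (hc.nn τ) le_rfl) (hc'.sub τ (hc.nn τ) hle)
        (by rw [comb_sub, comb_sub, he]) ?_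
      · have := congrArg (fun g => g + sing τ (c τ)) this
        simpa using this
      · have l1 : (Finset.univ.filter (fun σ => (c - sing τ (c τ)) σ ≠ 0)).card <
            (Finset.univ.filter (fun σ => c σ ≠ 0)).card := by
          apply Finset.card_lt_card
          refine ⟨?_, ?_⟩
          · intro σ hσ
            simp only [Finset.mem_filter, Finset.mem_univ, true_and] at hσ ⊢
            intro h
            by_cases e : σ = τ
            · exact h0 (e ▸ h)
            · apply hσ; simp [e, h]
          · intro h
            have := @h τ (by simpa using h0)
            simp at this
        have l2 : (Finset.univ.filter (fun σ => (c' - sing τ (c τ)) σ ≠ 0)).card ≤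
            (Finset.univ.filter (fun σ => c' σ ≠ 0)).card := by
          apply Finset.card_le_card
          intro σ hσ
          simp only [Finset.mem_filter, Finset.mem_univ, true_and] at hσ ⊢
          intro h
          by_cases e : σ = τ
          · subst e
            have := hc.nn σ
            exact h0 (le_antisymm (by linarith) this)
          · apply hσ; simp [e, h]
        omega
    intro c c' hc hc' he hn
    by_cases h0 : c = 0
    · subst h0
      have : comb f c' = 0 := by rw [← he]; simp [comb]
      exact (hc'.comb_eq_zero this).symm
    by_cases h0' : c' = 0
    · subst h0'
      have : comb f c = 0 := by rw [he]; simp [comb]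
      exact hc.comb_eq_zero this
    have t1 := (hc.sg_comb' h0).1
    have t2 := (hc'.sg_comb' h0').1
    rw [← he] at t2
    rcases le_total (c (sg f (comb f c))) (c' (sg f (comb f c))) with h | h
    · exact main hc hc' he hn _ t1 h
    · exact (main hc' hc he.symm (by omega) _ t2 h).symm

theorem Val.uniq {c c' : (ι → SignType) → ℝ} (hc : Val f c) (hc' : Val f c')
    (he : comb f c = comb f c') : c = c' := Val.unique _ hc hc' he le_rfl

theorem Val.exists (hsep : ∀ x, (∀ i, f i x = 0) → x = 0) : ∀ (n : ℕ) (x : V),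
    (Finset.univ.filter (fun i => f i x ≠ 0)).card ≤ n →
    ∃ c, Val f c ∧ comb f c = x := by
  intro n
  induction n with
  | zero =>
    intro x h
    have h1 : (Finset.univ.filter (fun i => f i x ≠ 0)).card = 0 := by omega
    rw [Finset.card_eq_zero, Finset.filter_eq_empty_iff] at h1
    have : x = 0 := hsep x (fun i => by simpa using h1 (Finset.mem_univ i))
    exact ⟨0, ⟨by simp, by simp, by simp⟩, by simp [comb, this]⟩
  | succ n ih =>
    intro x hn
    by_cases hx : x = 0
    · exact ⟨0, ⟨by simp, by simp, by simp⟩, by simp [comb, hx]⟩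
    have hne : (Finset.univ.filter (fun i => f i x ≠ 0)).Nonempty := by
      by_contra h
      apply hx; apply hsep
      intro i
      by_contra h'
      exact h ⟨i, by simpa using h'⟩
    set σ := sg f x with hσ
    have hb : sg f (bp f σ) = σ := sg_bp f x
    have hbi : ∀ i, SignType.sign (f i (bp f σ)) = SignType.sign (f i x) := fun i => congrFun hb i
    obtain ⟨i0, hi0, hmin⟩ := Finset.exists_min_image _ (fun i => f i x / f i (bp f σ)) hne
    simp only [Finset.mem_filter, Finset.mem_univ, true_and] at hi0 hmin
    set μ := f i0 x / f i0 (bp f σ) with hμ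
    have hpos : ∀ i, f i x ≠ 0 → 0 < f i x / f i (bp f σ) := by
      intro i hi
      have := hbi i
      rcases lt_or_gt_of_ne hi with h | h
      · rw [sign_neg h, sign_eq_neg_one_iff] at this
        exact div_pos_of_neg_of_neg h this
      · rw [sign_pos h, sign_eq_one_iff] at this
        exact div_pos h this
    have hμ0 : 0 < μ := hpos i0 hi0
    have hzero : ∀ i, f i x = 0 → f i (x - μ • bp f σ) = 0 := by
      intro i hi
      have := hbi i
      rw [hi, sign_zero, sign_eq_zero_iff] at this
      simp [hi, this]
    have hi0z : f i0 (x - μ • bp f σ) = 0 := by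
      have : f i0 (bp f σ) ≠ 0 := by
        intro h
        have := hpos i0 hi0
        rw [h] at this; simp at this
      simp [hμ, this]
    have hsub : Sub (sg f (x - μ • bp f σ)) σ := by
      intro i
      by_cases hi : f i x = 0
      · left; simp only [sg]; rw [hzero i hi]; simp
      · have hm := hmin i hi
        have hs := hbi i
        simp only [sg, hσ, map_sub, map_smul, smul_eq_mul]
        rcases lt_or_gt_of_ne hi with h | h
        · rw [sign_neg h, sign_eq_neg_one_iff] at hs
          rw [le_div_iff_of_neg hs] at hm
          rcases eq_or_lt_of_le hm with e | e
          · left; rw [sign_eq_zero_iff]; linarith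
          · right; rw [sign_neg h, sign_eq_neg_one_iff]; linarith
        · rw [sign_pos h, sign_eq_one_iff] at hs
          rw [le_div_iff₀ hs] at hm
          rcases eq_or_lt_of_le hm with e | e
          · left; rw [sign_eq_zero_iff]; linarith
          · right; rw [sign_pos h, sign_eq_one_iff]; linarith
    obtain ⟨c, hc, hcx⟩ := ih (x - μ • bp f σ) (by
      have : (Finset.univ.filter (fun i => f i (x - μ • bp f σ) ≠ 0)).card <
          (Finset.univ.filter (fun i => f i x ≠ 0)).card := by
        apply Finset.card_lt_card
        refine ⟨?_, ?_⟩
        · intro i hi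
          simp only [Finset.mem_filter, Finset.mem_univ, true_and] at hi ⊢
          exact fun h => hi (hzero i h)
        · intro h
          have := @h i0 (by simpa using hi0)
          simp only [Finset.mem_filter, Finset.mem_univ, true_and] at this
          exact this hi0z
      omega)
    have hσ0 : σ ≠ 0 := by
      intro h
      have := congrFun h i0
      simp only [hσ, sg, Pi.zero_apply, sign_eq_zero_iff] at this
      exact hi0 this
    have hsup : ∀ τ, c τ ≠ 0 → Sub τ σ := by
      intro τ hτ
      have := (hc.sg_comb' (by rintro rfl; exact hτ rfl)).2 τ hτ
      rw [hcx] at this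
      exact this.trans hsub
    have key : ∀ τ, (c + sing σ μ) τ ≠ 0 → τ = σ ∨ c τ ≠ 0 := by
      intro τ h
      by_cases e : τ = σ
      · exact Or.inl e
      · right; simpa [e] using h
    refine ⟨c + sing σ μ, ⟨?_, ?_, ?_⟩, ?_⟩
    · intro τ
      have := hc.nn τ
      by_cases e : τ = σ
      · subst e; simp; linarith
      · simpa [e] using this
    · intro τ h
      rcases key τ h with rfl | h
      · exact ⟨hb, hσ0⟩
      · exact hc.re τ h
    · intro τ τ' h h'
      rcases key τ h with rfl | h
      · rcases key τ' h' with rfl | h'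
        · exact Or.inl (Sub.refl _)
        · exact Or.inr (hsup _ h')
      · rcases key τ' h' with rfl | h'
        · exact Or.inl (hsup _ h)
        · exact hc.ch τ τ' h h'
    · have := comb_sub (f := f) (c + sing σ μ) σ μ
      rw [add_sub_cancel_right, hcx] at this
      exact (sub_left_inj.1 this).symm
end Arr
end

noncomputable section
set_option linter.unusedSectionVars false
open Classical

theorem poly_convex {E J : Type} [NormedAddCommGroup E] [NormedSpace ℝ E]
    (l : J → E →L[ℝ] ℝ) (c : J → ℝ) : Convex ℝ {x | ∀ j, 0 ≤ l j x + c j} := by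
  intro x hx y hy a b ha hb hab j
  have h1 := hx j; have h2 := hy j
  have : c j = a * c j + b * c j := by rw [← add_mul, hab, one_mul]
  rw [map_add, map_smul, map_smul, smul_eq_mul, smul_eq_mul, this]
  nlinarith [mul_nonneg ha h1, mul_nonneg hb h2]

theorem poly_closed {E J : Type} [NormedAddCommGroup E] [NormedSpace ℝ E]
    (l : J → E →L[ℝ] ℝ) (c : J → ℝ) : IsClosed {x | ∀ j, 0 ≤ l j x + c j} := by
  have : {x | ∀ j, 0 ≤ l j x + c j} = ⋂ j, {x | 0 ≤ l j x + c j} := by ext; simp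
  rw [this]
  exact isClosed_iInter fun j => isClosed_le continuous_const (by fun_prop)

theorem poly_interior {E J : Type} [Finite J] [NormedAddCommGroup E] [NormedSpace ℝ E]
    (l : J → E →L[ℝ] ℝ) (c : J → ℝ) (h : ∀ j, l j = 0 → 0 < c j) :
    interior {x | ∀ j, 0 ≤ l j x + c j} = {x | ∀ j, 0 < l j x + c j} := by
  have : {x | ∀ j, 0 ≤ l j x + c j} = ⋂ j, {x | 0 ≤ l j x + c j} := by ext; simp
  rw [this, interior_iInter_of_finite]
  have : {x | ∀ j, 0 < l j x + c j} = ⋂ j, {x | 0 < l j x + c j} := by ext; simp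
  rw [this]
  congr 1; funext j
  by_cases hj : l j = 0
  · have := h j hj
    simp [hj, this, this.le]
  · have ho := (l j).isOpenMap_of_ne_zero hj
    have e1 : {x | 0 ≤ l j x + c j} = l j ⁻¹' Set.Ici (- c j) := by
      ext x; simp only [Set.mem_ofPred_eq, Set.mem_preimage, Set.mem_Ici]; constructor <;> intro h <;> linarith
    have e2 : {x | 0 < l j x + c j} = l j ⁻¹' Set.Ioi (- c j) := by
      ext x; simp only [Set.mem_ofPred_eq, Set.mem_preimage, Set.mem_Ioi]; constructor <;> intro h <;> linarith
    rw [e1, e2, ← ho.preimage_interior_eq_interior_preimage (l j).continuous, interior_Ici]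

/-- Four-dimensional Euclidean space. -/
abbrev E4 := EuclideanSpace ℝ (Fin 4)

/-- A base point on the sphere. -/
def basePt : Sphere3 := ⟨EuclideanSpace.single 0 1, by simp⟩

/-- Radial projection. -/
def nrm (v : E4) : Sphere3 := if h : v = 0 then basePt else
  ⟨‖v‖⁻¹ • v, by
    have : ‖v‖ ≠ 0 := norm_ne_zero_iff.2 h
    simp [norm_smul, this]⟩

theorem nrm_coe {v : E4} (h : v ≠ 0) : (nrm v : E4) = ‖v‖⁻¹ • v := by simp [nrm, h]

theorem nrm_continuousOn : ContinuousOn nrm {v | v ≠ 0} := by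
  rw [continuousOn_iff_continuous_domRestrict, continuous_induced_rng]
  have : (Subtype.val ∘ ({v : E4 | v ≠ 0}).domRestrict nrm) = fun v : {v : E4 | v ≠ 0} => ‖(v : E4)‖⁻¹ • (v : E4) := by
    funext v; exact nrm_coe v.2
  rw [this]
  have h : ∀ v : {v : E4 | v ≠ 0}, ‖(v : E4)‖ ≠ 0 := fun v => norm_ne_zero_iff.2 v.2
  exact (Continuous.inv₀ (by fun_prop) h).smul (by fun_prop)

theorem sphere_ne_zero (x : Sphere3) : (x : E4) ≠ 0 := by
  intro h
  have := x.2
  rw [h] at this; simp at this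

theorem nrm_smul_sphere (x : Sphere3) {r : ℝ} (hr : 0 < r) : nrm (r • (x : E4)) = x := by
  apply Subtype.ext
  rw [nrm_coe (smul_ne_zero hr.ne' (sphere_ne_zero x)), norm_smul, norm_eq_of_mem_sphere]
  simp [abs_of_pos hr, smul_smul, hr.ne']

theorem nrm_eq {v w : E4} (hv : v ≠ 0) (hw : w ≠ 0) (h : nrm v = nrm w) :
    ∃ r : ℝ, 0 < r ∧ v = r • w := by
  have h1 := congrArg Subtype.val h
  rw [nrm_coe hv, nrm_coe hw] at h1
  have pv : 0 < ‖v‖ := norm_pos_iff.2 hv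
  have pw : 0 < ‖w‖ := norm_pos_iff.2 hw
  refine ⟨‖v‖ * ‖w‖⁻¹, by positivity, ?_⟩
  rw [mul_smul, ← h1, smul_smul, mul_inv_cancel₀ pv.ne', one_smul]

namespace Arr
section
variable {V : Type} [AddCommGroup V] [Module ℝ V] {ι : Type} [Fintype ι] (f : ι → V →ₗ[ℝ] ℝ)

/-- The arrangement separates points. -/
def Sep : Prop := ∀ x, (∀ i, f i x = 0) → x = 0

/-- Coordinates of a point. -/
def co (x : V) : (ι → SignType) → ℝ := if h : ∃ c, Val f c ∧ comb f c = x then h.choose else 0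

/-- Support of a point. -/
def supp (x : V) : Finset (ι → SignType) := Finset.univ.filter (fun σ => co f x σ ≠ 0)

variable {f}

theorem mem_supp {x : V} {σ : ι → SignType} : σ ∈ supp f x ↔ co f x σ ≠ 0 := by simp [supp]

theorem Sep.co_spec (h : Sep f) (x : V) : Val f (co f x) ∧ comb f (co f x) = x := by
  have := Val.exists h _ x le_rfl
  rw [co, dif_pos this]; exact this.choose_spec

theorem Sep.co_comb (h : Sep f) {c : (ι → SignType) → ℝ} (hc : Val f c) :
    co f (comb f c) = c := (h.co_spec _).1.uniq hc (h.co_spec _).2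

theorem comb_smul (r : ℝ) (c : (ι → SignType) → ℝ) : comb f (r • c) = r • comb f c := by
  simp [comb, Finset.smul_sum, mul_smul]

theorem Val.smul {c : (ι → SignType) → ℝ} (hc : Val f c) {r : ℝ} (hr : 0 ≤ r) :
    Val f (r • c) := by
  have : ∀ σ, (r • c) σ ≠ 0 → c σ ≠ 0 := fun σ h h' => h (by simp [h'])
  exact ⟨fun σ => mul_nonneg hr (hc.nn σ), fun σ h => hc.re σ (this σ h),
    fun σ τ h h' => hc.ch σ τ (this σ h) (this τ h')⟩

theorem Sep.co_smul (h : Sep f) (x : V) {r : ℝ} (hr : 0 ≤ r) : co f (r • x) = r • co f x := by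
  have := h.co_comb ((h.co_spec x).1.smul hr)
  rwa [comb_smul, (h.co_spec x).2] at this

theorem Sep.supp_smul (h : Sep f) (x : V) {r : ℝ} (hr : 0 < r) : supp f (r • x) = supp f x := by
  ext σ; simp [mem_supp, h.co_smul x hr.le, hr.ne']

theorem Sep.co_ne (h : Sep f) {x : V} (hx : x ≠ 0) : co f x ≠ 0 := by
  intro h0
  apply hx
  rw [← (h.co_spec x).2, h0]; simp [comb]

theorem Sep.sg_mem (h : Sep f) {x : V} (hx : x ≠ 0) :
    sg f x ∈ supp f x ∧ ∀ σ ∈ supp f x, Sub σ (sg f x) := by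
  have := (h.co_spec x).1.sg_comb' (h.co_ne hx)
  rw [(h.co_spec x).2] at this
  exact ⟨mem_supp.2 this.1, fun σ hσ => this.2 σ (mem_supp.1 hσ)⟩

variable (f)
/-- Simplices: nonempty chains of realizable sign vectors. -/
structure Spx (s : Finset (ι → SignType)) : Prop where
  ne : s.Nonempty
  re : ∀ σ ∈ s, Real f σ
  ch : ∀ σ ∈ s, ∀ τ ∈ s, Sub σ τ ∨ Sub τ σ
variable {f}

theorem Spx.subset {s t : Finset (ι → SignType)} (h : Spx f s) (hts : t ⊆ s) (ht : t.Nonempty) :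
    Spx f t := ⟨ht, fun σ hσ => h.re σ (hts hσ), fun σ hσ τ hτ => h.ch σ (hts hσ) τ (hts hτ)⟩

theorem Sep.spx_supp (h : Sep f) {x : V} (hx : x ≠ 0) : Spx f (supp f x) :=
  ⟨⟨_, (h.sg_mem hx).1⟩, fun σ hσ => (h.co_spec x).1.re σ (mem_supp.1 hσ),
    fun σ hσ τ hτ => (h.co_spec x).1.ch σ τ (mem_supp.1 hσ) (mem_supp.1 hτ)⟩

theorem Spx.val {s : Finset (ι → SignType)} (h : Spx f s) {c : (ι → SignType) → ℝ}
    (h0 : ∀ σ, 0 ≤ c σ) (h1 : ∀ σ, σ ∉ s → c σ = 0) : Val f c := by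
  have : ∀ σ, c σ ≠ 0 → σ ∈ s := fun σ => not_imp_comm.1 (h1 σ)
  exact ⟨h0, fun σ hσ => h.re σ (this σ hσ), fun σ τ hσ hτ => h.ch σ (this σ hσ) τ (this τ hτ)⟩

theorem Spx.linInd {s : Finset (ι → SignType)} (h : Spx f s) :
    LinearIndependent ℝ (fun σ : s => bp f (σ : ι → SignType)) := by
  rw [Fintype.linearIndependent_iff]
  intro g hg
  let c : (ι → SignType) → ℝ := fun σ => if h : σ ∈ s then max (g ⟨σ, h⟩) 0 else 0
  let c' : (ι → SignType) → ℝ := fun σ => if h : σ ∈ s then max (-g ⟨σ, h⟩) 0 else 0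
  have hc : Val f c := h.val (fun σ => by simp only [c]; split_ifs <;> simp)
    (fun σ hσ => by simp [c, hσ])
  have hc' : Val f c' := h.val (fun σ => by simp only [c']; split_ifs <;> simp)
    (fun σ hσ => by simp [c', hσ])
  have key : comb f c - comb f c' = 0 := by
    rw [← hg, comb, comb, ← Finset.sum_sub_distrib]
    rw [← Finset.sum_subset (Finset.subset_univ s)
      (fun σ _ hσ => by simp [c, c', hσ]), ← Finset.sum_coe_sort]
    refine Finset.sum_congr rfl fun σ _ => ?_
    simp only [c, c', σ.2, dif_pos, ← sub_smul]
    congr 1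
    rcases le_total (g σ) 0 with h | h
    · rw [max_eq_right h, max_eq_left (by linarith)]; ring
    · rw [max_eq_left h, max_eq_right (by linarith)]; ring
  have := hc.uniq hc' (sub_eq_zero.1 key)
  intro σ
  have := congrFun this σ.1
  simp only [c, c', σ.2, dif_pos] at this
  rcases le_total (g σ) 0 with h | h
  · rw [max_eq_right h, max_eq_left (by linarith)] at this; simpa using this.symm
  · rw [max_eq_left h, max_eq_right (by linarith)] at this; exact this

theorem Spx.codim [FiniteDimensional ℝ V] {s : Finset (ι → SignType)} (hs : Sep f) (h : Spx f s)
    {x : V} (hx : supp f x = s) {k : ℕ} (g : Fin k → ι)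
    (hg : LinearIndependent ℝ (fun j => f (g j))) (hz : ∀ j, f (g j) x = 0) :
    s.card + k ≤ Module.finrank ℝ V := by
  have hx0 : x ≠ 0 := by
    rintro rfl
    obtain ⟨σ, hσ⟩ := h.ne
    rw [← hx, mem_supp] at hσ
    have : co f (0 : V) = 0 := by have := hs.co_smul (0 : V) (le_refl 0); simpa using this
    rw [this] at hσ; exact hσ rfl
  have hb : ∀ σ : s, bp f (σ : ι → SignType) ∈
      (Submodule.span ℝ (Set.range fun j => f (g j)) : Submodule ℝ (Module.Dual ℝ V)).dualCoannihilator := by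
    intro σ
    rw [Submodule.mem_dualCoannihilator]
    intro φ hφ
    have key : ∀ j, f (g j) (bp f (σ : ι → SignType)) = 0 := by
      intro j
      have h1 : sg f x (g j) = 0 := by simp [sg, hz j]
      have h2 := (hs.sg_mem hx0).2 σ (by rw [hx]; exact σ.2) (g j)
      rw [h1, or_self] at h2
      have h3 := congrFun (h.re σ σ.2).1 (g j)
      rw [h2] at h3
      exact sign_eq_zero_iff.1 h3
    induction hφ using Submodule.span_induction with
    | mem y hy => obtain ⟨j, rfl⟩ := hy; exact key j
    | zero => rfl
    | add y z _ _ hy hz => simp [hy, hz]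
    | smul a y _ hy => simp [hy]
  set W := (Submodule.span ℝ (Set.range fun j => f (g j)) : Submodule ℝ (Module.Dual ℝ V))
  have li : LinearIndependent ℝ (fun σ : s => (⟨bp f (σ : ι → SignType), hb σ⟩ :
      W.dualCoannihilator)) := by
    apply LinearIndependent.of_comp W.dualCoannihilator.subtype
    exact h.linInd
  have c1 := li.fintype_card_le_finrank
  have c2 := Subspace.finrank_add_finrank_dualCoannihilator_eq W
  have c3 := finrank_span_eq_card hg
  have c3' : Module.finrank ℝ W = k := by simpa using c3
  rw [Fintype.card_coe] at c1
  omega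
end

section
variable {ι : Type} [Fintype ι] (f : ι → E4 →ₗ[ℝ] ℝ)

/-- Closed simplex on the sphere. -/
def SCl (s : Finset (ι → SignType)) : Set Sphere3 := {x | supp f (x : E4) ⊆ s}
/-- Open simplex on the sphere. -/
def SOp (s : Finset (ι → SignType)) : Set Sphere3 := {x | supp f (x : E4) = s}
variable {f}

theorem comb_continuous : Continuous (comb f) := by
  unfold comb; fun_prop

theorem Spx.isCell {s : Finset (ι → SignType)} (hs : Sep f) (h : Spx f s) :
    IsCell (s.card - 1) (SCl f s) (SOp f s) := by
  obtain ⟨σ0, h0⟩ := h.ne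
  let J := {σ // σ ∈ s.erase σ0}
  let l : Option J → (J → ℝ) →L[ℝ] ℝ := fun o => match o with
    | none => - ∑ j : J, ContinuousLinearMap.proj j
    | some j => ContinuousLinearMap.proj j
  let cc : Option J → ℝ := fun o => match o with
    | none => 1
    | some _ => 0
  let K : Set (J → ℝ) := {y | ∀ o, 0 ≤ l o y + cc o}
  have hl : ∀ o, l o = 0 → 0 < cc o := by
    rintro (_ | j) ho
    · simp [cc]
    · have := congrArg (fun g : (J → ℝ) →L[ℝ] ℝ => g (fun _ => 1)) ho
      simp [l] at this
  have mK : ∀ y, y ∈ K ↔ (∀ j, 0 ≤ y j) ∧ ∑ j, y j ≤ 1 := by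
    intro y
    simp only [K, Set.mem_ofPred_eq, Option.forall, l, cc]
    simp; tauto
  have mI : ∀ y, y ∈ interior K ↔ (∀ j, 0 < y j) ∧ ∑ j, y j < 1 := by
    intro y
    rw [poly_interior l cc hl]
    simp only [Set.mem_ofPred_eq, Option.forall, l, cc]
    simp; tauto
  let cy : (J → ℝ) → (ι → SignType) → ℝ := fun y σ =>
    if h : σ ∈ s.erase σ0 then y ⟨σ, h⟩ else if σ = σ0 then 1 - ∑ j, y j else 0
  have cyc : Continuous cy := by
    apply continuous_pi
    intro σ
    simp only [cy]
    split_ifs <;> fun_prop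
  have cyj : ∀ y (j : J), cy y j = y j := fun y j => by
    have := j.2
    simp only [cy, dif_pos this]; rfl
  have cy0 : ∀ y, cy y σ0 = 1 - ∑ j, y j := fun y => by simp [cy]
  have cyn : ∀ y, ∀ σ ∉ s, cy y σ = 0 := by
    intro y σ hσ
    have : σ ≠ σ0 := by rintro rfl; exact hσ h0
    simp [cy, hσ, this]
  have scase : ∀ σ ∈ s, σ = σ0 ∨ ∃ j : J, σ = j := by
    intro σ hσ
    by_cases e : σ = σ0
    · exact Or.inl e
    · exact Or.inr ⟨⟨σ, by simp [e, hσ]⟩, rfl⟩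
  have sumcy : ∀ c : (ι → SignType) → ℝ, (∀ σ ∉ s, c σ = 0) →
      ∑ σ, c σ = c σ0 + ∑ j : J, c j := by
    intro c hc
    rw [← Finset.sum_subset (Finset.subset_univ s) (fun σ _ hσ => hc σ hσ),
      ← Finset.add_sum_erase s _ h0, ← Finset.sum_coe_sort (s.erase σ0)]
  have cys : ∀ y, ∑ σ, cy y σ = 1 := by
    intro y
    rw [sumcy _ (cyn y), cy0]
    simp [cyj]
  have cyv : ∀ y ∈ K, Val f (cy y) := by
    intro y hy
    rw [mK] at hy
    refine h.val ?_ (cyn y)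
    intro σ
    by_cases hσ : σ ∈ s
    · rcases scase σ hσ with rfl | ⟨j, rfl⟩
      · rw [cy0]; linarith [hy.2]
      · rw [cyj]; exact hy.1 j
    · rw [cyn y σ hσ]
  have cyne : ∀ y ∈ K, comb f (cy y) ≠ 0 := by
    intro y hy h0
    have := (cyv y hy).comb_eq_zero h0
    have := cys y
    simp_all
  have cysupp : ∀ y ∈ K, ∀ x : Sphere3, nrm (comb f (cy y)) = x →
      ∀ σ, σ ∈ supp f (x : E4) ↔ cy y σ ≠ 0 := by
    rintro y hy x rfl σ
    rw [nrm_coe (cyne y hy), hs.supp_smul _ (inv_pos.2 (norm_pos_iff.2 (cyne y hy))),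
      mem_supp, hs.co_comb (cyv y hy)]
  have surj : ∀ x ∈ SCl f s, ∃ y ∈ K, nrm (comb f (cy y)) = x := by
    intro x hx
    obtain ⟨hv, hcx⟩ := hs.co_spec (x : E4)
    have hout : ∀ σ ∉ s, co f (x : E4) σ = 0 := by
      intro σ hσ
      by_contra hne
      exact hσ (hx (mem_supp.2 hne))
    set S := ∑ σ, co f (x : E4) σ with hS
    have hSpos : 0 < S := by
      obtain ⟨σ, hσ⟩ := Function.ne_iff.1 (hs.co_ne (sphere_ne_zero x))
      apply Finset.sum_pos' (fun σ _ => hv.nn σ)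
      exact ⟨σ, Finset.mem_univ _, lt_of_le_of_ne (hv.nn σ) (Ne.symm hσ)⟩
    have hS2 := sumcy _ hout
    have ey : cy (fun j => S⁻¹ * co f (x : E4) j) = S⁻¹ • co f (x : E4) := by
      funext σ
      by_cases hσ : σ ∈ s
      · rcases scase σ hσ with rfl | ⟨j, rfl⟩
        · refine (cy0 _).trans ?_
          rw [← Finset.mul_sum]
          have : ∑ j : J, co f (x : E4) j = S - co f (x : E4) σ := by rw [hS, hS2]; ring
          rw [this, Pi.smul_apply, smul_eq_mul]
          field_simp
          ring
        · refine (cyj _ _).trans ?_; simp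
      · refine (cyn _ σ hσ).trans ?_; simp [hout σ hσ]
    refine ⟨fun j => S⁻¹ * co f (x : E4) j, ?_, ?_⟩
    · rw [mK]
      refine ⟨fun j => mul_nonneg (inv_nonneg.2 hSpos.le) (hv.nn _), ?_⟩
      rw [← Finset.mul_sum, inv_mul_le_iff₀ hSpos]
      have := hv.nn σ0
      rw [hS, hS2]; linarith
    · rw [ey, comb_smul, hcx, nrm_smul_sphere x (inv_pos.2 hSpos)]
  refine ⟨J → ℝ, inferInstance, inferInstance, inferInstance, K, fun y => nrm (comb f (cy y)),
    ?_, poly_convex _ _, ?_, ?_, ?_, ?_, ?_, ?_⟩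
  · rw [Module.finrank_fintype_fun_eq_card, Fintype.card_coe, Finset.card_erase_of_mem h0]
  · apply IsCompact.of_isClosed_subset (isCompact_Icc (a := (0 : J → ℝ)) (b := 1))
      (poly_closed l cc)
    intro y hy
    have hy' := (mK y).1 hy
    refine ⟨fun j => hy'.1 j, fun j => ?_⟩
    exact (Finset.single_le_sum (fun j _ => hy'.1 j) (Finset.mem_univ j)).trans hy'.2
  · refine ⟨fun _ => (Fintype.card J + 1 : ℝ)⁻¹, ?_⟩
    rw [mI]
    refine ⟨fun j => by positivity, ?_⟩
    rw [Finset.sum_const, Finset.card_univ, nsmul_eq_mul, mul_inv_lt_iff₀ (by positivity)]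
    linarith
  · exact nrm_continuousOn.comp (comb_continuous.comp cyc).continuousOn cyne
  · intro y hy y' hy' he
    obtain ⟨r, hr, hrr⟩ := nrm_eq (cyne y hy) (cyne y' hy') he
    rw [← comb_smul] at hrr
    have := (cyv y hy).uniq ((cyv y' hy').smul hr.le) hrr
    have r1 : r = 1 := by
      have h1 := cys y
      rw [this] at h1
      simp only [Pi.smul_apply, smul_eq_mul, ← Finset.mul_sum, cys y', mul_one] at h1
      exact h1
    rw [r1, one_smul] at this
    funext j
    rw [← cyj y, ← cyj y', this]
  · ext x
    constructor
    · rintro ⟨y, hy, he⟩ σ hσ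
      by_contra hn
      exact (cysupp y hy x he σ).1 hσ (cyn y σ hn)
    · intro hx
      exact surj x hx
  · ext x
    constructor
    · rintro ⟨y, hy, he⟩
      have hyK := interior_subset hy
      rw [mI] at hy
      change supp f (x : E4) = s
      ext σ
      rw [cysupp y hyK x he]
      constructor
      · intro hne; by_contra hn; exact hne (cyn y σ hn)
      · intro hσ
        rcases scase σ hσ with rfl | ⟨j, rfl⟩
        · rw [cy0]; linarith [hy.2]
        · rw [cyj]; exact (hy.1 j).ne'
    · intro hx
      have hx : supp f (x : E4) = s := hx
      obtain ⟨y, hy, he⟩ := surj x hx.subset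
      refine ⟨y, ?_, he⟩
      have key : ∀ σ ∈ s, cy y σ ≠ 0 := fun σ hσ => (cysupp y hy x he σ).1 (hx ▸ hσ)
      have hy' := (mK y).1 hy
      rw [mI]
      refine ⟨fun j => lt_of_le_of_ne (hy'.1 j) ?_, lt_of_le_of_ne hy'.2 ?_⟩
      · have := key j (Finset.mem_of_mem_erase j.2)
        rw [cyj] at this; exact this.symm
      · have := key σ0 h0
        rw [cy0] at this; intro h; apply this; rw [h]; ring

theorem SCl_inter (s t : Finset (ι → SignType)) : SCl f s ∩ SCl f t = SCl f (s ∩ t) := by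
  ext x; simp [SCl, Finset.subset_inter_iff]

theorem SCl_empty (hs : Sep f) : SCl f ∅ = ∅ := by
  ext x
  simp only [SCl, Set.mem_ofPred_eq, Set.mem_empty_iff_false, iff_false]
  intro h
  have := h (hs.sg_mem (sphere_ne_zero x)).1
  simp at this

variable (f) in
/-- Sign-determined sets. -/
def SD (A : Set Sphere3) : Prop := ∀ x y : Sphere3, sg f (x : E4) = sg f (y : E4) → x ∈ A → y ∈ A

theorem sg_smul (x : E4) {r : ℝ} (hr : 0 < r) : sg f (r • x) = sg f x := by
  funext i; simp [sg, sign_mul, sign_pos hr]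

theorem sg_nrm {x : E4} (hx : x ≠ 0) : sg f (nrm x : E4) = sg f x := by
  rw [nrm_coe hx, sg_smul _ (inv_pos.2 (norm_pos_iff.2 hx))]

/-- A closed sign-determined set is closed under passing to faces. -/
theorem SD.down (hs : Sep f) {A : Set Sphere3} (hA : SD f A) (hcl : IsClosed A) {x y : Sphere3}
    (hx : x ∈ A) (hyx : Sub (sg f (y : E4)) (sg f (x : E4))) : y ∈ A := by
  have hsg : ∀ ε : ℝ, 0 < ε → sg f ((y : E4) + ε • (x : E4)) = sg f (x : E4) := by
    intro ε hε
    funext i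
    have h1 := hyx i
    simp only [sg, map_add, map_smul, smul_eq_mul] at h1 ⊢
    rcases h1 with h | h
    · rw [sign_eq_zero_iff] at h
      rw [h, zero_add, sign_mul, sign_pos hε, one_mul]
    · rcases lt_trichotomy (f i (x : E4)) 0 with hx | hx | hx
      · rw [sign_neg hx] at h ⊢
        rw [sign_eq_neg_one_iff] at h ⊢
        nlinarith
      · rw [hx, sign_zero, sign_eq_zero_iff] at h
        rw [h, hx]; simp
      · rw [sign_pos hx] at h ⊢
        rw [sign_eq_one_iff] at h ⊢
        nlinarith
  have hcont : Filter.Tendsto (fun ε : ℝ => nrm ((y : E4) + ε • (x : E4))) (nhdsWithin 0 (Set.Ioi 0))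
      (nhds y) := by
    have c1 : ContinuousAt nrm (y : E4) := nrm_continuousOn.continuousAt
      (isOpen_ne.mem_nhds (sphere_ne_zero y))
    have e : nrm (y : E4) = y := by have := nrm_smul_sphere y one_pos; rwa [one_smul] at this
    have c2 : Filter.Tendsto (fun ε : ℝ => (y : E4) + ε • (x : E4)) (nhdsWithin 0 (Set.Ioi 0))
        (nhds (y : E4)) := by
      have : Continuous (fun ε : ℝ => (y : E4) + ε • (x : E4)) := by fun_prop
      have := (this.tendsto 0).mono_left (nhdsWithin_le_nhds (s := Set.Ioi 0))
      simpa using this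
    have := c1.tendsto.comp c2
    rw [e] at this; exact this
  refine hcl.mem_of_tendsto hcont ?_
  filter_upwards [self_mem_nhdsWithin] with ε hε
  by_cases h0 : (y : E4) + ε • (x : E4) = 0
  · have h1 := hsg ε hε
    rw [h0, sg_zero] at h1
    exfalso
    refine sphere_ne_zero x (hs _ fun i => ?_)
    have := congrFun h1 i
    simpa [sg] using this.symm
  · refine hA x _ ?_ hx
    rw [sg_nrm h0, hsg ε hε]

theorem Real.pt (hs : Sep f) {σ : ι → SignType} (h : Real f σ) :
    bp f σ ≠ 0 ∧ sg f (nrm (bp f σ) : E4) = σ := by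
  have : bp f σ ≠ 0 := by
    intro h0
    have h1 := h.1
    rw [h0, sg_zero] at h1
    exact h.2 h1.symm
  exact ⟨this, by rw [sg_nrm this, h.1]⟩

theorem SD.inter (hs : Sep f) {A : Set Sphere3} (hA : SD f A) (hcl : IsClosed A)
    {s : Finset (ι → SignType)} (h : Spx f s) :
    A ∩ SCl f s = SCl f (s.filter fun σ => nrm (bp f σ) ∈ A) := by
  ext x
  have hm := hs.sg_mem (sphere_ne_zero x)
  constructor
  · rintro ⟨hx, hxs⟩ σ hσ
    rw [Finset.mem_filter]
    refine ⟨hxs hσ, hA.down hs hcl hx ?_⟩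
    rw [((h.re σ (hxs hσ)).pt hs).2]
    exact hm.2 σ hσ
  · intro hx
    have hxs : x ∈ SCl f s := fun σ hσ => (Finset.mem_filter.1 (hx hσ)).1
    refine ⟨?_, hxs⟩
    refine hA _ x ?_ (Finset.mem_filter.1 (hx hm.1)).2
    rw [((h.re _ (hxs hm.1)).pt hs).2]

end
end Arr
end

noncomputable section
set_option linter.unusedSectionVars false
open Classical

namespace Arr
variable {ι : Type} [Fintype ι] {f : ι → E4 →ₗ[ℝ] ℝ}

theorem assemble (hs : Sep f) {J : Type} [Fintype J] (d : J → Fin 4) (Cl Op : J → Set Sphere3)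
    (Y : Set Sphere3) (hYc : IsClosed Y) (hY : SD f Y)
    (hcell : ∀ i, IsCell (d i : ℕ) (Cl i) (Op i))
    (hdisj : ∀ i j, i ≠ j → Disjoint (Op i) (Op j))
    (hOY : ∀ x, x ∈ Y ↔ ∀ i, x ∉ Op i)
    (hbd : ∀ i, ∀ x ∈ Cl i, x ∉ Op i → (∃ j, d j < d i ∧ x ∈ Cl j) ∨
      (x ∈ Y ∧ ∃ (k : ℕ) (g : Fin k → ι), k + (d i : ℕ) = 4 ∧
        LinearIndependent ℝ (fun j => f (g j)) ∧ ∀ j, f (g j) (x : E4) = 0))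
    (hII : ∀ i j, Cl i ∩ Cl j = ∅ ∨ ∃ k, Cl i ∩ Cl j = Cl k)
    (hIY : ∀ i, Cl i ∩ Y = ∅ ∨ ∃ A, IsClosed A ∧ SD f A ∧ Cl i ∩ Y = A ∩ Y) :
    ∃ C : FinCellulation3, C.StronglyRegular ∧ ∀ n, Nat.card {i // d i = n} ≤ C.count n ∧
      C.count n ≤ Nat.card {i // d i = n} + Nat.card (Finset (ι → SignType)) := by
  let T := {s : Finset (ι → SignType) // Spx f s ∧ SCl f s ⊆ Y}
  have card4 : ∀ s, Spx f s → s.card ≤ 4 := by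
    intro s h
    have := h.linInd.fintype_card_le_finrank
    simpa using this
  have ofx : ∀ x : Sphere3, x ∈ Y → Spx f (supp f (x : E4)) ∧ SCl f (supp f (x : E4)) ⊆ Y := by
    intro x hx
    refine ⟨hs.spx_supp (sphere_ne_zero x), fun y hy => ?_⟩
    apply hY.down hs hYc hx
    exact (hs.sg_mem (sphere_ne_zero x)).2 _ (hy (hs.sg_mem (sphere_ne_zero y)).1)
  have openY : ∀ s : T, SOp f s.1 ⊆ Y := fun s x hx => s.2.2 (show supp f (x : E4) ⊆ s.1 from hx.le)
  have ddef : ∀ s : T, s.1.card - 1 < 4 := by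
    intro s
    have := card4 s.1 s.2.1; omega
  let dd : J ⊕ T → Fin 4 := Sum.elim d (fun s => ⟨s.1.card - 1, ddef s⟩)
  let CC : J ⊕ T → Set Sphere3 := Sum.elim Cl (fun s => SCl f s.1)
  let OO : J ⊕ T → Set Sphere3 := Sum.elim Op (fun s => SOp f s.1)
  have interO : ∀ i (s : T), Cl i ∩ SCl f s.1 = ∅ ∨ ∃ k, Cl i ∩ SCl f s.1 = CC k := by
    intro i s
    have e0 : Cl i ∩ SCl f s.1 = (Cl i ∩ Y) ∩ SCl f s.1 := by
      ext x
      constructor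
      · rintro ⟨h1, h2⟩; exact ⟨⟨h1, s.2.2 h2⟩, h2⟩
      · rintro ⟨⟨h1, _⟩, h2⟩; exact ⟨h1, h2⟩
    rcases hIY i with h | ⟨A, hA1, hA2, hA3⟩
    · left; rw [e0, h]; simp
    · have e1 : Cl i ∩ SCl f s.1 = A ∩ SCl f s.1 := by
        rw [e0, hA3]
        ext x
        constructor
        · rintro ⟨⟨h1, _⟩, h2⟩; exact ⟨h1, h2⟩
        · rintro ⟨h1, h2⟩; exact ⟨⟨h1, s.2.2 h2⟩, h2⟩
      rw [hA2.inter hs hA1 s.2.1] at e1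
      set t := s.1.filter fun σ => nrm (bp f σ) ∈ A
      by_cases ht : t = ∅
      · left; rw [e1, ht, SCl_empty hs]
      · right
        have hts : t ⊆ s.1 := Finset.filter_subset _ _
        refine ⟨Sum.inr ⟨t, s.2.1.subset hts (Finset.nonempty_iff_ne_empty.2 ht),
          fun x hx => s.2.2 (fun σ hσ => hts (hx hσ))⟩, e1⟩
  suffices hmain : ∃ C : FinCellulation3, C.StronglyRegular ∧
      ∀ n, C.count n = Nat.card {i // dd i = n} by
    obtain ⟨C, hC, hcount⟩ := hmain
    refine ⟨C, hC, fun n => ?_⟩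
    rw [hcount n]
    have e : {i // dd i = n} ≃ {i // d i = n} ⊕ {t : T // dd (Sum.inr t) = n} :=
      Equiv.subtypeSum
    rw [Nat.card_congr e, Nat.card_sum]
    refine ⟨Nat.le_add_right _ _, Nat.add_le_add_left ?_ _⟩
    exact Nat.card_le_card_of_injective (fun t => t.1.1)
      (fun a b h => Subtype.ext (Subtype.ext h))
  apply build dd CC OO
  · rintro (i | s)
    · exact hcell i
    · exact s.2.1.isCell hs
  · rintro (i | s) (j | t) hne
    · exact hdisj i j (fun h => hne (by rw [h]))
    · rw [Set.disjoint_left]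
      intro x hx hx'
      exact (hOY x).1 (openY t hx') i hx
    · rw [Set.disjoint_left]
      intro x hx hx'
      exact (hOY x).1 (openY s hx) j hx'
    · rw [Set.disjoint_left]
      intro x hx hx'
      apply hne
      congr 1
      apply Subtype.ext
      exact (show supp f (x : E4) = s.1 from hx).symm.trans hx'
  · intro x
    by_cases hx : x ∈ Y
    · exact ⟨Sum.inr ⟨_, ofx x hx⟩, rfl⟩
    · rw [hOY] at hx; push Not at hx
      obtain ⟨i, hi⟩ := hx
      exact ⟨Sum.inl i, hi⟩
  · rintro (i | s) x hx hxo
    · rcases hbd i x hx hxo with ⟨j, hj, hxj⟩ | ⟨hxY, k, g, hk, hg, hz⟩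
      · exact ⟨Sum.inl j, hj, hxj⟩
      · have h1 := (ofx x hxY).1
        refine ⟨Sum.inr ⟨_, ofx x hxY⟩, ?_, ?_⟩
        · have := h1.codim hs rfl g hg hz
          have h2 := Finset.card_pos.2 h1.ne
          rw [finrank_euclideanSpace, Fintype.card_fin] at this
          change (⟨_, _⟩ : Fin 4) < d i
          rw [Fin.lt_def]; change (supp f (x : E4)).card - 1 < _
          omega
        · exact show supp f (x : E4) ⊆ supp f (x : E4) from subset_rfl
    · have hx : supp f (x : E4) ⊆ s.1 := hx
      refine ⟨Sum.inr ⟨_, ofx x (s.2.2 hx)⟩, ?_, ?_⟩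
      · have h1 : (supp f (x : E4)).card < s.1.card :=
          Finset.card_lt_card (Finset.ssubset_iff_subset_ne.2 ⟨hx, hxo⟩)
        have h2 := Finset.card_pos.2 (ofx x (s.2.2 hx)).1.ne
        change (⟨_, _⟩ : Fin 4) < ⟨_, _⟩
        rw [Fin.lt_def]; change (supp f (x : E4)).card - 1 < _ - 1
        omega
      · exact show supp f (x : E4) ⊆ supp f (x : E4) from subset_rfl
  · rintro (i | s) (j | t)
    · rcases hII i j with h | ⟨k, hk⟩
      · exact Or.inl h
      · exact Or.inr ⟨Sum.inl k, hk⟩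
    · exact interO i t
    · change SCl f s.1 ∩ Cl j = ∅ ∨ ∃ k, SCl f s.1 ∩ Cl j = CC k
      rw [Set.inter_comm]; exact interO j s
    · change SCl f s.1 ∩ SCl f t.1 = ∅ ∨ ∃ k, SCl f s.1 ∩ SCl f t.1 = CC k
      rw [SCl_inter]
      by_cases ht : s.1 ∩ t.1 = ∅
      · left; rw [ht, SCl_empty hs]
      · right
        refine ⟨Sum.inr ⟨s.1 ∩ t.1, s.2.1.subset Finset.inter_subset_left
          (Finset.nonempty_iff_ne_empty.2 ht), fun x hx => s.2.2 (fun σ hσ => ?_)⟩, rfl⟩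
        exact Finset.inter_subset_left (hx hσ)
end Arr
end

noncomputable section
set_option linter.unusedSectionVars false
open Classical

/-- The affine chart space. -/
abbrev Q3 := ℝ × ℝ × ℝ

/-- Affine function with given coefficients. -/
def aff (a : Fin 4 → ℝ) (q : Q3) : ℝ := a 0 + a 1 * q.1 + a 2 * q.2.1 + a 3 * q.2.2

/-- Linear functional with given coefficients. -/
def lin : (Fin 4 → ℝ) →ₗ[ℝ] (E4 →ₗ[ℝ] ℝ) :=
  LinearMap.mk₂ ℝ (fun a v => a 0 * v 0 + a 1 * v 1 + a 2 * v 2 + a 3 * v 3)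
    (fun a b v => by simp only [Pi.add_apply]; ring)
    (fun r a v => by simp only [Pi.smul_apply, smul_eq_mul]; ring)
    (fun a v w => by simp only [PiLp.add_apply]; ring)
    (fun r a v => by simp only [PiLp.smul_apply, smul_eq_mul]; ring)

theorem lin_apply (a : Fin 4 → ℝ) (v : E4) :
    lin a v = a 0 * v 0 + a 1 * v 1 + a 2 * v 2 + a 3 * v 3 := rfl

theorem lin_injective : Function.Injective lin := by
  rw [← LinearMap.ker_eq_bot, LinearMap.ker_eq_bot']
  intro a ha
  funext j
  have := congrArg (fun g : E4 →ₗ[ℝ] ℝ => g (EuclideanSpace.single j 1)) ha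
  simp only [lin_apply, LinearMap.zero_apply] at this
  fin_cases j <;> simpa using this

/-- Lift to homogeneous coordinates. -/
def lift4 (q : Q3) : E4 := !₂[1, q.1, q.2.1, q.2.2]

theorem lift4_ne (q : Q3) : lift4 q ≠ 0 := by
  intro h
  have := congrArg (fun v : E4 => v 0) h
  simp [lift4] at this

theorem lin_lift4 (a : Fin 4 → ℝ) (q : Q3) : lin a (lift4 q) = aff a q := by
  simp [lin_apply, lift4, aff]

theorem lift4_continuous : Continuous lift4 := by
  unfold lift4
  refine (PiLp.continuous_toLp 2 _).comp ?_
  apply continuous_pi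
  intro j
  fin_cases j <;> simp <;> fun_prop

/-- The central chart of the sphere. -/
def chart (q : Q3) : Sphere3 := nrm (lift4 q)

theorem chart_continuous : Continuous chart :=
  nrm_continuousOn.comp_continuous lift4_continuous lift4_ne

theorem chart_injective : Function.Injective chart := by
  intro p q h
  obtain ⟨r, hr, e⟩ := nrm_eq (lift4_ne p) (lift4_ne q) h
  have e0 := congrArg (fun v : E4 => v 0) e
  have e1 := congrArg (fun v : E4 => v 1) e
  have e2 := congrArg (fun v : E4 => v 2) e
  have e3 := congrArg (fun v : E4 => v 3) e
  simp [lift4] at e0 e1 e2 e3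
  subst e0
  simp at e1 e2 e3
  ext <;> assumption

theorem chart_of_pos (v : Sphere3) (h : 0 < (v : E4) 0) :
    chart ((v : E4) 1 / (v : E4) 0, (v : E4) 2 / (v : E4) 0, (v : E4) 3 / (v : E4) 0) = v := by
  have : lift4 ((v : E4) 1 / (v : E4) 0, (v : E4) 2 / (v : E4) 0, (v : E4) 3 / (v : E4) 0)
      = ((v : E4) 0)⁻¹ • (v : E4) := by
    ext j
    fin_cases j <;> simp [lift4, h.ne'] <;> ring
  rw [chart, this, nrm_smul_sphere v (inv_pos.2 h)]

theorem chart_pos (q : Q3) : 0 < ((chart q : Sphere3) : E4) 0 := by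
  rw [chart, nrm_coe (lift4_ne q)]
  have : 0 < ‖lift4 q‖ := norm_pos_iff.2 (lift4_ne q)
  simpa [lift4] using this

theorem chart_isOpen {N : Set Q3} (hN : IsOpen N) : IsOpen (chart '' N) := by
  let U : Set Sphere3 := {v | 0 < (v : E4) 0}
  let g : Sphere3 → Q3 := fun v => ((v : E4) 1 / (v : E4) 0, (v : E4) 2 / (v : E4) 0,
    (v : E4) 3 / (v : E4) 0)
  have hU : IsOpen U := isOpen_lt continuous_const (by fun_prop)
  have hg : ContinuousOn g U := by
    have h0 : ∀ v ∈ U, (v : E4) 0 ≠ 0 := fun v hv => ne_of_gt hv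
    refine ContinuousOn.prodMk ?_ (ContinuousOn.prodMk ?_ ?_) <;>
    exact ContinuousOn.div (by fun_prop) (by fun_prop) h0
  have : chart '' N = U ∩ g ⁻¹' N := by
    ext v
    constructor
    · rintro ⟨q, hq, rfl⟩
      refine ⟨chart_pos q, ?_⟩
      have := chart_injective (chart_of_pos _ (chart_pos q))
      change g (chart q) ∈ N
      rw [show g (chart q) = q from this]; exact hq
    · rintro ⟨h1, h2⟩
      exact ⟨g v, h2, chart_of_pos v h1⟩
  rw [this]
  exact hg.isOpen_inter_preimage hU hN

theorem IsCell.map {X Y : Type} [TopologicalSpace X] [TopologicalSpace Y] {n : ℕ} {A B : Set X}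
    (h : IsCell n A B) {g : X → Y} (hg : Continuous g) (hi : Function.Injective g) :
    IsCell n (g '' A) (g '' B) := by
  obtain ⟨E, i1, i2, i3, K, φ, hn, hK, hKc, hKi, hφ, hinj, rfl, rfl⟩ := h
  refine ⟨E, i1, i2, i3, K, g ∘ φ, hn, hK, hKc, hKi, hg.comp_continuousOn hφ,
    fun x hx y hy h => hinj hx hy (hi h), Set.image_comp _ _ _, Set.image_comp _ _ _⟩

/-- Sets in the chart determined by signs of finitely many affine functions. -/
def SL (F : Finset (Fin 4 → ℝ)) (S : Set Q3) : Prop :=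
  ∀ p q, (∀ a ∈ F, SignType.sign (aff a p) = SignType.sign (aff a q)) → p ∈ S → q ∈ S

/-- The arrangement attached to a finite set of coefficient vectors. -/
def arr (F : Finset (Fin 4 → ℝ)) : F → E4 →ₗ[ℝ] ℝ := fun a => lin a

theorem sign_chart (a : Fin 4 → ℝ) (q : Q3) :
    SignType.sign (lin a (chart q : E4)) = SignType.sign (aff a q) := by
  rw [chart, nrm_coe (lift4_ne q), map_smul, lin_lift4, smul_eq_mul, sign_mul,
    sign_pos (inv_pos.2 (norm_pos_iff.2 (lift4_ne q))), one_mul]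

/-- The coordinate functionals belong to the family. -/
def Coord (F : Finset (Fin 4 → ℝ)) : Prop := ∀ j, Pi.single j 1 ∈ F

theorem Coord.sep {F : Finset (Fin 4 → ℝ)} (h : Coord F) : Arr.Sep (arr F) := by
  intro v hv
  ext j
  have := hv ⟨_, h j⟩
  simp only [arr, lin_apply] at this
  fin_cases j <;> simpa using this

theorem SL.sd {F : Finset (Fin 4 → ℝ)} (hF : Coord F) {S : Set Q3} (h : SL F S) :
    Arr.SD (arr F) (chart '' S) := by
  rintro _ v hxy ⟨q, hq, rfl⟩
  have h0 : 0 < (v : E4) 0 := by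
    have h1 := congrFun hxy ⟨_, hF 0⟩
    have e : ∀ w : Sphere3, Arr.sg (arr F) (w : E4) ⟨_, hF 0⟩ = SignType.sign ((w : E4) 0) := by
      intro w; simp [Arr.sg, arr, lin_apply]
    rw [e, e, sign_pos (chart_pos q)] at h1
    exact sign_eq_one_iff.1 h1.symm
  rw [← chart_of_pos v h0]
  refine ⟨_, h q _ ?_ hq, rfl⟩
  intro a ha
  rw [← sign_chart, ← sign_chart, chart_of_pos v h0]
  exact congrFun hxy ⟨a, ha⟩

theorem Arr.SD.compl {ι : Type} {f : ι → E4 →ₗ[ℝ] ℝ} {A : Set Sphere3} (h : Arr.SD f A) :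
    Arr.SD f Aᶜ := fun x y e hx hy => hx (h y x e.symm hy)

theorem assembleQ (F : Finset (Fin 4 → ℝ)) (hF : Coord F)
    {J : Type} [Fintype J] (d : J → Fin 4) (Cl Op : J → Set Q3)
    (N : Set Q3) (hNo : IsOpen N) (hN : SL F N)
    (hcell : ∀ i, IsCell (d i : ℕ) (Cl i) (Op i))
    (hdisj : ∀ i j, i ≠ j → Disjoint (Op i) (Op j))
    (hON : ∀ x, x ∈ N ↔ ∃ i, x ∈ Op i)
    (hbd : ∀ i, ∀ x ∈ Cl i, x ∉ Op i → (∃ j, d j < d i ∧ x ∈ Cl j) ∨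
      (x ∉ N ∧ ∃ (k : ℕ) (g : Fin k → Fin 4 → ℝ), k + (d i : ℕ) = 4 ∧
        LinearIndependent ℝ g ∧ ∀ j, g j ∈ F ∧ aff (g j) x = 0))
    (hII : ∀ i j, Cl i ∩ Cl j = ∅ ∨ ∃ k, Cl i ∩ Cl j = Cl k)
    (hIY : ∀ i, Cl i ⊆ N ∨ ∃ A, IsCompact A ∧ SL F A ∧ Cl i \ N = A \ N) :
    ∃ C : FinCellulation3, C.StronglyRegular ∧ ∀ n, Nat.card {i // d i = n} ≤ C.count n ∧
      C.count n ≤ Nat.card {i // d i = n} + Nat.card (Finset (F → SignType)) := by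
  refine Arr.assemble (f := arr F) hF.sep d (fun i => chart '' Cl i) (fun i => chart '' Op i)
    (chart '' N)ᶜ (chart_isOpen hNo).isClosed_compl (hN.sd hF).compl ?_ ?_ ?_ ?_ ?_ ?_
  · intro i; exact (hcell i).map chart_continuous chart_injective
  · intro i j h
    rw [Set.disjoint_image_iff chart_injective]; exact hdisj i j h
  · intro x
    rw [Set.mem_compl_iff]
    constructor
    · rintro h i ⟨q, hq, rfl⟩
      exact h ⟨q, (hON q).2 ⟨i, hq⟩, rfl⟩
    · rintro h ⟨q, hq, rfl⟩
      obtain ⟨i, hi⟩ := (hON q).1 hq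
      exact h i ⟨q, hi, rfl⟩
  · rintro i _ ⟨q, hq, rfl⟩ hqo
    rw [chart_injective.mem_set_image] at hqo
    rcases hbd i q hq hqo with ⟨j, h1, h2⟩ | ⟨h1, k, g, hk, hg, hz⟩
    · exact Or.inl ⟨j, h1, ⟨q, h2, rfl⟩⟩
    · right
      rw [Set.mem_compl_iff, chart_injective.mem_set_image]
      refine ⟨h1, k, fun j => ⟨g j, (hz j).1⟩, hk, ?_, ?_⟩
      · exact hg.map' lin (LinearMap.ker_eq_bot.2 lin_injective)
      · intro j
        have := sign_chart (g j) q
        rw [(hz j).2, sign_zero, sign_eq_zero_iff] at this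
        exact this
  · intro i j
    rw [← Set.image_inter chart_injective]
    rcases hII i j with h | ⟨k, h⟩
    · left; rw [h, Set.image_empty]
    · right; exact ⟨k, by rw [h]⟩
  · intro i
    have e : ∀ S : Set Q3, chart '' S ∩ (chart '' N)ᶜ = chart '' (S \ N) := by
      intro S; rw [Set.image_sdiff chart_injective]; rfl
    rw [e]
    rcases hIY i with h | ⟨A, h1, h2, h3⟩
    · left; rw [Set.sdiff_eq_empty.2 h, Set.image_empty]
    · right
      refine ⟨chart '' A, (h1.image chart_continuous).isClosed, h2.sd hF, ?_⟩
      rw [h3, e]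
end

noncomputable section
set_option linter.unusedSectionVars false
open Classical

namespace Fat
variable {D : ℕ}

/-- The vertex set. -/
abbrev Gam (D : ℕ) := Equiv.Perm (Fin (D + 1))

/-- Adjacent transpositions. -/
def sw (D c : ℕ) : Gam D := Equiv.swap (Fin.ofNat (D + 1) c) (Fin.ofNat (D + 1) (c + 1))

/-- The neighbour along colour `c`. -/
def nb (h : Gam D) (c : ℕ) : Gam D := h * sw D c

/-- Partial products. -/
def wk (D : ℕ) : ℕ → Gam D
  | 0 => 1
  | i + 1 => wk D i * sw D i

/-- The vertices of the path of `g`. -/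
def pv (g : Gam D) (i : ℕ) : Gam D := g * wk D i

theorem pv_zero (g : Gam D) : pv g 0 = g := by simp [pv, wk]
theorem pv_succ (g : Gam D) (i : ℕ) : pv g (i + 1) = nb (pv g i) i := by
  simp [pv, wk, nb, mul_assoc]

theorem nb_nb (h : Gam D) (c : ℕ) : nb (nb h c) c = h := by
  simp [nb, mul_assoc, sw]

theorem ofNat_val {c : ℕ} (h : c ≤ D) : (Fin.ofNat (D + 1) c).val = c := by
  simp only [Fin.val_ofNat]; exact Nat.mod_eq_of_lt (by omega)

theorem nb_ne (h : Gam D) {c : ℕ} (hc : c < D) : nb h c ≠ h := by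
  intro e
  have : sw D c = 1 := by simpa [nb] using e
  rw [sw, Equiv.swap_eq_one_iff] at this
  have := congrArg Fin.val this
  rw [ofNat_val (by omega), ofNat_val (by omega)] at this
  omega

theorem wk_val : ∀ (i : ℕ), i ≤ D → ∀ z : Fin (D + 1), (wk D i z).val =
    if z.val < i then z.val + 1 else if z.val = i then 0 else z.val := by
  intro i
  induction i with
  | zero =>
    intro _ z
    simp only [wk]
    by_cases h : z.val = 0 <;> simp [h]
  | succ i ih =>
    intro hi z
    have e : wk D (i + 1) z = wk D i (sw D i z) := rfl
    rw [e, ih (by omega)]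
    have v1 := ofNat_val (D := D) (c := i) (by omega)
    have v2 := ofNat_val (D := D) (c := i + 1) (by omega)
    by_cases h1 : z = Fin.ofNat (D + 1) i
    · subst h1
      rw [sw, Equiv.swap_apply_left, v1, v2]; simp
    · by_cases h2 : z = Fin.ofNat (D + 1) (i + 1)
      · subst h2
        rw [sw, Equiv.swap_apply_right, v1, v2]; simp
      · rw [sw, Equiv.swap_apply_of_ne_of_ne h1 h2]
        have h1' : z.val ≠ i := fun h => h1 (Fin.ext (by rw [v1, h]))
        have h2' : z.val ≠ i + 1 := fun h => h2 (Fin.ext (by rw [v2, h]))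
        split_ifs <;> omega

theorem pv_inj {g : Gam D} {i k : ℕ} (hi : i ≤ D) (hk : k ≤ D) (h : pv g i = pv g k) : i = k := by
  have h : wk D i = wk D k := mul_left_cancel h
  have h1 := wk_val i hi (Fin.ofNat (D + 1) i)
  have h2 := wk_val k hk (Fin.ofNat (D + 1) i)
  rw [← h, h1, ofNat_val hi] at h2
  split_ifs at h2 <;> omega

theorem pv_two {g g' : Gam D} {i j k l : ℕ} (hi : i ≤ D) (hj : j ≤ D) (hk : k ≤ D) (hl : l ≤ D)
    (hne : g ≠ g') (h1 : pv g i = pv g' j) (h2 : pv g k = pv g' l) (hik : i < k) :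
    k = i + 1 ∧ l = i ∧ j = i + 1 := by
  have hij : i ≠ j := by rintro rfl; exact hne (mul_right_cancel h1)
  have hkl : k ≠ l := by rintro rfl; exact hne (mul_right_cancel h2)
  -- wk i z = wk k z' iff wk j z = wk l z'
  have key : ∀ z z', wk D i z = wk D k z' ↔ wk D j z = wk D l z' := by
    intro z z'
    have a1 : g (wk D i z) = g' (wk D j z) := by
      have := congrArg (fun p : Gam D => p z) h1; exact this
    have a2 : g (wk D k z') = g' (wk D l z') := by
      have := congrArg (fun p : Gam D => p z') h2; exact this
    rw [← g.injective.eq_iff, a1, a2, g'.injective.eq_iff]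
  have b1 := (key (Fin.ofNat _ j) (Fin.ofNat _ l)).2 (by
    apply Fin.ext; rw [wk_val j hj, wk_val l hl, ofNat_val hj, ofNat_val hl]; simp)
  have b2 := (key (Fin.ofNat _ i) (Fin.ofNat _ k)).1 (by
    apply Fin.ext; rw [wk_val i hi, wk_val k hk, ofNat_val hi, ofNat_val hk]; simp)
  have b1 := congrArg Fin.val b1
  have b2 := congrArg Fin.val b2
  rw [wk_val i hi, wk_val k hk, ofNat_val hj, ofNat_val hl] at b1
  rw [wk_val j hj, wk_val l hl, ofNat_val hi, ofNat_val hk] at b2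
  split_ifs at b1 b2 <;> omega

/-- The start of the path whose `i`-th vertex is `h`. -/
def st (h : Gam D) (i : ℕ) : Gam D := h * (wk D i)⁻¹

theorem pv_st (h : Gam D) (i : ℕ) : pv (st h i) i = h := by simp [pv, st]
theorem st_pv (g : Gam D) (i : ℕ) : st (pv g i) i = g := by simp [pv, st]
theorem st_nb (h : Gam D) (c : ℕ) : st (nb h c) (c + 1) = st h c := by
  simp [st, nb, wk, mul_assoc]
theorem st_zero (h : Gam D) : st h 0 = h := by simp [st, wk]
theorem pv_eq_iff {g h : Gam D} {i : ℕ} : pv g i = h ↔ g = st h i :=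
  ⟨fun e => by rw [← e, st_pv], fun e => by rw [e, pv_st]⟩

/-- Numbering of the vertices. -/
def num (h : Gam D) : ℕ := (Fintype.equivFin (Gam D) h).val
theorem num_inj {h h' : Gam D} (e : num h = num h') : h = h' :=
  (Fintype.equivFin (Gam D)).injective (Fin.ext e)
end Fat
end

noncomputable section
set_option linter.unusedSectionVars false
open Classical

namespace Fat
variable {D : ℕ}

/-- Horizontal position of a vertex. -/
def XX (h : Gam D) : ℝ := 10 * (D + 1) * num h
/-- Whether `h` is the left end of its edge of colour `c`. -/
def lft (h : Gam D) (c : ℕ) : Prop := num h < num (nb h c)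
/-- Orientation sign. -/
def eta (h : Gam D) (c : ℕ) : ℝ := if lft h c then 1 else -1
/-- Slope of a strip. -/
def sl (h : Gam D) (c : ℕ) : ℝ := 3 * c + (if lft h c then 1 else 0)
/-- Height of the top of a strip. -/
def TT (h : Gam D) (c : ℕ) : ℝ := |XX h - XX (nb h c)|
/-- Label of an edge. -/
def lam (h : Gam D) (c : ℕ) : ℕ := min (num h) (num (nb h c)) * D + c
/-- Gluing slopes. -/
def AA (h : Gam D) (i : ℕ) : ℝ :=
  if 0 < i ∧ i < D then 1 / (sl h i - sl h (i - 1)) else 1 / (sl h 0 - sl h (D - 1))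
/-- Lower boundary of a strip. -/
def low (h : Gam D) (c : ℕ) (δ : ℝ) : ℝ :=
  2 * max δ 0 * AA h (c + 1) + 2 * max (-δ) 0 * AA h c
/-- Upper boundary of a strip. -/
def up (h : Gam D) (c : ℕ) (δ : ℝ) : ℝ := TT h c - 2 * eta h c * δ
/-- Points of thickened strips. -/
def pt (h : Gam D) (c : ℕ) (δ t z : ℝ) : Q3 :=
  (XX h + t * sl h c + δ, t, lam h c * max (t - 1) 0 + z / 4)

theorem lft_nb (h : Gam D) {c : ℕ} (hc : c < D) : lft (nb h c) c ↔ ¬ lft h c := by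
  simp only [lft, nb_nb, not_lt]
  have : num (nb h c) ≠ num h := fun e => nb_ne h hc (num_inj e)
  omega
theorem eta_sq (h : Gam D) (c : ℕ) : eta h c = 1 ∨ eta h c = -1 := by
  unfold eta; split_ifs <;> simp
theorem eta_nb (h : Gam D) {c : ℕ} (hc : c < D) : eta (nb h c) c = - eta h c := by
  simp only [eta, lft_nb h hc]; split_ifs <;> simp
theorem sl_nb (h : Gam D) {c : ℕ} (hc : c < D) : sl (nb h c) c = sl h c - eta h c := by
  simp only [sl, eta, lft_nb h hc]; split_ifs <;> ring
theorem TT_nb (h : Gam D) (c : ℕ) : TT (nb h c) c = TT h c := by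
  simp only [TT, nb_nb]; exact abs_sub_comm _ _
theorem lam_nb (h : Gam D) (c : ℕ) : lam (nb h c) c = lam h c := by
  simp only [lam, nb_nb]; rw [min_comm]
theorem XX_nb (h : Gam D) (c : ℕ) : XX (nb h c) = XX h + eta h c * TT h c := by
  have hD : (0 : ℝ) < 10 * (D + 1) := by positivity
  simp only [TT, eta]
  split_ifs with hl
  · have : (num h : ℝ) < num (nb h c) := by exact_mod_cast hl
    rw [abs_of_nonpos]
    · ring
    · simp only [XX]; nlinarith
  · have : (num (nb h c) : ℝ) ≤ num h := by exact_mod_cast not_lt.1 hl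
    rw [abs_of_nonneg]
    · ring
    · simp only [XX]; nlinarith
theorem XX_dist {h h' : Gam D} (hne : h ≠ h') : 10 * (D + 1 : ℝ) ≤ |XX h - XX h'| := by
  have e : XX h - XX h' = 10 * (D + 1) * ((num h : ℝ) - num h') := by simp only [XX]; ring
  rw [e, abs_mul, abs_of_pos (by positivity : (0 : ℝ) < 10 * (D + 1))]
  have : (1 : ℝ) ≤ |(num h : ℝ) - num h'| := by
    have hn : num h ≠ num h' := fun e => hne (num_inj e)
    have : (1 : ℤ) ≤ |(num h : ℤ) - num h'| := Int.one_le_abs (by omega)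
    exact_mod_cast this
  nlinarith [(by positivity : (0 : ℝ) < 10 * (D + 1))]
theorem TT_ge (h : Gam D) {c : ℕ} (hc : c < D) : 10 * (D + 1 : ℝ) ≤ TT h c :=
  XX_dist (nb_ne h hc).symm
theorem sl_bd (h : Gam D) (c : ℕ) : 3 * (c : ℝ) ≤ sl h c ∧ sl h c ≤ 3 * c + 1 := by
  unfold sl; split_ifs <;> constructor <;> linarith
theorem sl_lt (h : Gam D) {c c' : ℕ} (hc : c < c') : sl h c + 2 ≤ sl h c' := by
  have h1 := (sl_bd h c).2
  have h2 := (sl_bd h c').1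
  have : (c : ℝ) + 1 ≤ c' := by exact_mod_cast hc
  linarith
theorem sl_le (h : Gam D) {c c' : ℕ} (hc : c ≤ c') : sl h c ≤ sl h c' := by
  rcases hc.eq_or_lt with rfl | h'
  · exact le_rfl
  · linarith [sl_lt h h']

theorem AA_mid (h : Gam D) {i : ℕ} (h0 : 0 < i) (h1 : i < D) :
    0 < AA h i ∧ AA h i ≤ 1 / 2 ∧ AA h i * (sl h i - sl h (i - 1)) = 1 := by
  have := sl_lt h (show i - 1 < i by omega)
  have p : 0 < sl h i - sl h (i - 1) := by linarith
  rw [AA, if_pos ⟨h0, h1⟩]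
  refine ⟨by positivity, ?_, by field_simp⟩
  exact one_div_le_one_div_of_le (by norm_num) (by linarith)
theorem AA_end (hD : 2 ≤ D) (h : Gam D) {i : ℕ} (hi : i = 0 ∨ i = D) :
    AA h i < 0 ∧ - (1 / 2) ≤ AA h i ∧ AA h i * (sl h (D - 1) - sl h 0) = -1 := by
  have := sl_lt h (show 0 < D - 1 by omega)
  have p : 0 < sl h (D - 1) - sl h 0 := by linarith
  rw [AA, if_neg (by omega)]
  have e : 1 / (sl h 0 - sl h (D - 1)) = - (1 / (sl h (D - 1) - sl h 0)) := by
    rw [← neg_sub, one_div, one_div, inv_neg]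
  rw [e]
  have : 1 / (sl h (D - 1) - sl h 0) ≤ 1 / 2 := one_div_le_one_div_of_le (by norm_num) (by linarith)
  refine ⟨by simp [p], by linarith, by field_simp⟩
theorem AA_abs (hD : 2 ≤ D) (h : Gam D) {i : ℕ} (hi : i ≤ D) : |AA h i| ≤ 1 / 2 := by
  rw [abs_le]
  by_cases h0 : i = 0 ∨ i = D
  · have := AA_end hD h h0; constructor <;> linarith
  · have := AA_mid h (show 0 < i by omega) (show i < D by omega); constructor <;> linarith

theorem low_nonneg (h : Gam D) (c : ℕ) {δ : ℝ} (hδ : 0 ≤ δ) : low h c δ = 2 * δ * AA h (c + 1) := by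
  rw [low, max_eq_left hδ, max_eq_right (by linarith)]; ring
theorem low_nonpos (h : Gam D) (c : ℕ) {δ : ℝ} (hδ : δ ≤ 0) : low h c δ = -2 * δ * AA h c := by
  rw [low, max_eq_right hδ, max_eq_left (by linarith)]; ring
theorem low_zero (h : Gam D) (c : ℕ) : low h c 0 = 0 := by simp [low]
theorem low_abs (hD : 2 ≤ D) (h : Gam D) {c : ℕ} (hc : c < D) {δ : ℝ} (hδ : |δ| ≤ 1 / 4) :
    |low h c δ| ≤ 1 / 4 := by
  rcases le_total 0 δ with h0 | h0
  · rw [low_nonneg h c h0, abs_mul, abs_mul]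
    have := AA_abs hD h (show c + 1 ≤ D by omega)
    rw [abs_of_pos (by norm_num : (0:ℝ) < 2)]
    nlinarith [abs_nonneg δ, abs_nonneg (AA h (c + 1))]
  · rw [low_nonpos h c h0, abs_mul, abs_mul]
    have := AA_abs hD h (show c ≤ D by omega)
    rw [abs_neg, abs_of_pos (by norm_num : (0:ℝ) < 2)]
    nlinarith [abs_nonneg δ, abs_nonneg (AA h c)]
theorem up_ge (h : Gam D) {c : ℕ} (hc : c < D) {δ : ℝ} (hδ : |δ| ≤ 1 / 4) :
    9 ≤ up h c δ := by
  have h1 := TT_ge h hc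
  have : (0 : ℝ) ≤ D := by positivity
  rw [abs_le] at hδ
  rcases eta_sq h c with e | e <;> rw [up, e] <;> linarith [hδ.1, hδ.2]

/-- Valid strip coordinates. -/
structure Ok (h : Gam D) (c : ℕ) (δ t z : ℝ) : Prop where
  hc : c < D
  hδ : |δ| ≤ 1 / 4
  lo : low h c δ ≤ t
  hi : t ≤ up h c δ
  hz : |z| ≤ 1

theorem Ok.t_ge (hD : 2 ≤ D) {h : Gam D} {c : ℕ} {δ t z : ℝ} (o : Ok h c δ t z) : -(1 / 4) ≤ t := by
  have := (abs_le.1 (low_abs hD h o.hc o.hδ)).1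
  linarith [o.lo]

/-- The possible coincidences of points of strips. -/
inductive Glue (h : Gam D) (c : ℕ) (δ t : ℝ) (h' : Gam D) (c' : ℕ) (δ' : ℝ) : Prop
  | same : h = h' → c = c' → δ = δ' → Glue h c δ t h' c' δ'
  | bot1 : h = h' → c' = c + 1 → 0 ≤ δ → δ' = -δ → t = low h c δ → t = low h c' δ' →
      Glue h c δ t h' c' δ'
  | bot2 : h = h' → c = c' + 1 → δ ≤ 0 → δ' = -δ → t = low h c δ → t = low h c' δ' →
      Glue h c δ t h' c' δ'
  | wrap1 : h = h' → c + 1 = D → c' = 0 → 0 ≤ δ → δ' = -δ → t = low h c δ → t = low h c' δ' →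
      Glue h c δ t h' c' δ'
  | wrap2 : h = h' → c = 0 → c' + 1 = D → δ ≤ 0 → δ' = -δ → t = low h c δ → t = low h c' δ' →
      Glue h c δ t h' c' δ'
  | vert : h = h' → t = 0 → δ = 0 → δ' = 0 → Glue h c δ t h' c' δ'
  | top : h' = nb h c → c' = c → δ' = -δ → t = up h c δ → t = up h' c' δ' → Glue h c δ t h' c' δ'

theorem glue_lt (hD : 2 ≤ D) {h : Gam D} {c c' : ℕ} {δ δ' t : ℝ} (hcc : c < c') (hc' : c' < D)
    (lo : low h c δ ≤ t) (lo' : low h c' δ' ≤ t) (e : t * sl h c + δ = t * sl h c' + δ') :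
    (c' = c + 1 ∧ 0 ≤ δ ∧ δ' = -δ ∧ t = low h c δ ∧ t = low h c' δ') ∨
    (c = 0 ∧ c' + 1 = D ∧ δ ≤ 0 ∧ δ' = -δ ∧ t = low h c δ ∧ t = low h c' δ') ∨
    (t = 0 ∧ δ = 0 ∧ δ' = 0) := by
  obtain ⟨a1, a2, a3⟩ := AA_mid h (show 0 < c + 1 by omega) (show c + 1 < D by omega)
  obtain ⟨b1, b2, b3⟩ := AA_mid h (show 0 < c' by omega) (show c' < D by omega)
  simp only [Nat.add_sub_cancel] at a3
  have s0 := sl_lt h hcc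
  have s1 := sl_le h (show c + 1 ≤ c' by omega)
  have s2 := sl_le h (show c ≤ c' - 1 by omega)
  set P := sl h (c + 1) - sl h c with hP
  set R := sl h c' - sl h (c' - 1) with hR
  have hPp : 0 < P := by have := sl_lt h (show c < c + 1 by omega); linarith
  have hRp : 0 < R := by have := sl_lt h (show c' - 1 < c' by omega); linarith
  set S := sl h c' - sl h c with hS
  have hPS : P ≤ S := by linarith
  have hRS : R ≤ S := by linarith
  have e' : t * S = δ - δ' := by rw [hS]; linarith
  have hSp : 0 < S := by linarith
  have L1 : 0 ≤ δ → 2 * δ ≤ t * P := by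
    intro hd
    rw [low_nonneg h c hd] at lo
    have := mul_le_mul_of_nonneg_right lo hPp.le
    have e2 : 2 * δ * AA h (c + 1) * P = 2 * δ := by rw [mul_assoc, a3, mul_one]
    linarith
  have L2 : δ' ≤ 0 → -2 * δ' ≤ t * R := by
    intro hd
    rw [low_nonpos h c' hd] at lo'
    have := mul_le_mul_of_nonneg_right lo' hRp.le
    have e2 : -2 * δ' * AA h c' * R = -2 * δ' := by rw [mul_assoc, b3, mul_one]
    linarith
  rcases lt_trichotomy t 0 with ht | ht | ht
  · -- t negative
    have d1 : δ < 0 := by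
      by_contra hd; push Not at hd
      nlinarith [L1 hd]
    have d2 : 0 < δ' := by
      by_contra hd; push Not at hd
      nlinarith [L2 hd]
    have c0 : c = 0 := by
      by_contra hc
      have := (AA_mid h (show 0 < c by omega) (by omega)).1
      rw [low_nonpos h c d1.le] at lo
      nlinarith
    have cL : c' + 1 = D := by
      by_contra hc
      have := (AA_mid h (show 0 < c' + 1 by omega) (by omega)).1
      rw [low_nonneg h c' d2.le] at lo'
      nlinarith
    have q1 := AA_end hD h (i := c) (Or.inl c0)
    have q2 := AA_end hD h (i := c' + 1) (Or.inr cL)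
    have hSS : sl h (D - 1) - sl h 0 = S := by
      rw [hS, c0, show D - 1 = c' by omega]
    rw [hSS] at q1 q2
    have lo1 := lo; have lo2 := lo'
    rw [low_nonpos h c d1.le] at lo1
    rw [low_nonneg h c' d2.le] at lo2
    have m1 := mul_le_mul_of_nonneg_right lo1 hSp.le
    have m2 := mul_le_mul_of_nonneg_right lo2 hSp.le
    have n1 : -2 * δ * AA h c * S = 2 * δ := by rw [mul_assoc, q1.2.2]; ring
    have n2 : 2 * δ' * AA h (c' + 1) * S = -2 * δ' := by rw [mul_assoc, q2.2.2]; ring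
    have hdd : δ' = -δ := by linarith
    right; left
    refine ⟨c0, cL, d1.le, hdd, ?_, ?_⟩
    · rw [low_nonpos h c d1.le]
      apply mul_right_cancel₀ hSp.ne'
      rw [n1, e']; linarith
    · rw [low_nonneg h c' d2.le]
      apply mul_right_cancel₀ hSp.ne'
      rw [n2, e']; linarith
  · subst ht
    right; right
    refine ⟨rfl, ?_, ?_⟩
    · have hdd : δ = δ' := by linarith
      rcases le_total 0 δ with hd | hd
      · have := L1 hd; linarith
      · have := L2 (by linarith); linarith
    · have hdd : δ = δ' := by linarith
      rcases le_total 0 δ with hd | hd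
      · have := L1 hd; linarith
      · have := L2 (by linarith); linarith
  · left
    have m1 : t * P ≤ t * S := mul_le_mul_of_nonneg_left hPS ht.le
    have m2 : t * R ≤ t * S := mul_le_mul_of_nonneg_left hRS ht.le
    have d1 : 0 ≤ δ := by
      by_contra hd; push Not at hd
      have := L2 (by nlinarith [mul_pos ht hSp])
      nlinarith [mul_pos ht hSp]
    have d2 : δ' ≤ 0 := by
      by_contra hd; push Not at hd
      have := L1 d1
      nlinarith [mul_pos ht hSp]
    have l1 := L1 d1
    have l2 := L2 d2
    have hdd : δ' = -δ := by linarith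
    have hPS' : S = P := by
      apply mul_left_cancel₀ ht.ne'; linarith
    have cc : c' = c + 1 := by
      by_contra hne
      have := sl_lt h (show c + 1 < c' by omega)
      linarith
    refine ⟨cc, d1, hdd, ?_, ?_⟩
    · rw [low_nonneg h c d1]
      apply mul_right_cancel₀ hPp.ne'
      rw [mul_assoc, a3]; linarith
    · rw [low_nonpos h c' d2]
      apply mul_right_cancel₀ hRp.ne'
      rw [mul_assoc, b3]
      have : R = S := by apply mul_left_cancel₀ ht.ne'; linarith
      rw [this, e']; linarith

theorem collide (hD : 2 ≤ D) {h h' : Gam D} {c c' : ℕ} {δ δ' t t' z z' : ℝ}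
    (o : Ok h c δ t z) (o' : Ok h' c' δ' t' z') (e : pt h c δ t z = pt h' c' δ' t' z') :
    t = t' ∧ z = z' ∧ Glue h c δ t h' c' δ' := by
  simp only [pt, Prod.mk.injEq] at e
  obtain ⟨e1, rfl, e3⟩ := e
  refine ⟨rfl, ?_⟩
  have tg := o.t_ge hD
  have d := abs_le.1 o.hδ
  have d' := abs_le.1 o'.hδ
  have hz := abs_le.1 o.hz
  have hz' := abs_le.1 o'.hz
  by_cases hh : h = h'
  · subst hh
    by_cases hcc : c = c'
    · subst hcc
      exact ⟨by linarith, Glue.same rfl rfl (by linarith)⟩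
    · have ht : t ≤ 1 := by
        by_contra ht; push Not at ht
        rcases lt_or_gt_of_ne hcc with hl | hl
        · have := sl_lt h hl; nlinarith
        · have := sl_lt h hl; nlinarith
      rw [max_eq_right (by linarith)] at e3
      refine ⟨by linarith, ?_⟩
      rcases lt_or_gt_of_ne hcc with hl | hl
      · rcases glue_lt hD hl o'.hc o.lo o'.lo (by linarith) with ⟨a, b, c, d, e⟩ | ⟨a, b, c, d, e, f⟩ | ⟨a, b, c⟩
        · exact Glue.bot1 rfl a b c d e
        · exact Glue.wrap2 rfl a b c d e f
        · exact Glue.vert rfl a b c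
      · rcases glue_lt hD hl o.hc o'.lo o.lo (by linarith) with ⟨a, b, c, d, e⟩ | ⟨a, b, c, d, e, f⟩ | ⟨a, b, c⟩
        · exact Glue.bot2 rfl a (by linarith) (by linarith) e d
        · exact Glue.wrap1 rfl b a (by linarith) (by linarith) f e
        · exact Glue.vert rfl a c b
  · have hx := XX_dist hh
    have hs1 := sl_bd h c
    have hs2 := sl_bd h' c'
    have hc1 : (c : ℝ) + 1 ≤ D := by exact_mod_cast o.hc
    have hc2 : (c' : ℝ) + 1 ≤ D := by exact_mod_cast o'.hc
    have c0 : (0 : ℝ) ≤ c := by positivity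
    have c0' : (0 : ℝ) ≤ c' := by positivity
    have ht : 3 < t := by
      by_contra ht; push Not at ht
      have : |XX h - XX h'| ≤ 3 * (3 * D) + 1 := by
        have : XX h - XX h' = t * (sl h' c' - sl h c) + (δ' - δ) := by linarith
        rw [this]
        have hs : |sl h' c' - sl h c| ≤ 3 * D := by rw [abs_le]; constructor <;> linarith
        have ht' : |t| ≤ 3 := by rw [abs_le]; constructor <;> linarith
        have hd : |δ' - δ| ≤ 1 := by rw [abs_le]; constructor <;> linarith
        calc _ ≤ |t * (sl h' c' - sl h c)| + |δ' - δ| := abs_add_le _ _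
          _ ≤ 3 * (3 * D) + 1 := by
            rw [abs_mul]
            have := mul_le_mul ht' hs (abs_nonneg _) (by norm_num)
            linarith
      nlinarith
    rw [max_eq_left (by linarith)] at e3
    have hlam : lam h c = lam h' c' := by
      by_contra hne
      have h1 : (1 : ℝ) ≤ |(lam h c : ℝ) - lam h' c'| := by
        have : (1 : ℤ) ≤ |(lam h c : ℤ) - lam h' c'| := Int.one_le_abs (by omega)
        exact_mod_cast this
      have h2 : ((lam h c : ℝ) - lam h' c') * (t - 1) = (z' - z) / 4 := by linarith
      have h3 : |((lam h c : ℝ) - lam h' c') * (t - 1)| ≤ 1 / 2 := by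
        rw [h2, abs_le]; constructor <;> linarith
      rw [abs_mul, abs_of_pos (by linarith : (0:ℝ) < t - 1)] at h3
      nlinarith
    have hzz : z = z' := by rw [hlam] at e3; linarith
    refine ⟨hzz, ?_⟩
    have hcc : c = c' := by
      have := congrArg (· % D) hlam
      simp only [lam, Nat.mul_add_mod_self_right] at this
      rwa [Nat.mod_eq_of_lt o.hc, Nat.mod_eq_of_lt o'.hc] at this
    subst hcc
    have hmin : min (num h) (num (nb h c)) = min (num h') (num (nb h' c)) := by
      have h2 : min (num h) (num (nb h c)) * D = min (num h') (num (nb h' c)) * D := by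
        simp only [lam] at hlam; omega
      exact Nat.eq_of_mul_eq_mul_right (by omega) h2
    have hnb : h' = nb h c := by
      have n1 : num h ≠ num h' := fun e => hh (num_inj e)
      rcases min_choice (num h) (num (nb h c)) with m | m <;>
      rcases min_choice (num h') (num (nb h' c)) with m' | m' <;> rw [m, m'] at hmin
      · exact absurd hmin n1
      · have := num_inj hmin; rw [this, nb_nb]
      · exact (num_inj hmin).symm
      · have := num_inj hmin
        have := congrArg (fun k => nb k c) this
        simp only [nb_nb] at this
        exact absurd this hh
    subst hnb
    have hi := o.hi
    have hi' := o'.hi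
    rw [XX_nb, sl_nb h o.hc] at e1
    simp only [up, TT_nb, eta_nb h o.hc] at hi hi'
    refine Glue.top rfl rfl ?_ ?_ ?_
    · rcases eta_sq h c with e | e <;> rw [e] at e1 hi hi' <;> linarith
    · rw [up]; rcases eta_sq h c with e | e <;> rw [e] at e1 hi hi' ⊢ <;> linarith
    · rw [up, TT_nb, eta_nb h o.hc]; rcases eta_sq h c with e | e <;> rw [e] at e1 hi hi' ⊢ <;> linarith
end Fat
end

noncomputable section
set_option linter.unusedSectionVars false
open Classical

namespace Fat
variable {D : ℕ}

/-- Transverse strip coordinate. -/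
def dl (h : Gam D) (c : ℕ) (q : Q3) : ℝ := q.1 - XX h - q.2.1 * sl h c
/-- Vertical strip coordinate. -/
def zz (h : Gam D) (c : ℕ) (q : Q3) : ℝ := 4 * (q.2.2 - lam h c * max (q.2.1 - 1) 0)

theorem pt_dl (h : Gam D) (c : ℕ) (q : Q3) : pt h c (dl h c q) q.2.1 (zz h c q) = q := by
  simp only [pt, dl, zz]
  ext <;> simp
theorem dl_pt (h : Gam D) (c : ℕ) (δ t z : ℝ) : dl h c (pt h c δ t z) = δ := by
  simp only [pt, dl]; ring
theorem zz_pt (h : Gam D) (c : ℕ) (δ t z : ℝ) : zz h c (pt h c δ t z) = z := by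
  simp only [pt, zz]; ring
theorem t_pt (h : Gam D) (c : ℕ) (δ t z : ℝ) : (pt h c δ t z).2.1 = t := rfl

theorem dl_cont (h : Gam D) (c : ℕ) : Continuous (dl h c) := by unfold dl; fun_prop
theorem zz_cont (h : Gam D) (c : ℕ) : Continuous (zz h c) := by unfold zz; fun_prop

/-- The open region filled by the cells. -/
def NN (D : ℕ) : Set Q3 := {q | ∃ (h : Gam D) (c : ℕ), c < D ∧ |dl h c q| < 1 / 4 ∧ |zz h c q| < 1 ∧
  low h c (dl h c q) ≤ q.2.1 ∧ q.2.1 ≤ up h c (dl h c q)}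

theorem dl_diff (h : Gam D) (c c' : ℕ) (q : Q3) :
    dl h c' q = dl h c q - q.2.1 * (sl h c' - sl h c) := by simp only [dl]; ring

theorem zz_small (h : Gam D) (c : ℕ) {q : Q3} (ht : q.2.1 ≤ 1) : zz h c q = 4 * q.2.2 := by
  rw [zz, max_eq_right (by linarith)]; ring

theorem fan_pos (hD : 2 ≤ D) (h : Gam D) {c : ℕ} (hc : c < D) {q : Q3} (t0 : 0 < q.2.1) (t1 : q.2.1 < 1)
    (hz : |q.2.2| < 1 / 4) (hd : |dl h c q| < 1 / 4) : q ∈ NN D := by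
  obtain ⟨k, hk, hmin⟩ := Finset.exists_min_image (Finset.range D) (fun k => |dl h k q|)
    ⟨c, Finset.mem_range.2 hc⟩
  have hkD := Finset.mem_range.1 hk
  have hlt : |dl h k q| < 1 / 4 := lt_of_le_of_lt (hmin c (Finset.mem_range.2 hc)) hd
  refine ⟨h, k, hkD, hlt, ?_, ?_, ?_⟩
  · rw [zz_small h k t1.le, abs_mul, abs_of_pos (by norm_num : (0:ℝ) < 4)]; linarith
  · rcases le_total 0 (dl h k q) with d0 | d0
    · rw [low_nonneg h k d0]
      by_cases hk1 : k + 1 < D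
      · have m := hmin (k + 1) (Finset.mem_range.2 hk1)
        obtain ⟨a1, a2, a3⟩ := AA_mid h (Nat.succ_pos k) hk1
        simp only [Nat.succ_eq_add_one, Nat.add_sub_cancel] at a1 a2 a3
        rw [dl_diff h k (k + 1)] at m
        set P := sl h (k + 1) - sl h k with hP
        have hPp : 0 < P := by have := sl_lt h (show k < k + 1 by omega); linarith
        have := mul_pos t0 hPp
        have m2 : 2 * dl h k q ≤ q.2.1 * P := by
          rw [abs_of_nonneg d0] at m
          rcases le_abs.1 m with m | m <;> linarith
        calc 2 * dl h k q * AA h (k + 1) ≤ q.2.1 * P * AA h (k + 1) :=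
              mul_le_mul_of_nonneg_right m2 a1.le
          _ = q.2.1 * (AA h (k + 1) * P) := by ring
          _ = q.2.1 := by rw [a3, mul_one]
      · have := (AA_end hD h (i := k + 1) (Or.inr (by omega))).1
        nlinarith
    · rw [low_nonpos h k d0]
      by_cases hk1 : 0 < k
      · have m := hmin (k - 1) (Finset.mem_range.2 (by omega))
        obtain ⟨a1, a2, a3⟩ := AA_mid h hk1 hkD
        rw [dl_diff h k (k - 1)] at m
        set P := sl h k - sl h (k - 1) with hP
        have hPp : 0 < P := by have := sl_lt h (show k - 1 < k by omega); linarith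
        have := mul_pos t0 hPp
        have e : dl h k q - q.2.1 * (sl h (k - 1) - sl h k) = dl h k q + q.2.1 * P := by rw [hP]; ring
        rw [e] at m
        have m2 : -2 * dl h k q ≤ q.2.1 * P := by
          rw [abs_of_nonpos d0] at m
          rcases le_abs.1 m with m | m <;> linarith
        calc -2 * dl h k q * AA h k ≤ q.2.1 * P * AA h k :=
              mul_le_mul_of_nonneg_right m2 a1.le
          _ = q.2.1 * (AA h k * P) := by ring
          _ = q.2.1 := by rw [a3, mul_one]
      · have := (AA_end hD h (i := k) (Or.inl (by omega))).1
        nlinarith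
  · linarith [up_ge h hkD hlt.le]

theorem fan_zero (hD : 2 ≤ D) (h : Gam D) {q : Q3} (t1 : q.2.1 < 1)
    (hz : |q.2.2| < 1 / 4) (hd : |dl h 0 q| < 1 / 4) (hd' : |dl h (D - 1) q| < 1 / 4) :
    q ∈ NN D := by
  rcases lt_or_ge 0 q.2.1 with t0 | t0
  · exact fan_pos hD h (show 0 < D by omega) t0 t1 hz hd
  have hzz : ∀ c, |zz h c q| < 1 := by
    intro c
    rw [zz_small h c t1.le, abs_mul, abs_of_pos (by norm_num : (0:ℝ) < 4)]; linarith
  have e := dl_diff h 0 (D - 1) q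
  have q1 := AA_end hD h (i := 0) (Or.inl rfl)
  have q2 := AA_end hD h (i := D - 1 + 1) (Or.inr (by omega))
  set S := sl h (D - 1) - sl h 0 with hS
  have hSp : 0 < S := by have := sl_lt h (show 0 < D - 1 by omega); linarith
  have tS : q.2.1 * S ≤ 0 := mul_nonpos_of_nonpos_of_nonneg t0 hSp.le
  by_cases hs : 0 ≤ dl h 0 q + dl h (D - 1) q
  · refine ⟨h, D - 1, by omega, hd', hzz _, ?_, by linarith [up_ge h (show D - 1 < D by omega) hd'.le]⟩
    have d0 : 0 ≤ dl h (D - 1) q := by linarith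
    rw [low_nonneg _ _ d0]
    apply le_of_mul_le_mul_right _ hSp
    rw [mul_assoc, q2.2.2]; linarith
  · push Not at hs
    refine ⟨h, 0, by omega, hd, hzz _, ?_, by linarith [up_ge h (show 0 < D by omega) hd.le]⟩
    have d0 : dl h 0 q ≤ 0 := by linarith
    rw [low_nonpos _ _ d0]
    apply le_of_mul_le_mul_right _ hSp
    rw [mul_assoc, q1.2.2]; linarith

theorem dl_nb (h : Gam D) {c : ℕ} (hc : c < D) (q : Q3) :
    dl (nb h c) c q = dl h c q + eta h c * (q.2.1 - TT h c) := by
  simp only [dl, XX_nb, sl_nb h hc]; ring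
theorem zz_nb (h : Gam D) (c : ℕ) (q : Q3) : zz (nb h c) c q = zz h c q := by
  simp only [zz, lam_nb]

theorem low_cont (h : Gam D) (c : ℕ) : Continuous (low h c) := by unfold low; fun_prop
theorem up_cont (h : Gam D) (c : ℕ) : Continuous (up h c) := by unfold up; fun_prop

theorem NN_open (hD : 2 ≤ D) : IsOpen (NN D) := by
  rw [isOpen_iff_forall_mem_open]
  rintro q ⟨h, c, hc, hd, hz, lo, hi⟩
  have cd := dl_cont (D := D)
  have cz := zz_cont (D := D)
  have cl := low_cont (D := D)
  have cu := up_cont (D := D)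
  have ct : Continuous (fun q : Q3 => q.2.1) := by fun_prop
  have cy : Continuous (fun q : Q3 => q.2.2) := by fun_prop
  rcases lo.lt_or_eq with lo' | lo'
  · rcases hi.lt_or_eq with hi' | hi'
    · refine ⟨{q | |dl h c q| < 1 / 4} ∩ {q | |zz h c q| < 1} ∩ {q | low h c (dl h c q) < q.2.1} ∩
        {q | q.2.1 < up h c (dl h c q)}, ?_, ?_, ⟨⟨⟨hd, hz⟩, lo'⟩, hi'⟩⟩
      · rintro p ⟨⟨⟨a, b⟩, l⟩, u⟩
        exact ⟨h, c, hc, a, b, le_of_lt l, le_of_lt u⟩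
      · exact (((isOpen_lt (cd h c).abs continuous_const).inter
          (isOpen_lt (cz h c).abs continuous_const)).inter
          (isOpen_lt ((cl h c).comp (cd h c)) ct)).inter
          (isOpen_lt ct ((cu h c).comp (cd h c)))
    · have ee := eta_sq h c
      refine ⟨{q | |dl h c q| < 1 / 4} ∩ {q | |dl (nb h c) c q| < 1 / 4} ∩ {q | 3 < q.2.1} ∩
        {q | |zz h c q| < 1}, ?_, ?_, ⟨⟨⟨hd, ?_⟩, ?_⟩, hz⟩⟩
      · rintro p ⟨⟨⟨a, b⟩, l⟩, u⟩
        simp only [Set.mem_ofPred_eq] at a b l u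
        by_cases hp : p.2.1 ≤ up h c (dl h c p)
        · exact ⟨h, c, hc, a, u, by linarith [(abs_le.1 (low_abs hD h hc a.le)).2], hp⟩
        · push Not at hp
          refine ⟨nb h c, c, hc, b, by rw [zz_nb]; exact u,
            by linarith [(abs_le.1 (low_abs hD (nb h c) hc b.le)).2], ?_⟩
          simp only [up, eta_nb h hc, TT_nb, dl_nb h hc] at hp ⊢
          rcases ee with e | e <;> rw [e] at hp ⊢ <;> linarith
      · exact (((isOpen_lt (cd h c).abs continuous_const).inter
          (isOpen_lt (cd (nb h c) c).abs continuous_const)).inter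
          (isOpen_lt continuous_const ct)).inter
          (isOpen_lt (cz h c).abs continuous_const)
      · have : dl (nb h c) c q = - dl h c q := by
          rw [dl_nb h hc, hi', up]
          rcases ee with e | e <;> rw [e] <;> ring
        simp only [Set.mem_ofPred_eq, this, abs_neg]; exact hd
      · simp only [Set.mem_ofPred_eq]
        linarith [up_ge h hc hd.le]
  · have t1 : q.2.1 < 1 := by linarith [(abs_le.1 (low_abs hD h hc hd.le)).2]
    have hy : |q.2.2| < 1 / 4 := by
      rw [zz_small h c t1.le, abs_mul, abs_of_pos (by norm_num : (0:ℝ) < 4)] at hz; linarith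
    rcases lt_or_ge 0 q.2.1 with t0 | t0
    · refine ⟨{q | 0 < q.2.1} ∩ {q | q.2.1 < 1} ∩ {q | |q.2.2| < 1 / 4} ∩ {q | |dl h c q| < 1 / 4},
        ?_, ?_, ⟨⟨⟨t0, t1⟩, hy⟩, hd⟩⟩
      · rintro p ⟨⟨⟨a, b⟩, l⟩, u⟩
        exact fan_pos hD h hc a b l u
      · exact (((isOpen_lt continuous_const ct).inter (isOpen_lt ct continuous_const)).inter
          (isOpen_lt cy.abs continuous_const)).inter (isOpen_lt (cd h c).abs continuous_const)
    · have key : |dl h 0 q| < 1 / 4 ∧ |dl h (D - 1) q| < 1 / 4 := by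
        have q1 := AA_end hD h (i := 0) (Or.inl rfl)
        have q2 := AA_end hD h (i := D) (Or.inr rfl)
        have e := dl_diff h 0 (D - 1) q
        rcases lt_trichotomy (dl h c q) 0 with d | d | d
        · rw [low_nonpos h c d.le] at lo'
          have c0 : c = 0 := by
            by_contra hne
            have := (AA_mid h (show 0 < c by omega) hc).1
            nlinarith
          subst c0
          have : dl h (D - 1) q = - dl h 0 q := by
            rw [e, ← lo', mul_assoc, q1.2.2]; ring
          rw [this, abs_neg]; exact ⟨hd, hd⟩
        · rw [d, low_zero] at lo'
          rw [dl_diff h c 0, dl_diff h c (D - 1), ← lo', d]; norm_num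
        · rw [low_nonneg h c d.le] at lo'
          have c0 : c + 1 = D := by
            by_contra hne
            have := (AA_mid h (show 0 < c + 1 by omega) (by omega)).1
            nlinarith
          have c1 : D - 1 = c := by omega
          rw [c0] at lo'
          have e2 : dl h 0 q = - dl h c q := by
            have : q.2.1 * (sl h (D - 1) - sl h 0) = - 2 * dl h c q := by
              rw [← lo', mul_assoc, q2.2.2]; ring
            rw [c1] at e this
            linarith
          rw [c1, e2, abs_neg]; exact ⟨hd, hd⟩
      refine ⟨{q | q.2.1 < 1} ∩ {q | |q.2.2| < 1 / 4} ∩ {q | |dl h 0 q| < 1 / 4} ∩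
        {q | |dl h (D - 1) q| < 1 / 4}, ?_, ?_, ⟨⟨⟨t1, hy⟩, key.1⟩, key.2⟩⟩
      · rintro p ⟨⟨⟨a, b⟩, l⟩, u⟩
        exact fan_zero hD h a b l u
      · exact (((isOpen_lt ct continuous_const).inter
          (isOpen_lt cy.abs continuous_const)).inter (isOpen_lt (cd h 0).abs continuous_const)).inter
          (isOpen_lt (cd h (D - 1)).abs continuous_const)
end Fat
end

noncomputable section
set_option linter.unusedSectionVars false
open Classical

namespace Fat
variable {D : ℕ}

/-- Edges of the graph, with a preferred end. -/
abbrev Ed (D : ℕ) := {p : Gam D × Fin D // lft p.1 p.2}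

/-- The edge of colour `c` at `h`. -/
def ed (h : Gam D) (c : Fin D) : Ed D :=
  if l : lft h c then ⟨(h, c), l⟩ else ⟨(nb h c, c), (lft_nb h c.2).2 l⟩

theorem ed_self (e : Ed D) : ed e.1.1 e.1.2 = e := by
  rw [ed, dif_pos e.2]
theorem ed_nb (h : Gam D) (c : Fin D) : ed (nb h c) c = ed h c := by
  by_cases l : lft h c
  · rw [ed, ed, dif_neg (by rw [lft_nb h c.2]; simpa using l), dif_pos l]
    simp only [nb_nb]
  · rw [ed, ed, dif_pos ((lft_nb h c.2).2 l), dif_neg l]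
theorem ed_ends (h : Gam D) (c : Fin D) : (ed h c).1.2 = c ∧ ((ed h c).1.1 = h ∨ (ed h c).1.1 = nb h c) := by
  rw [ed]; split_ifs <;> simp
theorem ed_eq {h h' : Gam D} {c c' : Fin D} (e : ed h c = ed h' c') : c = c' ∧ (h' = h ∨ h' = nb h c) := by
  obtain ⟨a1, a2⟩ := ed_ends h c
  obtain ⟨b1, b2⟩ := ed_ends h' c'
  rw [e] at a1 a2
  have hc : c = c' := a1.symm.trans b1
  subst hc
  refine ⟨rfl, ?_⟩
  rcases a2 with a | a <;> rcases b2 with b | b <;> rw [a] at b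
  · exact Or.inl b.symm
  · right; rw [b, nb_nb]
  · right; exact b.symm
  · left
    have := congrArg (fun k => nb k (c : ℕ)) b
    simpa only [nb_nb] using this.symm

/-- Base cells. -/
inductive Bc (D : ℕ) : Type
  | G : Gam D → Bc D
  | R : Gam D → Bc D
  | E : Ed D → Bc D
  | V : Gam D → Bc D

namespace Bc
/-- Face relation between base cells. -/
def le (x : Bc D) : Bc D → Prop
  | G g => x = G g ∨ x = R g ∨ x = R (pv g D) ∨ (∃ i, i ≤ D ∧ x = V (pv g i)) ∨
      ∃ c : Fin D, x = E (ed (pv g c) c)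
  | R h => x = R h ∨ x = V h
  | E e => x = E e ∨ x = V e.1.1 ∨ x = V (nb e.1.1 e.1.2)
  | V h => x = V h
/-- Rank. -/
def rk : Bc D → ℕ
  | G _ => 1
  | R _ => 0
  | E _ => 1
  | V _ => 0
/-- Whether the cell is off the wall. -/
def off : Bc D → Prop
  | G _ => True
  | R _ => True
  | E _ => False
  | V _ => False

theorem le_refl (b : Bc D) : le b b := by cases b <;> simp [le]

theorem le_V {k : Gam D} {h : Gam D} {c : Fin D} : le (V k) (E (ed h c)) ↔ k = h ∨ k = nb h c := by
  obtain ⟨a1, a2⟩ := ed_ends h c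
  simp only [le, V.injEq, a1, reduceCtorEq, false_or]
  rcases a2 with a | a <;> rw [a]
  rw [nb_nb]; tauto

theorem V_pv {g : Gam D} {i : ℕ} (hi : i ≤ D) : le (V (pv g i)) (G g) := by
  simp only [le]; right; right; right; left; exact ⟨i, hi, rfl⟩
theorem V_G {g k : Gam D} : le (V k) (G g) ↔ ∃ i, i ≤ D ∧ pv g i = k := by
  simp only [le, V.injEq, reduceCtorEq, false_or, exists_false, or_false]
  constructor <;> rintro ⟨i, a, b⟩ <;> exact ⟨i, a, b.symm⟩
theorem E_G {g : Gam D} {e : Ed D} : le (E e) (G g) ↔ ∃ c : Fin D, e = ed (pv g c) c := by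
  simp [le]
theorem R_G {g k : Gam D} : le (R k) (G g) ↔ k = g ∨ k = pv g D := by
  simp [le]

theorem le_trans {a b c : Bc D} (h1 : le a b) (h2 : le b c) : le a c := by
  cases c with
  | V h => cases h2; exact h1
  | R h => rcases h2 with rfl | rfl
           · exact h1
           · cases h1; simp [le]
  | E e => rcases h2 with rfl | rfl | rfl
           · exact h1
           · cases h1; simp [le]
           · cases h1; simp [le]
  | G g =>
    rcases h2 with rfl | rfl | rfl | ⟨i, hi, rfl⟩ | ⟨c, rfl⟩
    · exact h1
    · rcases h1 with rfl | rfl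
      · simp [le]
      · rw [V_G]; exact ⟨0, by omega, pv_zero g⟩
    · rcases h1 with rfl | rfl
      · simp [le]
      · rw [V_G]; exact ⟨D, le_rfl, rfl⟩
    · cases h1; exact V_pv hi
    · have hv : ∀ k, le (V k) (E (ed (pv g c) c)) → le (V k) (G g) := by
        intro k hk
        rcases le_V.1 hk with rfl | rfl
        · exact V_pv c.2.le
        · rw [← pv_succ]; exact V_pv c.2
      have h1' := h1
      rcases h1 with rfl | rfl | rfl
      · rw [E_G]; exact ⟨c, rfl⟩
      · exact hv _ h1'
      · exact hv _ h1'

theorem ends_le {e : Ed D} {b : Bc D} (h1 : le (V e.1.1) b) (h2 : le (V (nb e.1.1 e.1.2)) b) :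
    le (E e) b := by
  have hne := nb_ne e.1.1 e.1.2.2
  cases b with
  | V h => cases h1; simp [le] at h2; exact absurd h2 hne
  | R h => simp [le] at h1 h2; exact absurd (h2.trans h1.symm) hne
  | E f =>
    rw [← ed_self f, le_V] at h1 h2
    simp only [le, E.injEq, reduceCtorEq, or_false]
    have key : ∀ (h h' : Gam D) (c c' : Fin D), (h = h' ∧ nb h c = nb h' c') ∨ (h = nb h' c' ∧ nb h c = h') →
        c = c' := by
      intro h h' c c' hh
      have : sw D c = sw D c' := by
        rcases hh with ⟨rfl, a⟩ | ⟨rfl, a⟩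
        · exact mul_left_cancel a
        · have : nb (nb h' ↑c') c' = nb (nb h' c') c := by rw [a, nb_nb]
          exact (mul_left_cancel this).symm
      have := congrArg (fun f => (f (Fin.ofNat (D+1) c)).val) this
      simp only [sw, Equiv.swap_apply_left] at this
      have c1 := c.2; have c2 := c'.2
      rw [ofNat_val (by omega)] at this
      by_cases e1 : (c : ℕ) = c'
      · exact Fin.ext e1
      by_cases e2 : (c : ℕ) = c' + 1
      · rw [e2, Equiv.swap_apply_right, ofNat_val (by omega)] at this
        omega
      · rw [Equiv.swap_apply_of_ne_of_ne, ofNat_val (by omega)] at this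
        · omega
        · intro h; have := congrArg Fin.val h
          rw [ofNat_val (by omega), ofNat_val (by omega)] at this; exact e1 this
        · intro h; have := congrArg Fin.val h
          rw [ofNat_val (by omega), ofNat_val (by omega)] at this; exact e2 this
    rcases h1 with h1 | h1 <;> rcases h2 with h2 | h2
    · rw [h2, h1] at hne; exact absurd rfl hne
    · have := key _ _ _ _ (Or.inl ⟨h1, h2⟩)
      rw [← ed_self e, ← ed_self f, h1, this]
    · have := key _ _ _ _ (Or.inr ⟨h1, h2⟩)
      rw [← ed_self e, ← ed_self f, h1, this, ed_nb]
    · rw [h2, h1] at hne; exact absurd rfl hne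
  | G g =>
    rw [V_G] at h1 h2
    obtain ⟨i, hi, h1⟩ := h1
    obtain ⟨k, hk, h2⟩ := h2
    set h := e.1.1 with hh
    set c := e.1.2 with hc
    have ee : e = ed h c := (ed_self e).symm
    rw [E_G, ee]
    by_cases hg : g = st h c
    · refine ⟨c, ?_⟩; rw [hg, pv_st]
    by_cases hg' : g = st h (c + 1)
    · refine ⟨c, ?_⟩
      have : pv g c = nb h c := by
        have := pv_succ g c
        rw [hg', pv_st] at this
        have h3 := congrArg (fun k => nb k (c : ℕ)) this
        simp only [nb_nb] at h3
        rw [hg', h3]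
      rw [this, ed_nb]
    exfalso
    have c1 := c.2
    have p1 : pv (st h c) (c + 1) = nb h c := by rw [pv_succ, pv_st]
    have p2 : pv (st h (c + 1)) c = nb h c := by
      have := pv_succ (st h (c + 1)) c
      rw [pv_st] at this
      have h3 := congrArg (fun k => nb k (c : ℕ)) this
      simp only [nb_nb] at h3
      rw [h3]
    rcases lt_trichotomy i k with hik | hik | hik
    · have := pv_two hi (j := c) (by omega) hk (l := c + 1) (by omega) hg (by rw [h1, pv_st]) (by rw [h2, p1]) hik
      omega
    · subst hik; rw [h1] at h2; exact hne h2.symm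
    · have := pv_two hk (j := c) (by omega) hi (l := c + 1) (by omega) hg' (by rw [h2, p2]) (by rw [h1, pv_st]) hik
      omega

theorem meet_aux (b b' : Bc D) (hb : ∀ g, b ≠ G g) :
    (∀ x, ¬ (le x b ∧ le x b')) ∨ ∃ b'', ∀ x, (le x b ∧ le x b') ↔ le x b'' := by
  by_cases hbb : le b b'
  · exact Or.inr ⟨b, fun x => ⟨fun h => h.1, fun h => ⟨h, le_trans h hbb⟩⟩⟩
  have hV : ∀ h, le (V h) b → le (V h) b' → (∀ x, le x b → le x b' → x = V h) →
      ∃ b'', ∀ x, (le x b ∧ le x b') ↔ le x b'' :=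
    fun h h1 h2 h3 => ⟨V h, fun x => ⟨fun hx => h3 x hx.1 hx.2, by rintro rfl; exact ⟨h1, h2⟩⟩⟩
  cases b with
  | G g => exact absurd rfl (hb g)
  | V h => left; rintro x ⟨rfl, hx⟩; exact hbb hx
  | R h =>
    by_cases h1 : le (V h) b'
    · right
      refine hV h (by simp [le]) h1 ?_
      rintro x (rfl | rfl) hx
      · exact absurd hx hbb
      · rfl
    · left
      rintro x ⟨rfl | rfl, hx⟩
      · exact hbb hx
      · exact h1 hx
  | E e =>
    by_cases h1 : le (V e.1.1) b'
    · have h2 : ¬ le (V (nb e.1.1 e.1.2)) b' := fun h2 => hbb (ends_le h1 h2)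
      right
      refine hV _ (by simp [le]) h1 ?_
      rintro x (rfl | rfl | rfl) hx
      · exact absurd hx hbb
      · rfl
      · exact absurd hx h2
    · by_cases h2 : le (V (nb e.1.1 e.1.2)) b'
      · right
        refine hV _ (by simp [le]) h2 ?_
        rintro x (rfl | rfl | rfl) hx
        · exact absurd hx hbb
        · exact absurd hx h1
        · rfl
      · left
        rintro x ⟨rfl | rfl | rfl, hx⟩
        · exact hbb hx
        · exact h1 hx
        · exact h2 hx

theorem meet_GG (hD : 2 ≤ D) (g g' : Gam D) (hne : g ≠ g') :
    (∀ x, ¬ (le x (G g) ∧ le x (G g'))) ∨ ∃ b'', ∀ x, (le x (G g) ∧ le x (G g')) ↔ le x b'' := by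
  -- uniqueness of common vertices
  have two : ∀ i j k l, i ≤ D → j ≤ D → k ≤ D → l ≤ D → pv g i = pv g' j → pv g k = pv g' l → i < k →
    k = i + 1 ∧ l = i ∧ j = i + 1 := fun i j k l a b c d e f h => pv_two a b c d hne e f h
  have edV : ∀ c : Fin D, le (E (ed (pv g c) c)) (G g') → pv g c = pv g' (c + 1) ∧ pv g (c + 1) = pv g' c := by
    intro c hc
    obtain ⟨c', hc'⟩ := E_G.1 hc
    obtain ⟨rfl, h | h⟩ := ed_eq hc'
    · exact absurd (mul_right_cancel h).symm hne
    · constructor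
      · rw [pv_succ, h, nb_nb]
      · rw [pv_succ, h]
  have nG : ∀ x, le x (G g) → le x (G g') → ∀ k, x ≠ G k := by
    rintro x h1 h2 k rfl
    simp [le] at h1 h2
    exact hne (h1.symm.trans h2)
  have nR : ∀ k, le (R k) (G g) → le (R k) (G g') → (pv g 0 = pv g' D ∧ k = pv g 0) ∨ (pv g D = pv g' 0 ∧ k = pv g D) := by
    intro k h1 h2
    rw [R_G] at h1 h2
    rcases h1 with rfl | rfl
    · rcases h2 with h | h
      · exact absurd h hne
      · left; rw [pv_zero]; exact ⟨h, rfl⟩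
    · rcases h2 with h | h
      · right; rw [pv_zero]; exact ⟨h, rfl⟩
      · exact absurd (mul_right_cancel h) hne
  by_cases hE : ∃ c : Fin D, le (E (ed (pv g c) c)) (G g')
  · obtain ⟨c, hc⟩ := hE
    right
    obtain ⟨e1, e2⟩ := edV c hc
    have c1 := c.2
    have uq : ∀ i j, i ≤ D → j ≤ D → pv g i = pv g' j → i = c ∨ i = c + 1 := by
      intro i j hi hj h
      by_contra hn
      push Not at hn
      rcases lt_or_gt_of_ne hn.1 with hl | hl
      · have := two i j (c + 1) c hi hj (by omega) (by omega) h e2 (by omega); omega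
      · have := two c (c + 1) i j (by omega) (by omega) hi hj e1 h (by omega); omega
    refine ⟨E (ed (pv g c) c), fun x => ⟨?_, fun hx => ⟨le_trans hx (by rw [E_G]; exact ⟨c, rfl⟩), le_trans hx hc⟩⟩⟩
    rintro ⟨h1, h2⟩
    cases x with
    | G k => exact absurd rfl (nG _ h1 h2 k)
    | R k =>
      exfalso
      rcases nR k h1 h2 with ⟨h, -⟩ | ⟨h, -⟩
      · by_cases c0 : (c : ℕ) = 0
        · have := two 0 D (c + 1) c (by omega) (by omega) (by omega) (by omega) h e2 (by omega); omega
        · have := two 0 D c (c + 1) (by omega) (by omega) (by omega) (by omega) h e1 (by omega); omega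
      · have := two c (c + 1) D 0 (by omega) (by omega) (by omega) (by omega) e1 h (by omega); omega
    | V k =>
      rw [V_G] at h1 h2
      obtain ⟨i, hi, rfl⟩ := h1
      obtain ⟨j, hj, h2⟩ := h2
      rw [le_V]
      rcases uq i j hi hj h2.symm with rfl | rfl
      · exact Or.inl rfl
      · exact Or.inr (pv_succ _ _)
    | E e =>
      obtain ⟨c', rfl⟩ := E_G.1 h1
      obtain ⟨f1, f2⟩ := edV c' h2
      have c2 := c'.2
      have u1 := uq _ _ (by omega) (by omega) f1
      have u2 := uq _ _ (by omega) (by omega) f2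
      have : c' = c := Fin.ext (by omega)
      rw [this]; exact le_refl _
  have uq : ∀ i j k l, i ≤ D → j ≤ D → k ≤ D → l ≤ D → pv g i = pv g' j → pv g k = pv g' l → i = k := by
    have w : ∀ i j k l, i ≤ D → j ≤ D → k ≤ D → l ≤ D → pv g i = pv g' j → pv g k = pv g' l → ¬ i < k := by
      intro i j k l hi hj hk hl h1 h2 hik
      obtain ⟨rfl, rfl, rfl⟩ := two i j k l hi hj hk hl h1 h2 hik
      apply hE
      refine ⟨⟨l, by omega⟩, E_G.2 ⟨⟨l, by omega⟩, ?_⟩⟩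
      simp only
      rw [← h2, pv_succ]
      exact (ed_nb (pv g l) ⟨l, by omega⟩).symm
    intro i j k l hi hj hk hl h1 h2
    have := w i j k l hi hj hk hl h1 h2
    have := w k l i j hk hl hi hj h2 h1
    omega
  by_cases hV : ∃ i j, i ≤ D ∧ j ≤ D ∧ pv g i = pv g' j
  · obtain ⟨i, j, hi, hj, hij⟩ := hV
    right
    by_cases hR : le (R (pv g i)) (G g) ∧ le (R (pv g i)) (G g')
    · refine ⟨R (pv g i), fun x => ⟨?_, fun hx => ⟨le_trans hx hR.1, le_trans hx hR.2⟩⟩⟩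
      rintro ⟨h1, h2⟩
      cases x with
      | G k => exact absurd rfl (nG _ h1 h2 k)
      | R k =>
        rcases nR k h1 h2 with ⟨h, rfl⟩ | ⟨h, rfl⟩
        · rw [congrArg (pv g) (uq _ _ _ _ (by omega) (by omega) hi hj h hij)]; simp [le]
        · rw [congrArg (pv g) (uq _ _ _ _ (by omega) (by omega) hi hj h hij)]; simp [le]
      | V k =>
        rw [V_G] at h1 h2
        obtain ⟨a, ha, rfl⟩ := h1
        obtain ⟨b, hb, h2⟩ := h2
        rw [uq _ _ _ _ ha hb hi hj h2.symm hij]; simp [le]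
      | E e =>
        obtain ⟨c', rfl⟩ := E_G.1 h1
        exact absurd ⟨c', h2⟩ hE
    · refine ⟨V (pv g i), fun x => ⟨?_, ?_⟩⟩
      · rintro ⟨h1, h2⟩
        cases x with
        | G k => exact absurd rfl (nG _ h1 h2 k)
        | R k =>
          exfalso; apply hR
          rcases nR k h1 h2 with ⟨h, rfl⟩ | ⟨h, rfl⟩
          · rw [congrArg (pv g) (uq _ _ _ _ (by omega) (by omega) hi hj h hij)] at h1 h2; exact ⟨h1, h2⟩
          · rw [congrArg (pv g) (uq _ _ _ _ (by omega) (by omega) hi hj h hij)] at h1 h2; exact ⟨h1, h2⟩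
        | V k =>
          rw [V_G] at h1 h2
          obtain ⟨a, ha, rfl⟩ := h1
          obtain ⟨b, hb, h2⟩ := h2
          rw [uq _ _ _ _ ha hb hi hj h2.symm hij]; simp [le]
        | E e =>
          obtain ⟨c', rfl⟩ := E_G.1 h1
          exact absurd ⟨c', h2⟩ hE
      · rintro rfl
        exact ⟨V_pv hi, by rw [hij]; exact V_pv hj⟩
  · left
    rintro x ⟨h1, h2⟩
    apply hV
    cases x with
    | G k => exact absurd rfl (nG _ h1 h2 k)
    | R k =>
      rcases nR k h1 h2 with ⟨h, -⟩ | ⟨h, -⟩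
      · exact ⟨_, _, by omega, by omega, h⟩
      · exact ⟨_, _, by omega, by omega, h⟩
    | V k =>
      rw [V_G] at h1 h2
      obtain ⟨a, ha, rfl⟩ := h1
      obtain ⟨b, hb, h2⟩ := h2
      exact ⟨a, b, ha, hb, h2.symm⟩
    | E e =>
      obtain ⟨c', rfl⟩ := E_G.1 h1
      exact absurd ⟨c', h2⟩ hE

theorem meet (hD : 2 ≤ D) (b b' : Bc D) :
    (∀ x, ¬ (le x b ∧ le x b')) ∨ ∃ b'', ∀ x, (le x b ∧ le x b') ↔ le x b'' := by
  by_cases hb : ∀ g, b ≠ G g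
  · exact meet_aux b b' hb
  by_cases hb' : ∀ g, b' ≠ G g
  · rcases meet_aux b' b hb' with h | ⟨c, h⟩
    · left; intro x hx; exact h x hx.symm
    · right; exact ⟨c, fun x => by rw [← h x, and_comm]⟩
  push Not at hb hb'
  obtain ⟨g, rfl⟩ := hb
  obtain ⟨g', rfl⟩ := hb'
  by_cases hgg : g = g'
  · subst hgg; exact Or.inr ⟨G g, fun x => by simp⟩
  · exact meet_GG hD g g' hgg

theorem rk_le {a b : Bc D} (h : le a b) : a.rk ≤ b.rk := by
  cases b with
  | G g => cases a <;> simp [rk]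
  | R h => rcases h with rfl | rfl <;> simp [rk]
  | E e => cases a <;> simp [rk]
  | V h => cases h; exact le_rfl
theorem rk_eq {a b : Bc D} (h : le a b) (hr : a.rk = b.rk) (ho : a.off ↔ b.off) : a = b := by
  cases b with
  | G g => rcases h with rfl | rfl | rfl | ⟨_, _, rfl⟩ | ⟨_, rfl⟩ <;> simp_all [rk, off]
  | R h => rcases h with rfl | rfl <;> simp_all [rk, off]
  | E e => rcases h with rfl | rfl | rfl <;> simp_all [rk, off]
  | V h => exact h
theorem off_mono {a b : Bc D} (h : le a b) (ha : a.off) : b.off := by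
  cases b with
  | G g => trivial
  | R h => trivial
  | E e => rcases h with rfl | rfl | rfl <;> simp_all [off]
  | V h => cases h; exact ha
end Bc
end Fat
end

noncomputable section
set_option linter.unusedSectionVars false
open Classical

namespace Fat
variable {D : ℕ}

/-- A point of a strip. -/
structure Sp (D : ℕ) where
  h : Gam D
  c : Fin D
  δ : ℝ
  t : ℝ
  z : ℝ
  ok : Ok h c δ t z

namespace Sp
/-- Position in space. -/
def q (s : Sp D) : Q3 := pt s.h s.c s.δ s.t s.z
/-- The base cell of a strip point. -/
def a (s : Sp D) : Bc D :=
  if s.δ < 0 then (if (s.c : ℕ) = 0 ∧ s.t = low s.h s.c s.δ then Bc.R s.h else Bc.G (st s.h s.c))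
  else if 0 < s.δ then
    (if (s.c : ℕ) + 1 = D ∧ s.t = low s.h s.c s.δ then Bc.R s.h else Bc.G (st s.h (s.c + 1)))
  else if s.t = 0 then Bc.V s.h else Bc.E (ed s.h s.c)

theorem a_off (s : Sp D) : s.a.off ↔ s.δ ≠ 0 := by
  unfold a
  rcases lt_trichotomy s.δ 0 with h | h | h
  · rw [if_pos h]; split_ifs <;> simp [Bc.off, h.ne]
  · simp only [h, lt_self_iff_false, if_false]; split_ifs <;> simp [Bc.off]
  · rw [if_neg (by linarith), if_pos h]; split_ifs <;> simp [Bc.off, h.ne']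

theorem a_neg {s : Sp D} (h : s.δ < 0) : s.a =
    if (s.c : ℕ) = 0 ∧ s.t = low s.h s.c s.δ then Bc.R s.h else Bc.G (st s.h s.c) := by
  rw [a, if_pos h]
theorem a_pos {s : Sp D} (h : 0 < s.δ) : s.a =
    if (s.c : ℕ) + 1 = D ∧ s.t = low s.h s.c s.δ then Bc.R s.h else Bc.G (st s.h (s.c + 1)) := by
  rw [a, if_neg (by linarith), if_pos h]
theorem a_zero {s : Sp D} (h : s.δ = 0) : s.a =
    if s.t = 0 then Bc.V s.h else Bc.E (ed s.h s.c) := by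
  rw [a, if_neg (by linarith), if_neg (by linarith)]

theorem low_lt_up (hD : 2 ≤ D) (s : Sp D) : low s.h s.c s.δ + 8 < up s.h s.c s.δ := by
  have := (abs_le.1 (low_abs hD s.h s.ok.hc s.ok.hδ)).2
  have := up_ge s.h s.ok.hc s.ok.hδ
  linarith

theorem q_inv (hD : 2 ≤ D) {s s' : Sp D} (e : s.q = s'.q) :
    s.a = s'.a ∧ |s.δ| = |s'.δ| ∧ s.z = s'.z := by
  have L1 := s.low_lt_up hD
  have L2 := s'.low_lt_up hD
  obtain ⟨h, c, δ, t, z, ok⟩ := s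
  obtain ⟨h', c', δ', t', z', ok'⟩ := s'
  obtain ⟨rfl, rfl, gl⟩ := collide hD ok ok' e
  have cD := c.2
  have cD' := c'.2
  simp only at L1 L2
  cases gl with
  | same e1 e2 e3 => obtain rfl := e1; obtain rfl := e3; obtain rfl := Fin.ext e2; exact ⟨rfl, rfl, rfl⟩
  | bot1 e1 e2 e3 e4 e5 e6 =>
    obtain rfl := e1; obtain rfl := e4
    refine ⟨?_, by simp, rfl⟩
    rcases e3.lt_or_eq with d | d
    · rw [a_pos d, a_neg (by simpa using d), if_neg (by simp only; omega), if_neg (by simp only; omega)]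
      simp only [e2]
    · obtain rfl := d.symm
      rw [low_zero] at e5
      obtain rfl := e5
      simp [a]
  | bot2 e1 e2 e3 e4 e5 e6 =>
    obtain rfl := e1; obtain rfl := e4
    refine ⟨?_, by simp, rfl⟩
    rcases e3.lt_or_eq with d | d
    · rw [a_neg d, a_pos (by simpa using d), if_neg (by simp only; omega), if_neg (by simp only; omega)]
      simp only [e2]
    · obtain rfl := d
      rw [low_zero] at e5
      obtain rfl := e5
      simp [a]
  | wrap1 e1 e2 e3 e4 e5 e6 e7 =>
    obtain rfl := e1; obtain rfl := e5
    refine ⟨?_, by simp, rfl⟩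
    rcases e4.lt_or_eq with d | d
    · rw [a_pos d, a_neg (by simpa using d), if_pos ⟨e2, e6⟩, if_pos ⟨e3, e7⟩]
    · obtain rfl := d.symm
      rw [low_zero] at e6
      obtain rfl := e6
      simp [a]
  | wrap2 e1 e2 e3 e4 e5 e6 e7 =>
    obtain rfl := e1; obtain rfl := e5
    refine ⟨?_, by simp, rfl⟩
    rcases e4.lt_or_eq with d | d
    · rw [a_neg d, a_pos (by simpa using d), if_pos ⟨e2, e6⟩, if_pos ⟨e3, e7⟩]
    · obtain rfl := d
      rw [low_zero] at e6
      obtain rfl := e6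
      simp [a]
  | vert e1 e2 e3 e4 =>
    obtain rfl := e1; obtain rfl := e3; obtain rfl := e4; obtain rfl := e2
    refine ⟨?_, rfl, rfl⟩
    simp [a]
  | top e1 e2 e3 e4 e5 =>
    obtain rfl := e1; obtain rfl := Fin.ext e2; obtain rfl := e3
    refine ⟨?_, by simp, rfl⟩
    have u := up_ge h ok.hc ok.hδ
    rcases lt_trichotomy δ 0 with d | d | d
    · rw [a_neg d, a_pos (by simpa using d), if_neg (by simp only; rintro ⟨-, h⟩; linarith),
        if_neg (by simp only; rintro ⟨-, h⟩; linarith)]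
      simp only [st_nb]
    · subst d
      have t0 : t ≠ 0 := by intro h; linarith
      simp [a, t0, ed_nb]
    · rw [a_pos d, a_neg (by simpa using d), if_neg (by simp only; rintro ⟨-, h⟩; linarith),
        if_neg (by simp only; rintro ⟨-, h⟩; linarith)]
      simp only
      rw [← st_nb (nb h c'), nb_nb]
end Sp

theorem pt_top (h : Gam D) {c : ℕ} (hc : c < D) (δ z : ℝ) :
    pt h c δ (up h c δ) z = pt (nb h c) c (-δ) (up h c δ) z := by
  simp only [pt, lam_nb, XX_nb, sl_nb h hc, up]
  ext
  · simp only
    rcases eta_sq h c with e | e <;> rw [e] <;> ring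
  · rfl
  · rfl
theorem up_nb (h : Gam D) {c : ℕ} (hc : c < D) (δ : ℝ) : up (nb h c) c (-δ) = up h c δ := by
  simp only [up, TT_nb, eta_nb h hc]; ring

theorem pt_low_eq (hD : 2 ≤ D) (h : Gam D) {c c' : ℕ} (hc : c < D) {δ : ℝ}
    (hδ : |δ| ≤ 1 / 4) (z : ℝ) (e : low h c' (-δ) = low h c δ)
    (e2 : low h c δ * (sl h c' - sl h c) = 2 * δ) :
    pt h c δ (low h c δ) z = pt h c' (-δ) (low h c' (-δ)) z := by
  have := (abs_le.1 (low_abs hD h hc hδ)).2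
  rw [e]
  simp only [pt]
  rw [max_eq_right (by linarith)]
  ext
  · simp only; linarith
  · rfl
  · simp

theorem low_bot (h : Gam D) {c : ℕ} (hc : c + 1 < D) {δ : ℝ} (h0 : 0 ≤ δ) :
    low h (c + 1) (-δ) = low h c δ ∧ low h c δ * (sl h (c + 1) - sl h c) = 2 * δ := by
  rw [low_nonneg h c h0, low_nonpos h (c + 1) (by linarith)]
  refine ⟨by ring, ?_⟩
  have := (AA_mid h (Nat.succ_pos c) hc).2.2
  simp only [Nat.succ_eq_add_one, Nat.add_sub_cancel] at this
  rw [mul_assoc, this]; ring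
theorem low_wrap (hD : 2 ≤ D) (h : Gam D) {δ : ℝ} (h0 : 0 ≤ δ) {c : ℕ} (hc : c + 1 = D) :
    low h 0 (-δ) = low h c δ ∧ low h c δ * (sl h 0 - sl h c) = 2 * δ := by
  have e : AA h (c + 1) = AA h 0 := by rw [AA, AA, if_neg (by omega), if_neg (by omega)]
  have := (AA_end hD h (i := 0) (Or.inl rfl)).2.2
  rw [show D - 1 = c by omega] at this
  rw [low_nonneg h c h0, low_nonpos h 0 (by linarith), e]
  refine ⟨by ring, ?_⟩
  have : AA h 0 * (sl h 0 - sl h c) = 1 := by linarith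
  rw [mul_assoc, this]; ring

namespace Sp
/-- Normalised height. -/
def bb (s : Sp D) : ℝ := (s.t - low s.h s.c s.δ) / (up s.h s.c s.δ - low s.h s.c s.δ)
theorem bb_mem (hD : 2 ≤ D) (s : Sp D) : 0 ≤ s.bb ∧ s.bb ≤ 1 := by
  have := s.low_lt_up hD
  have p : 0 < up s.h s.c s.δ - low s.h s.c s.δ := by linarith
  have := s.ok.lo; have := s.ok.hi
  exact ⟨div_nonneg (by linarith) p.le, by rw [bb, div_le_one p]; linarith⟩
theorem bb_zero (hD : 2 ≤ D) (s : Sp D) : s.bb = 0 ↔ s.t = low s.h s.c s.δ := by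
  have := s.low_lt_up hD
  have p : up s.h s.c s.δ - low s.h s.c s.δ ≠ 0 := by linarith
  rw [bb, div_eq_zero_iff]
  constructor
  · rintro (h | h)
    · linarith
    · exact absurd h p
  · intro h; left; linarith
theorem bb_one (hD : 2 ≤ D) (s : Sp D) : s.bb = 1 ↔ s.t = up s.h s.c s.δ := by
  have := s.low_lt_up hD
  have p : up s.h s.c s.δ - low s.h s.c s.δ ≠ 0 := by linarith
  rw [bb, div_eq_one_iff_eq p]
  constructor <;> intro h <;> linarith
theorem t_bb (hD : 2 ≤ D) (s : Sp D) :
    s.t = low s.h s.c s.δ + s.bb * (up s.h s.c s.δ - low s.h s.c s.δ) := by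
  have := s.low_lt_up hD
  have p : up s.h s.c s.δ - low s.h s.c s.δ ≠ 0 := by linarith
  rw [bb, div_mul_cancel₀ _ p]; ring

/-- The strip point has tube coordinate `u` in the tube `g`. -/
def Rel (g : Gam D) (u : ℝ) (s : Sp D) : Prop :=
  (s.δ ≤ 0 ∧ pv g s.c = s.h ∧ u = 2 * (s.c : ℕ) + s.bb) ∨
  (0 ≤ s.δ ∧ pv g (s.c + 1) = s.h ∧ u = 2 * (s.c : ℕ) + 2 - s.bb)

theorem Rel.low (hD : 2 ≤ D) {g : Gam D} {u : ℝ} {s : Sp D} (h : Rel g u s) (hl : s.t = low s.h s.c s.δ) :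
    ∃ k, k ≤ D ∧ pv g k = s.h ∧ u = 2 * (k : ℕ) := by
  rw [← s.bb_zero hD] at hl
  have := s.c.2
  rcases h with ⟨_, h1, h2⟩ | ⟨_, h1, h2⟩
  · exact ⟨_, by omega, h1, by rw [h2, hl]; ring⟩
  · exact ⟨_, by omega, h1, by rw [h2, hl]; push_cast; ring⟩

theorem Rel.inj (hD : 2 ≤ D) {g : Gam D} {u u' : ℝ} {s s' : Sp D} (r : Rel g u s) (r' : Rel g u' s')
    (e : s.q = s'.q) : u = u' := by
  obtain ⟨ht, hz, gl⟩ := collide hD s.ok s'.ok e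
  have low_case : s.t = Fat.low s.h s.c s.δ → s'.t = Fat.low s'.h s'.c s'.δ → s.h = s'.h → u = u' := by
    intro h1 h2 h3
    obtain ⟨k, hk, a1, a2⟩ := r.low hD h1
    obtain ⟨k', hk', b1, b2⟩ := r'.low hD h2
    rw [h3, ← b1] at a1
    rw [a2, b2, pv_inj hk hk' a1]
  have c1 := s.c.2
  have c2 := s'.c.2
  cases gl with
  | same e1 e2 e3 =>
    have e4 : s.bb = s'.bb := by simp only [bb]; rw [e1, e2, e3, ht]
    rcases r with ⟨d, a1, a2⟩ | ⟨d, a1, a2⟩ <;> rcases r' with ⟨d', b1, b2⟩ | ⟨d', b1, b2⟩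
    · rw [a2, b2, e4, e2]
    · rw [e1, ← b1] at a1
      have := pv_inj (by omega) (by omega) a1; omega
    · rw [e1, ← b1] at a1
      have := pv_inj (by omega) (by omega) a1; omega
    · rw [a2, b2, e4, e2]
  | bot1 e1 e2 e3 e4 e5 e6 => exact low_case e5 (by rw [← ht, ← e1]; exact e6) e1
  | bot2 e1 e2 e3 e4 e5 e6 => exact low_case e5 (by rw [← ht, ← e1]; exact e6) e1
  | wrap1 e1 e2 e3 e4 e5 e6 e7 => exact low_case e6 (by rw [← ht, ← e1]; exact e7) e1
  | wrap2 e1 e2 e3 e4 e5 e6 e7 => exact low_case e6 (by rw [← ht, ← e1]; exact e7) e1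
  | vert e1 e2 e3 e4 =>
    exact low_case (by rw [e3, low_zero, e2]) (by rw [e4, low_zero, ← ht, e2]) e1
  | top e1 e2 e3 e4 e5 =>
    have b1 : s.bb = 1 := (s.bb_one hD).2 e4
    have b2 : s'.bb = 1 := (s'.bb_one hD).2 (by rw [← ht]; exact e5)
    rcases r with ⟨_, _, a2⟩ | ⟨_, _, a2⟩ <;> rcases r' with ⟨_, _, b3⟩ | ⟨_, _, b3⟩ <;>
      rw [a2, b3, b1, b2, e2] <;> ring

theorem ext_q {s s' : Sp D} (h1 : s.h = s'.h) (h2 : (s.c : ℕ) = s'.c) (h3 : s.δ = s'.δ) (h4 : s.t = s'.t)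
    (h5 : s.z = s'.z) : s.q = s'.q := by
  rw [q, q, h1, h2, h3, h4, h5]

theorem Rel.wd (hD : 2 ≤ D) {g : Gam D} {u : ℝ} {s s' : Sp D} (r : Rel g u s) (r' : Rel g u s')
    (hδ : |s.δ| = |s'.δ|) (hz : s.z = s'.z) : s.q = s'.q := by
  have B := s.bb_mem hD
  have B' := s'.bb_mem hD
  have T := s.t_bb hD
  have T' := s'.t_bb hD
  have mixed : ∀ {s s' : Sp D}, (s.δ ≤ 0 ∧ pv g s.c = s.h ∧ u = 2 * (s.c : ℕ) + s.bb) →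
      (0 ≤ s'.δ ∧ pv g (s'.c + 1) = s'.h ∧ u = 2 * (s'.c : ℕ) + 2 - s'.bb) → |s.δ| = |s'.δ| →
      s.z = s'.z → s.q = s'.q := by
    rintro s s' ⟨d, a1, a2⟩ ⟨d', b1, b2⟩ hδ hz
    have B := s.bb_mem hD
    have B' := s'.bb_mem hD
    rw [abs_of_nonpos d, abs_of_nonneg d'] at hδ
    have hcc : (s.c : ℕ) = s'.c ∨ (s.c : ℕ) = s'.c + 1 := by
      have i1 : (s.c : ℝ) < s'.c + 2 := by linarith
      have i2 : (s'.c : ℝ) < s.c + 1 := by linarith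
      have i1 : (s.c : ℕ) < s'.c + 2 := by exact_mod_cast i1
      have i2 : (s'.c : ℕ) < s.c + 1 := by exact_mod_cast i2
      omega
    rcases hcc with hcc | hcc
    · have hr : (s.c : ℝ) = s'.c := by exact_mod_cast hcc
      have t1 := (s.bb_one hD).1 (by linarith)
      have t2 := (s'.bb_one hD).1 (by linarith)
      have hh : s'.h = nb s.h s.c := by rw [← b1, pv_succ, ← a1, hcc]
      have := pt_top s.h s.c.2 s.δ s.z
      rw [q, q, ← hz, hh, ← hcc, t1, this, t2, hh, ← hcc, ← hδ, up_nb s.h s.c.2]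
    · have hr : (s.c : ℝ) = s'.c + 1 := by exact_mod_cast hcc
      have t1 := (s.bb_zero hD).1 (by linarith)
      have t2 := (s'.bb_zero hD).1 (by linarith)
      have hh : s'.h = s.h := by rw [← b1, ← a1, hcc]
      have l := low_bot s'.h (c := s'.c) (by have := s.c.2; omega) d'
      have := pt_low_eq hD s'.h s'.c.2 s'.ok.hδ s'.z l.1 l.2
      rw [q, q, t1, t2, this, hz, hh, hcc, ← hδ, neg_neg]
  rcases r with ⟨d, a1, a2⟩ | ⟨d, a1, a2⟩ <;> rcases r' with ⟨d', b1, b2⟩ | ⟨d', b1, b2⟩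
  · have hcc : (s.c : ℕ) = s'.c := by
      have i1 : (s.c : ℝ) < s'.c + 1 := by linarith
      have i2 : (s'.c : ℝ) < s.c + 1 := by linarith
      have i1 : (s.c : ℕ) < s'.c + 1 := by exact_mod_cast i1
      have i2 : (s'.c : ℕ) < s.c + 1 := by exact_mod_cast i2
      omega
    rw [abs_of_nonpos d, abs_of_nonpos d'] at hδ
    have hd : s.δ = s'.δ := by linarith
    have hr : (s.c : ℝ) = s'.c := by exact_mod_cast hcc
    have hb : s.bb = s'.bb := by linarith
    have hh : s.h = s'.h := by rw [← a1, ← b1, hcc]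
    exact ext_q hh hcc hd (by rw [T, T', hb, hh, hd, hcc]) hz
  · exact mixed ⟨d, a1, a2⟩ ⟨d', b1, b2⟩ hδ hz
  · exact (mixed ⟨d', b1, b2⟩ ⟨d, a1, a2⟩ hδ.symm hz.symm).symm
  · have hcc : (s.c : ℕ) = s'.c := by
      have i1 : (s.c : ℝ) < s'.c + 1 := by linarith
      have i2 : (s'.c : ℝ) < s.c + 1 := by linarith
      have i1 : (s.c : ℕ) < s'.c + 1 := by exact_mod_cast i1
      have i2 : (s'.c : ℕ) < s.c + 1 := by exact_mod_cast i2
      omega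
    rw [abs_of_nonneg d, abs_of_nonneg d'] at hδ
    have hr : (s.c : ℝ) = s'.c := by exact_mod_cast hcc
    have hb : s.bb = s'.bb := by linarith
    have hh : s.h = s'.h := by rw [← a1, ← b1, hcc]
    exact ext_q hh hcc hδ (by rw [T, T', hb, hh, hδ, hcc]) hz
end Sp
end Fat
end

noncomputable section
set_option linter.unusedSectionVars false
open Classical

namespace Fat
variable {D : ℕ}
namespace Sp

theorem Rel.off (hD : 2 ≤ D) {g : Gam D} {u : ℝ} {s : Sp D} (r : Rel g u s) (hδ : s.δ ≠ 0) :
    (u = 0 → s.a = Bc.R g) ∧ (u = 2 * D → s.a = Bc.R (pv g D)) ∧ (0 < u → u < 2 * D → s.a = Bc.G g) := by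
  have B := s.bb_mem hD
  have c1 : (s.c : ℕ) + 1 ≤ D := s.c.2
  have c1r : (s.c : ℝ) + 1 ≤ D := by exact_mod_cast c1
  have c0r : (0 : ℝ) ≤ s.c := by positivity
  rcases r with ⟨d, a1, a2⟩ | ⟨d, a1, a2⟩
  · have d' : s.δ < 0 := lt_of_le_of_ne d hδ
    have hg : st s.h s.c = g := (pv_eq_iff.1 a1).symm
    rw [a_neg d']
    refine ⟨fun hu => ?_, fun hu => ?_, fun h1 h2 => ?_⟩
    · have hc : (s.c : ℝ) = 0 := by linarith
      have hc : (s.c : ℕ) = 0 := by exact_mod_cast hc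
      rw [if_pos ⟨hc, (s.bb_zero hD).1 (by linarith)⟩, ← a1, hc, pv_zero]
    · exfalso; linarith
    · rw [if_neg, hg]
      rintro ⟨hc, ht⟩
      rw [(s.bb_zero hD).2 ht, hc] at a2
      norm_num at a2; linarith
  · have d' : 0 < s.δ := lt_of_le_of_ne d hδ.symm
    have hg : st s.h (s.c + 1) = g := (pv_eq_iff.1 a1).symm
    rw [a_pos d']
    refine ⟨fun hu => ?_, fun hu => ?_, fun h1 h2 => ?_⟩
    · exfalso; linarith
    · have hc : (s.c : ℝ) + 1 = D := by linarith
      have hc : (s.c : ℕ) + 1 = D := by exact_mod_cast hc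
      rw [if_pos ⟨hc, (s.bb_zero hD).1 (by linarith)⟩, ← a1, congrArg (pv g) hc]
    · rw [if_neg, hg]
      rintro ⟨hc, ht⟩
      have hcr : (s.c : ℝ) + 1 = D := by exact_mod_cast hc
      rw [(s.bb_zero hD).2 ht] at a2
      linarith

theorem Rel.on (hD : 2 ≤ D) {g : Gam D} {u : ℝ} {s : Sp D} (r : Rel g u s) (hδ : s.δ = 0) :
    (∀ k : ℕ, u = 2 * k → s.a = Bc.V (pv g k)) ∧
    (∀ c : Fin D, 2 * (c : ℕ) < u → u < 2 * (c : ℕ) + 2 → s.a = Bc.E (ed (pv g c) c)) := by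
  have B := s.bb_mem hD
  have tz : s.bb = 0 ↔ s.t = 0 := by rw [s.bb_zero hD, hδ, low_zero]
  rw [a_zero hδ]
  rcases r with ⟨-, a1, a2⟩ | ⟨-, a1, a2⟩
  · constructor
    · intro k hk
      have hc : (s.c : ℕ) = k := by
        have i1 : (s.c : ℝ) < k + 1 := by linarith
        have i2 : (k : ℝ) < s.c + 1 := by linarith
        have i1 : (s.c : ℕ) < k + 1 := by exact_mod_cast i1
        have i2 : k < (s.c : ℕ) + 1 := by exact_mod_cast i2
        omega
      rw [if_pos (tz.1 (by rw [hk, hc] at a2; linarith)), ← a1, hc]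
    · intro c h1 h2
      have hc : (s.c : ℕ) = c := by
        have i1 : (s.c : ℝ) < c + 1 := by linarith
        have i2 : (c : ℝ) < s.c + 1 := by linarith
        have i1 : (s.c : ℕ) < c + 1 := by exact_mod_cast i1
        have i2 : (c : ℕ) < (s.c : ℕ) + 1 := by exact_mod_cast i2
        omega
      have hc' : s.c = c := Fin.ext hc
      subst hc'
      rw [if_neg (fun h => by rw [tz.2 h] at a2; linarith), a1]
  · constructor
    · intro k hk
      have hc : (s.c : ℕ) + 1 = k := by
        have i1 : (s.c : ℝ) < k := by linarith
        have i2 : (k : ℝ) < s.c + 2 := by linarith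
        have i1 : (s.c : ℕ) < k := by exact_mod_cast i1
        have i2 : k < (s.c : ℕ) + 2 := by exact_mod_cast i2
        omega
      rw [if_pos (tz.1 (by rw [hk, ← hc] at a2; push_cast at a2; linarith)), ← a1, hc]
    · intro c h1 h2
      have hc : (s.c : ℕ) = c := by
        have i1 : (s.c : ℝ) < c + 1 := by linarith
        have i2 : (c : ℝ) < s.c + 1 := by linarith
        have i1 : (s.c : ℕ) < c + 1 := by exact_mod_cast i1
        have i2 : (c : ℕ) < (s.c : ℕ) + 1 := by exact_mod_cast i2
        omega
      have hc' : s.c = c := Fin.ext hc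
      subst hc'
      rw [if_neg (fun h => by rw [tz.2 h] at a2; linarith), ← a1, pv_succ, ed_nb]

theorem rel_V (s : Sp D) (hδ : s.δ = 0) (ht : s.t = 0) {g : Gam D} {i : ℕ} (hi : i ≤ D)
    (hg : pv g i = s.h) : ∃ s' : Sp D, s'.q = s.q ∧ Rel g (2 * i) s' := by
  have mk : ∀ c : Fin D, Ok s.h c 0 0 s.z := fun c =>
    ⟨c.2, by norm_num, by rw [low_zero], by linarith [up_ge s.h c.2 (δ := 0) (by norm_num)], s.ok.hz⟩
  have hq : ∀ c : Fin D, (⟨s.h, c, 0, 0, s.z, mk c⟩ : Sp D).q = s.q := by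
    intro c; simp [q, pt, hδ, ht]
  have hb : ∀ c : Fin D, (⟨s.h, c, 0, 0, s.z, mk c⟩ : Sp D).bb = 0 := by
    intro c; simp [bb, low_zero]
  by_cases h0 : i < D
  · exact ⟨_, hq ⟨i, h0⟩, Or.inl ⟨le_rfl, hg, by rw [hb]; simp⟩⟩
  · have h1 := s.c.2
    refine ⟨_, hq ⟨i - 1, by omega⟩, Or.inr ⟨le_rfl, ?_, ?_⟩⟩
    · simp only; rw [Nat.sub_add_cancel (by omega)]; exact hg
    · rw [hb]
      have : ((i - 1 : ℕ) : ℝ) = i - 1 := by rw [Nat.cast_sub (by omega)]; simp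
      simp only [this]; ring

theorem rel_E (hD : 2 ≤ D) (s : Sp D) (hδ : s.δ = 0) {g : Gam D}
    (hg : pv g s.c = s.h ∨ pv g s.c = nb s.h s.c) :
    ∃ u : ℝ, 2 * (s.c : ℕ) ≤ u ∧ u ≤ 2 * (s.c : ℕ) + 2 ∧ Rel g u s := by
  have B := s.bb_mem hD
  rcases hg with h | h
  · exact ⟨_, by linarith, by linarith, Or.inl ⟨hδ.le, h, rfl⟩⟩
  · exact ⟨2 * (s.c : ℕ) + 2 - s.bb, by linarith, by linarith, Or.inr ⟨hδ.ge, by rw [pv_succ, h, nb_nb], rfl⟩⟩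

theorem rel_R (hD : 2 ≤ D) (s : Sp D) {k : Gam D} (ha : s.a = Bc.R k) :
    (∃ s' : Sp D, s'.q = s.q ∧ Rel k 0 s') ∧
    ∀ g, pv g D = k → ∃ s' : Sp D, s'.q = s.q ∧ Rel g (2 * D) s' := by
  have hδ : s.δ ≠ 0 := by rw [← a_off, ha]; trivial
  rcases lt_or_gt_of_ne hδ with d | d
  · rw [a_neg d] at ha
    split_ifs at ha with hh
    obtain ⟨hc, ht⟩ := hh
    obtain rfl : s.h = k := by simpa using ha
    constructor
    · exact ⟨s, rfl, Or.inl ⟨d.le, by rw [hc, pv_zero], by rw [(s.bb_zero hD).2 ht, hc]; simp⟩⟩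
    · intro g hg
      have hd : -(-s.δ) = s.δ := neg_neg _
      have ab : |-s.δ| ≤ 1 / 4 := by rw [abs_neg]; exact s.ok.hδ
      obtain ⟨l1, l2⟩ := low_wrap hD s.h (δ := - s.δ) (by linarith) (c := D - 1) (by omega)
      have hp := pt_low_eq hD s.h (c := D - 1) (c' := 0) (by omega) ab s.z l1 l2
      have ok : Ok s.h (D - 1) (-s.δ) (low s.h (D - 1) (-s.δ)) s.z :=
        ⟨by omega, ab, le_rfl, by
          have := (abs_le.1 (low_abs hD s.h (show D - 1 < D by omega) ab)).2
          have := up_ge s.h (show D - 1 < D by omega) ab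
          linarith, s.ok.hz⟩
      refine ⟨⟨s.h, ⟨D - 1, by omega⟩, -s.δ, low s.h (D - 1) (-s.δ), s.z, ok⟩, ?_, Or.inr ⟨by simp only; linarith, ?_, ?_⟩⟩
      · simp only [q]; rw [hp, hd, ht, hc]
      · simp only; rw [← hg]; exact congrArg (pv g) (by omega)
      · rw [(bb_zero hD _).2 rfl]
        have : ((D - 1 : ℕ) : ℝ) = D - 1 := by rw [Nat.cast_sub (by omega)]; simp
        simp only [this]; ring
  · rw [a_pos d] at ha
    split_ifs at ha with hh
    obtain ⟨hc, ht⟩ := hh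
    obtain rfl : s.h = k := by simpa using ha
    constructor
    · have ab : |-s.δ| ≤ 1 / 4 := by rw [abs_neg]; exact s.ok.hδ
      obtain ⟨l1, l2⟩ := low_wrap hD s.h (δ := s.δ) (by linarith) hc
      have hp := pt_low_eq hD s.h (c := s.c) (c' := 0) s.c.2 s.ok.hδ s.z l1 l2
      have ok : Ok s.h 0 (-s.δ) (low s.h 0 (-s.δ)) s.z :=
        ⟨by omega, ab, le_rfl, by
          have := (abs_le.1 (low_abs hD s.h (show 0 < D by omega) ab)).2
          have := up_ge s.h (show 0 < D by omega) ab
          linarith, s.ok.hz⟩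
      refine ⟨⟨s.h, ⟨0, by omega⟩, -s.δ, low s.h 0 (-s.δ), s.z, ok⟩, ?_, Or.inl ⟨by simp only; linarith, ?_, ?_⟩⟩
      · simp only [q]; rw [← hp, ← ht]
      · simp only; rw [pv_zero]
      · rw [(bb_zero hD _).2 rfl]; simp
    · intro g hg
      refine ⟨s, rfl, Or.inr ⟨d.le, ?_, ?_⟩⟩
      · rw [← hg]; exact congrArg (pv g) hc
      · rw [(s.bb_zero hD).2 ht]
        have hcr : (s.c : ℝ) + 1 = D := by exact_mod_cast hc
        rw [← hcr]; ring
end Sp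

namespace Bc
/-- The tube used to parametrize a base cell. -/
def gg : Bc D → Gam D
  | G g => g
  | R h => h
  | E e => st e.1.1 e.1.2
  | V h => h
/-- Lower end of the parameter interval. -/
def lo : Bc D → ℝ
  | G _ => 0
  | R _ => 0
  | E e => 2 * (e.1.2 : ℕ)
  | V _ => 0
/-- Upper end of the parameter interval. -/
def hi : Bc D → ℝ
  | G _ => 2 * D
  | R _ => 0
  | E e => 2 * (e.1.2 : ℕ) + 2
  | V _ => 0
/-- Open parameter interval (a point for rank zero). -/
def io : Bc D → Set ℝ
  | G _ => Set.Ioo 0 (2 * D)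
  | R _ => {0}
  | E e => Set.Ioo (2 * (e.1.2 : ℕ)) (2 * (e.1.2 : ℕ) + 2)
  | V _ => {0}

theorem lohi (b : Bc D) : 0 ≤ b.lo ∧ b.hi ≤ 2 * D := by
  cases b with
  | G g => simp [lo, hi]
  | R g => simp [lo, hi]
  | V g => simp [lo, hi]
  | E e =>
    have : (e.1.2 : ℕ) + 1 ≤ D := e.1.2.2
    have : ((e.1.2 : ℕ) : ℝ) + 1 ≤ D := by exact_mod_cast this
    simp only [lo, hi]
    constructor
    · positivity
    · linarith

theorem rel_le (hD : 2 ≤ D) (b : Bc D) {u : ℝ} {s : Sp D} (r : Sp.Rel b.gg u s) (h1 : b.lo ≤ u) (h2 : u ≤ b.hi)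
    (ho : b.off ∨ s.δ = 0) : le s.a b := by
  cases b with
  | G g =>
    simp only [gg, lo, hi] at r h1 h2
    by_cases hδ : s.δ = 0
    · obtain ⟨f1, f2⟩ := r.on hD hδ
      by_cases hk : ∃ k : ℕ, u = 2 * k
      · obtain ⟨k, rfl⟩ := hk
        rw [f1 k rfl]
        have : (k : ℝ) ≤ D := by linarith
        exact V_pv (by exact_mod_cast this)
      · push Not at hk
        set c := ⌊u / 2⌋₊ with hc
        have e1 : (c : ℝ) ≤ u / 2 := Nat.floor_le (by linarith)
        have e2 : u / 2 < c + 1 := Nat.lt_floor_add_one _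
        have n1 := hk c
        have n2 := hk D
        have l1 : 2 * (c : ℝ) < u := lt_of_le_of_ne (by linarith) (fun h => n1 h.symm)
        have l2 : u < 2 * D := lt_of_le_of_ne h2 n2
        have l3 : (c : ℝ) < D := by linarith
        have l4 : c < D := by exact_mod_cast l3
        rw [f2 ⟨c, l4⟩ l1 (by simp only; linarith), E_G]
        exact ⟨_, rfl⟩
    · obtain ⟨f1, f2, f3⟩ := r.off hD hδ
      rcases h1.lt_or_eq with h | h
      · rcases h2.lt_or_eq with h' | h'
        · rw [f3 h h']; exact le_refl _
        · rw [f2 h', R_G]; simp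
      · rw [f1 h.symm, R_G]; simp
  | R h =>
    simp only [gg, lo, hi] at r h1 h2
    have hu : u = 0 := le_antisymm h2 h1
    by_cases hδ : s.δ = 0
    · rw [(r.on hD hδ).1 0 (by simp [hu]), pv_zero]; simp [le]
    · rw [(r.off hD hδ).1 hu]; simp [le]
  | E e =>
    simp only [gg, lo, hi] at r h1 h2
    have hδ : s.δ = 0 := by simpa [off] using ho
    obtain ⟨f1, f2⟩ := r.on hD hδ
    rcases h1.lt_or_eq with h | h
    · rcases h2.lt_or_eq with h' | h'
      · rw [f2 _ h h', pv_st, ed_self]; exact le_refl _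
      · rw [f1 (e.1.2 + 1) (by rw [h']; push_cast; ring), pv_succ, pv_st]; simp [le]
    · rw [f1 e.1.2 h.symm, pv_st]; simp [le]
  | V h =>
    simp only [gg, lo, hi] at r h1 h2
    have hδ : s.δ = 0 := by simpa [off] using ho
    have hu : u = 0 := le_antisymm h2 h1
    rw [(r.on hD hδ).1 0 (by simp [hu]), pv_zero]; simp [le]

theorem rel_io (hD : 2 ≤ D) (b : Bc D) {u : ℝ} {s : Sp D} (r : Sp.Rel b.gg u s) (h : u ∈ b.io)
    (ho : b.off ↔ s.δ ≠ 0) : s.a = b := by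
  cases b with
  | G g => exact (r.off hD (ho.1 trivial)).2.2 h.1 h.2
  | R g => exact (r.off hD (ho.1 trivial)).1 h
  | E e =>
    have hδ : s.δ = 0 := by simpa [off] using ho
    have := (r.on hD hδ).2 e.1.2 h.1 h.2
    rwa [gg, pv_st, ed_self] at this
  | V g =>
    have hδ : s.δ = 0 := by simpa [off] using ho
    have h0 : u = 0 := h
    have := (r.on hD hδ).1 0 (by simp [h0])
    rwa [gg, pv_zero] at this

theorem io_sub (b : Bc D) {u : ℝ} (h : u ∈ b.io) : b.lo ≤ u ∧ u ≤ b.hi := by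
  cases b <;> simp only [io, Set.mem_Ioo, Set.mem_singleton_iff] at h <;> simp only [lo, hi]
  · exact ⟨h.1.le, h.2.le⟩
  · simp [h]
  · exact ⟨h.1.le, h.2.le⟩
  · simp [h]

theorem rel_ex (hD : 2 ≤ D) {b : Bc D} {s : Sp D} (h : le s.a b) :
    ∃ u s', b.lo ≤ u ∧ u ≤ b.hi ∧ s'.q = s.q ∧ Sp.Rel b.gg u s' := by
  rcases hy : s.a with g | k | e | k
  · -- tube interior
    have hδ : s.δ ≠ 0 := by rw [← Sp.a_off, hy]; trivial
    rw [hy] at h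
    obtain rfl : b = G g := by
      cases b <;> simp [le] at h
      rw [h]
    have B := s.bb_mem hD
    have c1 : (s.c : ℕ) + 1 ≤ D := s.c.2
    have c1r : (s.c : ℝ) + 1 ≤ D := by exact_mod_cast c1
    have c0r : (0 : ℝ) ≤ s.c := by positivity
    simp only [lo, hi, gg]
    rcases lt_or_gt_of_ne hδ with d | d
    · rw [Sp.a_neg d] at hy
      split_ifs at hy with hh
      obtain rfl : st s.h s.c = g := by simpa using hy
      exact ⟨_, s, by linarith, by linarith, rfl, Or.inl ⟨d.le, pv_st _ _, rfl⟩⟩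
    · rw [Sp.a_pos d] at hy
      split_ifs at hy with hh
      obtain rfl : st s.h (s.c + 1) = g := by simpa using hy
      exact ⟨2 * (s.c : ℕ) + 2 - s.bb, s, by linarith, by linarith, rfl, Or.inr ⟨d.le, pv_st _ _, rfl⟩⟩
  · obtain ⟨⟨s0, q0, r0⟩, r1⟩ := s.rel_R hD hy
    rw [hy] at h
    cases b with
    | G g =>
      rcases R_G.1 h with rfl | rfl
      · exact ⟨0, s0, by simp [lo], by simp [hi], q0, r0⟩
      · obtain ⟨s1, q1, r1⟩ := r1 g rfl
        exact ⟨2 * D, s1, by simp [lo], by simp [hi], q1, r1⟩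
    | R k' =>
      obtain rfl : k = k' := by simpa [le] using h
      exact ⟨0, s0, by simp [lo], by simp [hi], q0, r0⟩
    | E e => simp [le] at h
    | V k' => simp [le] at h
  · have hδ : s.δ = 0 := by
      by_contra hne; rw [← ne_eq, ← Sp.a_off, hy] at hne; exact hne
    rw [hy] at h
    rw [Sp.a_zero hδ] at hy
    split_ifs at hy
    obtain rfl : ed s.h s.c = e := by simpa using hy
    obtain ⟨a1, a2⟩ := ed_ends s.h s.c
    have c1 : (s.c : ℕ) + 1 ≤ D := s.c.2
    have c1r : (s.c : ℝ) + 1 ≤ D := by exact_mod_cast c1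
    have c0r : (0 : ℝ) ≤ s.c := by positivity
    cases b with
    | G g =>
      obtain ⟨c', hc'⟩ := E_G.1 h
      obtain ⟨rfl, h2⟩ := ed_eq hc'
      obtain ⟨u, u1, u2, r⟩ := s.rel_E hD hδ h2
      exact ⟨u, s, by simp only [lo]; linarith, by simp only [hi]; linarith, rfl, r⟩
    | R k' => simp [le] at h
    | V k' => simp [le] at h
    | E e' =>
      obtain rfl : ed s.h s.c = e' := by simpa [le] using h
      have : pv (E (ed s.h s.c)).gg s.c = s.h ∨ pv (E (ed s.h s.c)).gg s.c = nb s.h s.c := by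
        simp only [gg, a1, pv_st]; exact a2
      obtain ⟨u, u1, u2, r⟩ := s.rel_E hD hδ this
      exact ⟨u, s, by simp only [lo, a1]; exact u1, by simp only [hi, a1]; exact u2, rfl, r⟩
  · have hδ : s.δ = 0 := by
      by_contra hne; rw [← ne_eq, ← Sp.a_off, hy] at hne; exact hne
    rw [hy] at h
    rw [Sp.a_zero hδ] at hy
    split_ifs at hy with ht
    obtain rfl : s.h = k := by simpa using hy
    cases b with
    | G g =>
      obtain ⟨i, hi', hg⟩ := V_G.1 h
      obtain ⟨s', q', r'⟩ := s.rel_V hδ ht hi' hg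
      have : (i : ℝ) ≤ D := by exact_mod_cast hi'
      exact ⟨_, s', by simp [lo], by simp only [hi]; linarith, q', r'⟩
    | R k' =>
      obtain rfl : s.h = k' := by simpa [le] using h
      obtain ⟨s', q', r'⟩ := s.rel_V hδ ht (Nat.zero_le D) (pv_zero s.h)
      exact ⟨_, s', by simp [lo], by simp [hi], q', r'⟩
    | V k' =>
      obtain rfl : s.h = k' := by simpa [le] using h
      obtain ⟨s', q', r'⟩ := s.rel_V hδ ht (Nat.zero_le D) (pv_zero s.h)
      exact ⟨_, s', by simp [lo], by simp [hi], q', r'⟩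
    | E e =>
      have c2 := e.1.2.2
      have : s.h = e.1.1 ∨ s.h = nb e.1.1 e.1.2 := by simpa [le] using h
      rcases this with h1 | h1
      · obtain ⟨s', q', r'⟩ := s.rel_V hδ ht (g := st e.1.1 e.1.2) (i := e.1.2) (by omega) (by rw [pv_st, h1])
        exact ⟨_, s', by simp [lo], by simp [hi], q', r'⟩
      · obtain ⟨s', q', r'⟩ := s.rel_V hδ ht (g := st e.1.1 e.1.2) (i := e.1.2 + 1) (by omega)
          (by rw [pv_succ, pv_st, h1])
        exact ⟨_, s', by simp [lo], by simp only [hi]; push_cast; linarith, q', r'⟩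

theorem rel_ex_io (hD : 2 ≤ D) {b : Bc D} {s : Sp D} (h : s.a = b) :
    ∃ u s', u ∈ b.io ∧ s'.q = s.q ∧ Sp.Rel b.gg u s' := by
  obtain ⟨u, s', h1, h2, h3, r⟩ := rel_ex hD (show le s.a b by rw [h]; exact le_refl _)
  refine ⟨u, s', ?_, h3, r⟩
  have ha : s'.a = b := (Sp.q_inv hD h3).1.trans h
  have ho := s'.a_off
  rw [ha] at ho
  cases b with
  | G g =>
    obtain ⟨f1, f2, f3⟩ := r.off hD (ho.1 trivial)
    rw [ha] at f1 f2
    exact ⟨lt_of_le_of_ne h1 fun e => by simpa using f1 e.symm, lt_of_le_of_ne h2 fun e => by simpa using f2 e⟩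
  | R g => exact le_antisymm h2 h1
  | V g => exact le_antisymm h2 h1
  | E e =>
    have hδ : s'.δ = 0 := by simpa [off] using ho
    obtain ⟨f1, f2⟩ := r.on hD hδ
    rw [ha] at f1
    refine ⟨lt_of_le_of_ne h1 fun e' => by simpa using f1 _ e'.symm, lt_of_le_of_ne h2 fun e' => ?_⟩
    have := f1 (e.1.2 + 1) (by rw [e']; push_cast [hi]; ring)
    simp at this
end Bc
end Fat
end

noncomputable section
set_option linter.unusedSectionVars false
open Classical

namespace Fat
variable {D : ℕ}

/-- Tube parametrisation. -/
def beta (g : Gam D) (p : ℝ × ℝ × ℝ) : Q3 :=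
  if h : ∃ s : Sp D, Sp.Rel g p.1 s ∧ 4 * |s.δ| = p.2.1 ∧ s.z = p.2.2 then h.choose.q else 0

theorem beta_eq (hD : 2 ≤ D) {g : Gam D} {u : ℝ} {s : Sp D} (r : Sp.Rel g u s) :
    beta g (u, 4 * |s.δ|, s.z) = s.q := by
  have h : ∃ s' : Sp D, Sp.Rel g u s' ∧ 4 * |s'.δ| = 4 * |s.δ| ∧ s'.z = s.z := ⟨s, r, rfl, rfl⟩
  have hs := h.choose_spec
  have : beta g (u, 4 * |s.δ|, s.z) = h.choose.q := by
    unfold beta; exact dif_pos h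
  rw [this]
  exact Sp.Rel.wd hD hs.1 r (by linarith [hs.2.1]) hs.2.2

/-- Left half of a turn. -/
def segL (g : Gam D) (c : ℕ) (p : ℝ × ℝ × ℝ) : Q3 :=
  pt (pv g c) c (-(p.2.1 / 4)) (low (pv g c) c (-(p.2.1 / 4)) +
    (p.1 - 2 * c) * (up (pv g c) c (-(p.2.1 / 4)) - low (pv g c) c (-(p.2.1 / 4)))) p.2.2
/-- Right half of a turn. -/
def segR (g : Gam D) (c : ℕ) (p : ℝ × ℝ × ℝ) : Q3 :=
  pt (pv g (c + 1)) c (p.2.1 / 4) (low (pv g (c + 1)) c (p.2.1 / 4) +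
    (2 * c + 2 - p.1) * (up (pv g (c + 1)) c (p.2.1 / 4) - low (pv g (c + 1)) c (p.2.1 / 4))) p.2.2

theorem pt_cont (h : Gam D) (c : ℕ) : Continuous fun p : ℝ × ℝ × ℝ => pt h c p.1 p.2.1 p.2.2 := by
  unfold pt; fun_prop

theorem segL_cont (g : Gam D) (c : ℕ) : Continuous (segL g c) := by
  have := low_cont (pv g c) c
  have := up_cont (pv g c) c
  exact (pt_cont (pv g c) c).comp (f := fun p : ℝ × ℝ × ℝ => (-(p.2.1 / 4), low (pv g c) c (-(p.2.1 / 4)) +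
    (p.1 - 2 * c) * (up (pv g c) c (-(p.2.1 / 4)) - low (pv g c) c (-(p.2.1 / 4))), p.2.2)) (by fun_prop)
theorem segR_cont (g : Gam D) (c : ℕ) : Continuous (segR g c) := by
  have := low_cont (pv g (c + 1)) c
  have := up_cont (pv g (c + 1)) c
  exact (pt_cont (pv g (c + 1)) c).comp (f := fun p : ℝ × ℝ × ℝ => (p.2.1 / 4, low (pv g (c + 1)) c (p.2.1 / 4) +
    (2 * c + 2 - p.1) * (up (pv g (c + 1)) c (p.2.1 / 4) - low (pv g (c + 1)) c (p.2.1 / 4)), p.2.2)) (by fun_prop)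

theorem mid_ok (hD : 2 ≤ D) (h : Gam D) (c : Fin D) {δ b z : ℝ} (hδ : |δ| ≤ 1 / 4) (b0 : 0 ≤ b) (b1 : b ≤ 1)
    (hz : |z| ≤ 1) : ∃ s : Sp D, s.h = h ∧ s.c = c ∧ s.δ = δ ∧ s.z = z ∧ s.bb = b ∧
      s.q = pt h c δ (low h c δ + b * (up h c δ - low h c δ)) z := by
  have h1 := (abs_le.1 (low_abs hD h c.2 hδ)).2
  have h2 := up_ge h c.2 hδ
  have p : 0 < up h c δ - low h c δ := by linarith
  refine ⟨⟨h, c, δ, low h c δ + b * (up h c δ - low h c δ), z, c.2, hδ, ?_, ?_, hz⟩, rfl, rfl, rfl, rfl, ?_, rfl⟩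
  · nlinarith
  · nlinarith
  · simp only [Sp.bb]; field_simp; ring

theorem segL_rel (hD : 2 ≤ D) (g : Gam D) (c : Fin D) {p : ℝ × ℝ × ℝ} (h1 : 2 * (c : ℕ) ≤ p.1)
    (h2 : p.1 ≤ 2 * (c : ℕ) + 1) (r0 : 0 ≤ p.2.1) (r1 : p.2.1 ≤ 1) (hz : |p.2.2| ≤ 1) :
    ∃ s : Sp D, Sp.Rel g p.1 s ∧ 4 * |s.δ| = p.2.1 ∧ s.z = p.2.2 ∧ s.q = segL g c p := by
  obtain ⟨s, e1, e2, e3, e4, e5, e6⟩ := mid_ok hD (pv g c) c (δ := -(p.2.1 / 4)) (b := p.1 - 2 * (c : ℕ)) (z := p.2.2)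
    (by rw [abs_neg, abs_of_nonneg (by linarith)]; linarith) (by linarith) (by linarith) hz
  refine ⟨s, Or.inl ⟨by rw [e3]; linarith, by rw [e1, e2], by rw [e5, e2]; ring⟩, ?_, e4, e6⟩
  rw [e3, abs_neg, abs_of_nonneg (by linarith)]; ring
theorem segR_rel (hD : 2 ≤ D) (g : Gam D) (c : Fin D) {p : ℝ × ℝ × ℝ} (h1 : 2 * (c : ℕ) + 1 ≤ p.1)
    (h2 : p.1 ≤ 2 * (c : ℕ) + 2) (r0 : 0 ≤ p.2.1) (r1 : p.2.1 ≤ 1) (hz : |p.2.2| ≤ 1) :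
    ∃ s : Sp D, Sp.Rel g p.1 s ∧ 4 * |s.δ| = p.2.1 ∧ s.z = p.2.2 ∧ s.q = segR g c p := by
  obtain ⟨s, e1, e2, e3, e4, e5, e6⟩ := mid_ok hD (pv g (c + 1)) c (δ := p.2.1 / 4) (b := 2 * (c : ℕ) + 2 - p.1) (z := p.2.2)
    (by rw [abs_of_nonneg (by linarith)]; linarith) (by linarith) (by linarith) hz
  refine ⟨s, Or.inr ⟨by rw [e3]; linarith, by rw [e1, e2], by rw [e5, e2]; ring⟩, ?_, e4, e6⟩
  rw [e3, abs_of_nonneg (by linarith)]; ring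

/-- The fibre box. -/
def FB : Set (ℝ × ℝ) := {p | 0 ≤ p.1 ∧ p.1 ≤ 1 ∧ |p.2| ≤ 1}
/-- The parameter box. -/
def Box (D : ℕ) : Set (ℝ × ℝ × ℝ) := Set.Icc 0 (2 * (D : ℝ)) ×ˢ FB

theorem FB_closed : IsClosed FB :=
  (isClosed_le continuous_const continuous_fst).inter ((isClosed_le continuous_fst continuous_const).inter
    (isClosed_le (show Continuous fun p : ℝ × ℝ => |p.2| by fun_prop) continuous_const))

theorem floorc (hD : 2 ≤ D) {u : ℝ} (h0 : 0 ≤ u) (h1 : u ≤ 2 * D) :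
    ∃ c : Fin D, (2 * (c : ℕ) ≤ u ∧ u ≤ 2 * (c : ℕ) + 1) ∨ (2 * (c : ℕ) + 1 ≤ u ∧ u ≤ 2 * (c : ℕ) + 2) := by
  suffices ∃ c : Fin D, 2 * (c : ℕ) ≤ u ∧ u ≤ 2 * (c : ℕ) + 2 by
    obtain ⟨c, a, b⟩ := this
    refine ⟨c, ?_⟩
    rcases le_total u (2 * (c : ℕ) + 1) with h | h
    · exact Or.inl ⟨a, h⟩
    · exact Or.inr ⟨h, b⟩
  by_cases hu : ⌊u / 2⌋₊ < D
  · refine ⟨⟨_, hu⟩, ?_, ?_⟩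
    · have := Nat.floor_le (show 0 ≤ u / 2 by linarith); simp only; linarith
    · have := Nat.lt_floor_add_one (u / 2); simp only; linarith
  · have : (D : ℝ) ≤ u / 2 := by
      refine le_trans ?_ (Nat.floor_le (show 0 ≤ u / 2 by linarith))
      exact_mod_cast not_lt.1 hu
    refine ⟨⟨D - 1, by omega⟩, ?_, ?_⟩ <;> simp only <;> rw [Nat.cast_sub (by omega)] <;> push_cast <;> linarith

theorem beta_ex (hD : 2 ≤ D) (g : Gam D) {p : ℝ × ℝ × ℝ} (hp : p ∈ Box D) :
    ∃ s : Sp D, Sp.Rel g p.1 s ∧ 4 * |s.δ| = p.2.1 ∧ s.z = p.2.2 ∧ s.q = beta g p := by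
  obtain ⟨⟨a, b⟩, r0, r1, hz⟩ := hp
  suffices ∃ s : Sp D, Sp.Rel g p.1 s ∧ 4 * |s.δ| = p.2.1 ∧ s.z = p.2.2 by
    obtain ⟨s, h1, h2, h3⟩ := this
    refine ⟨s, h1, h2, h3, ?_⟩
    rw [← beta_eq hD h1, h2, h3]
  obtain ⟨c, ⟨h1, h2⟩ | ⟨h1, h2⟩⟩ := floorc hD a b
  · obtain ⟨s, e⟩ := segL_rel hD g c h1 h2 r0 r1 hz; exact ⟨s, e.1, e.2.1, e.2.2.1⟩
  · obtain ⟨s, e⟩ := segR_rel hD g c h1 h2 r0 r1 hz; exact ⟨s, e.1, e.2.1, e.2.2.1⟩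

theorem beta_inj (hD : 2 ≤ D) (g : Gam D) : Set.InjOn (beta g) (Box D) := by
  intro p hp p' hp' e
  obtain ⟨s, r, d, z, q⟩ := beta_ex hD g hp
  obtain ⟨s', r', d', z', q'⟩ := beta_ex hD g hp'
  have hq : s.q = s'.q := by rw [q, q', e]
  obtain ⟨_, h2, h3⟩ := Sp.q_inv hD hq
  refine Prod.ext (r.inj hD r' hq) (Prod.ext ?_ ?_)
  · rw [← d, ← d', h2]
  · rw [← z, ← z', h3]

theorem beta_cont (hD : 2 ≤ D) (g : Gam D) : ContinuousOn (beta g) (Box D) := by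
  let f : Fin D × Bool → Set (ℝ × ℝ × ℝ) := fun i =>
    if i.2 then Set.Icc (2 * ((i.1 : ℕ) : ℝ)) (2 * (i.1 : ℕ) + 1) ×ˢ FB
    else Set.Icc (2 * ((i.1 : ℕ) : ℝ) + 1) (2 * (i.1 : ℕ) + 2) ×ˢ FB
  have hc : ContinuousOn (beta g) (⋃ i, f i) := by
    refine (locallyFinite_of_finite f).continuousOn_iUnion (fun i => ?_) (fun i => ?_)
    · simp only [f]; split_ifs <;> exact isClosed_Icc.prod FB_closed
    · obtain ⟨c, b⟩ := i
      cases b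
      · refine (segR_cont g c).continuousOn.congr ?_
        rintro p ⟨⟨a, b⟩, r0, r1, hz⟩
        obtain ⟨s, h1, h2, h3, h4⟩ := segR_rel hD g c a b r0 r1 hz
        rw [← h4, ← beta_eq hD h1, h2, h3]
      · refine (segL_cont g c).continuousOn.congr ?_
        rintro p ⟨⟨a, b⟩, r0, r1, hz⟩
        obtain ⟨s, h1, h2, h3, h4⟩ := segL_rel hD g c a b r0 r1 hz
        rw [← h4, ← beta_eq hD h1, h2, h3]
  refine hc.mono ?_
  rintro p ⟨⟨a, b⟩, hp⟩
  obtain ⟨c, h | h⟩ := floorc hD a b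
  · exact Set.mem_iUnion.2 ⟨(c, true), h, hp⟩
  · exact Set.mem_iUnion.2 ⟨(c, false), h, hp⟩

end Fat

theorem IsCell.mapOn {X Y : Type} [TopologicalSpace X] [TopologicalSpace Y] {n : ℕ} {A B : Set X}
    (h : IsCell n A B) {g : X → Y} (hg : ContinuousOn g A) (hi : Set.InjOn g A) :
    IsCell n (g '' A) (g '' B) := by
  obtain ⟨E, i1, i2, i3, K, φ, hn, hK, hKc, hKi, hφ, hinj, rfl, rfl⟩ := h
  refine ⟨E, i1, i2, i3, K, g ∘ φ, hn, hK, hKc, hKi, hg.comp hφ (Set.mapsTo_image _ _),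
    fun x hx y hy h => hinj hx hy (hi ⟨x, hx, rfl⟩ ⟨y, hy, rfl⟩ h), Set.image_comp _ _ _, Set.image_comp _ _ _⟩

theorem IsCell.prodIcc {X : Type} [TopologicalSpace X] {n : ℕ} {A B : Set X}
    (h : IsCell n A B) {a b : ℝ} (hab : a < b) :
    IsCell (n + 1) (Set.Icc a b ×ˢ A) (Set.Ioo a b ×ˢ B) := by
  obtain ⟨E, i1, i2, i3, K, φ, hn, hK, hKc, hKi, hφ, hinj, rfl, rfl⟩ := h
  refine ⟨ℝ × E, inferInstance, inferInstance, inferInstance, Set.Icc a b ×ˢ K, Prod.map id φ, ?_,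
    (convex_Icc a b).prod hK, isCompact_Icc.prod hKc, ?_, ?_, ?_, ?_, ?_⟩
  · rw [Module.finrank_prod, hn]; simp [add_comm]
  · rw [interior_prod_eq, interior_Icc]; exact (Set.nonempty_Ioo.2 hab).prod hKi
  · exact continuousOn_id.prodMap hφ
  · exact Set.injOn_id _ |>.prodMap hinj
  · rw [Set.prodMap_image_prod, Set.image_id]
  · rw [interior_prod_eq, interior_Icc, Set.prodMap_image_prod, Set.image_id]

theorem IsCell.prodPt {X : Type} [TopologicalSpace X] {n : ℕ} {A B : Set X}
    (h : IsCell n A B) (a : ℝ) : IsCell n (Set.Icc a a ×ˢ A) (({a} : Set ℝ) ×ˢ B) := by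
  have := h.map (g := fun x => (a, x)) (by fun_prop) (fun x y h => (Prod.mk.inj h).2)
  rw [Set.Icc_self, Set.singleton_prod, Set.singleton_prod]
  exact this

theorem IsCell.compact {X : Type} [TopologicalSpace X] {n : ℕ} {A B : Set X} (h : IsCell n A B) : IsCompact A := by
  obtain ⟨E, i1, i2, i3, K, φ, hn, hK, hKc, hKi, hφ, hinj, rfl, rfl⟩ := h
  exact hKc.image_of_continuousOn hφ

namespace Fat
variable {D : ℕ}

theorem Bc.cell (hD : 2 ≤ D) (b : Bc D) {n : ℕ} {A B : Set (ℝ × ℝ)} (h : IsCell n A B) :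
    IsCell (n + b.rk) (Set.Icc b.lo b.hi ×ˢ A) (b.io ×ˢ B) := by
  cases b with
  | G g => exact h.prodIcc (by have : (2 : ℝ) ≤ D := by exact_mod_cast hD
                               simp only [Bc.lo, Bc.hi]; linarith)
  | R g => exact h.prodPt _
  | E e => exact h.prodIcc (by simp only [Bc.lo, Bc.hi]; linarith)
  | V g => exact h.prodPt _

/-- Closed product cell. -/
def Cl (b : Bc D) (A : Set (ℝ × ℝ)) : Set Q3 := {x | ∃ s : Sp D, s.q = x ∧ Bc.le s.a b ∧ (4 * |s.δ|, s.z) ∈ A}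
/-- Open product cell. -/
def Op (b : Bc D) (B : Set (ℝ × ℝ)) : Set Q3 := {x | ∃ s : Sp D, s.q = x ∧ s.a = b ∧ (4 * |s.δ|, s.z) ∈ B}

theorem Cl_cell (hD : 2 ≤ D) (b : Bc D) {n : ℕ} {A B : Set (ℝ × ℝ)} (h : IsCell n A B) (hA : A ⊆ FB) (hBA : B ⊆ A)
    (h1 : ∀ p ∈ A, b.off ∨ p.1 = 0) (h2 : ∀ p ∈ B, b.off ↔ p.1 ≠ 0) :
    IsCell (n + b.rk) (Cl b A) (Op b B) := by
  have sub : Set.Icc b.lo b.hi ×ˢ A ⊆ Box D := by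
    rintro ⟨u, p⟩ ⟨⟨x, y⟩, hp⟩
    have := b.lohi
    exact ⟨⟨by linarith, by linarith⟩, hA hp⟩
  have key := (b.cell hD h).mapOn ((beta_cont hD b.gg).mono sub) ((beta_inj hD b.gg).mono sub)
  have e1 : beta b.gg '' (Set.Icc b.lo b.hi ×ˢ A) = Cl b A := by
    ext x; constructor
    · rintro ⟨p, hp, rfl⟩
      obtain ⟨s, r, d, z, q⟩ := beta_ex hD b.gg (sub hp)
      refine ⟨s, q, b.rel_le hD r hp.1.1 hp.1.2 ?_, ?_⟩
      · refine (h1 _ hp.2).imp id fun e => ?_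
        have : |s.δ| = 0 := by linarith
        exact abs_eq_zero.1 this
      · rw [d, z]; exact hp.2
    · rintro ⟨s, rfl, ha, hs⟩
      obtain ⟨u, s', l1, l2, e, r⟩ := Bc.rel_ex hD ha
      obtain ⟨_, f2, f3⟩ := Sp.q_inv hD e
      refine ⟨(u, 4 * |s'.δ|, s'.z), ⟨⟨l1, l2⟩, ?_⟩, ?_⟩
      · rw [f2, f3]; exact hs
      · rw [beta_eq hD r, e]
  have e2 : beta b.gg '' (b.io ×ˢ B) = Op b B := by
    ext x; constructor
    · rintro ⟨p, hp, rfl⟩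
      obtain ⟨s, r, d, z, q⟩ := beta_ex hD b.gg (sub ⟨b.io_sub hp.1, hBA hp.2⟩)
      refine ⟨s, q, b.rel_io hD r hp.1 ?_, ?_⟩
      · rw [h2 _ hp.2, ← d]; simp
      · rw [d, z]; exact hp.2
    · rintro ⟨s, rfl, ha, hs⟩
      obtain ⟨u, s', l1, e, r⟩ := Bc.rel_ex_io hD ha
      obtain ⟨_, f2, f3⟩ := Sp.q_inv hD e
      refine ⟨(u, 4 * |s'.δ|, s'.z), ⟨l1, ?_⟩, ?_⟩
      · rw [f2, f3]; exact hs
      · rw [beta_eq hD r, e]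
  rwa [e1, e2] at key

end Fat
end

noncomputable section
set_option linter.unusedSectionVars false
open Classical

namespace Fat
variable {n : ℕ}

/-- Height of a page before tapering. -/
def yy (n k : ℕ) : ℝ := -(1 / 2) + ((k : ℝ) - 1) / n
/-- Levels. -/
def Y (n k : ℕ) (r : ℝ) : ℝ := if k = 0 then -2 else if n + 2 ≤ k then 2 else yy n k * max 0 (1 - 2 * r)

theorem yy_lt (hn : 0 < n) {k l : ℕ} (h : k < l) : yy n k < yy n l := by
  have : (0 : ℝ) < n := by exact_mod_cast hn
  have h' : (k : ℝ) < l := by exact_mod_cast h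
  unfold yy
  gcongr
theorem yy_mem (hn : 0 < n) {k : ℕ} (h1 : 1 ≤ k) (h2 : k ≤ n + 1) : |yy n k| ≤ 1 / 2 := by
  have : (0 : ℝ) < n := by exact_mod_cast hn
  have h1' : (1 : ℝ) ≤ k := by exact_mod_cast h1
  have h2' : (k : ℝ) ≤ n + 1 := by exact_mod_cast h2
  have a : 0 ≤ ((k : ℝ) - 1) / n := div_nonneg (by linarith) this.le
  have b : ((k : ℝ) - 1) / n ≤ 1 := by rw [div_le_one this]; linarith
  rw [abs_le]; unfold yy; constructor <;> linarith
theorem yy_one : yy n 1 = -(1 / 2) := by simp [yy]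
theorem yy_last (hn : 0 < n) : yy n (n + 1) = 1 / 2 := by
  have : (n : ℝ) ≠ 0 := by positivity
  simp only [yy]; push_cast; field_simp; ring

theorem Y_zero (r : ℝ) : Y n 0 r = -2 := by simp [Y]
theorem Y_top (r : ℝ) : Y n (n + 2) r = 2 := by simp [Y]
theorem Y_mid {k : ℕ} (h1 : 1 ≤ k) (h2 : k ≤ n + 1) (r : ℝ) : Y n k r = yy n k * max 0 (1 - 2 * r) := by
  rw [Y, if_neg (by omega), if_neg (by omega)]
theorem Y_abs (hn : 0 < n) {k : ℕ} (h1 : 1 ≤ k) (h2 : k ≤ n + 1) {r : ℝ} (hr : 0 ≤ r) : |Y n k r| ≤ 1 / 2 := by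
  rw [Y_mid h1 h2, abs_mul]
  have := yy_mem hn h1 h2
  have h3 : |max 0 (1 - 2 * r)| ≤ 1 := by
    rw [abs_of_nonneg (le_max_left _ _)]; exact max_le (by norm_num) (by linarith)
  have := abs_nonneg (max 0 (1 - 2 * r))
  nlinarith [abs_nonneg (yy n k)]
theorem Y_half {k : ℕ} (h1 : 1 ≤ k) (h2 : k ≤ n + 1) {r : ℝ} (hr : 1 / 2 ≤ r) : Y n k r = 0 := by
  rw [Y_mid h1 h2, max_eq_left (by linarith), mul_zero]

theorem Y_lt (hn : 0 < n) {k l : ℕ} (hkl : k < l) (hl : l ≤ n + 2) {r : ℝ} (h0 : 0 ≤ r)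
    (hr : r < 1 / 2 ∨ k = 0 ∨ l = n + 2) : Y n k r < Y n l r := by
  by_cases k0 : k = 0
  · subst k0
    rw [Y_zero]
    by_cases l0 : l = n + 2
    · rw [l0, Y_top]; norm_num
    · have := (abs_le.1 (Y_abs hn (show 1 ≤ l by omega) (by omega) h0)).1; linarith
  by_cases l0 : l = n + 2
  · rw [l0, Y_top]
    have := (abs_le.1 (Y_abs hn (show 1 ≤ k by omega) (by omega) h0)).2; linarith
  have hr : r < 1 / 2 := by tauto
  rw [Y_mid (by omega) (by omega), Y_mid (by omega) (by omega), max_eq_right (by linarith)]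
  have := yy_lt hn hkl
  nlinarith
theorem Y_le (hn : 0 < n) {k l : ℕ} (hkl : k ≤ l) (hl : l ≤ n + 2) {r : ℝ} (h0 : 0 ≤ r) : Y n k r ≤ Y n l r := by
  rcases hkl.eq_or_lt with rfl | h
  · exact le_rfl
  by_cases hr : r < 1 / 2 ∨ k = 0 ∨ l = n + 2
  · exact (Y_lt hn h hl h0 hr).le
  · push Not at hr
    rw [Y_half (by omega) (by omega) hr.1, Y_half (by omega) (by omega) hr.1]

/-- Fibre cells. -/
inductive Fi (n : ℕ) : Type
  | face : Fin (n + 2) → Fi n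
  | page : Fin (n + 1) → Fi n
  | fin : Fi n
  | apex : Fi n
  | wint : Fin (n + 2) → Fi n
  | wpt : Fin (n + 1) → Fi n

namespace Fi
/-- Dimension. -/
def dim : Fi n → ℕ
  | face _ => 2
  | page _ => 1
  | fin => 1
  | apex => 0
  | wint _ => 1
  | wpt _ => 0
/-- Wall cells. -/
def wall : Fi n → Prop
  | face _ => False
  | page _ => False
  | fin => False
  | apex => False
  | wint _ => True
  | wpt _ => True
/-- Open cells. -/
def Fo (r z : ℝ) : Fi n → Prop
  | face k => 0 < r ∧ Y n k r < z ∧ z < Y n (k + 1) r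
  | page k => 0 < r ∧ r < 1 / 2 ∧ z = Y n (k + 1) r
  | fin => 1 / 2 < r ∧ z = 0
  | apex => r = 1 / 2 ∧ z = 0
  | wint k => r = 0 ∧ Y n k r < z ∧ z < Y n (k + 1) r
  | wpt k => r = 0 ∧ z = Y n (k + 1) r
/-- Closed cells. -/
def Fc (r z : ℝ) : Fi n → Prop
  | face k => Y n k r ≤ z ∧ z ≤ Y n (k + 1) r ∧ (0 < (k : ℕ) → (k : ℕ) < n + 1 → r ≤ 1 / 2)
  | page k => r ≤ 1 / 2 ∧ z = Y n (k + 1) r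
  | fin => 1 / 2 ≤ r ∧ z = 0
  | apex => r = 1 / 2 ∧ z = 0
  | wint k => r = 0 ∧ Y n k r ≤ z ∧ z ≤ Y n (k + 1) r
  | wpt k => r = 0 ∧ z = Y n (k + 1) r

theorem Fo_wall {P : Fi n} {r z : ℝ} (h : Fo r z P) (h0 : 0 ≤ r) : P.wall ↔ r = 0 := by
  cases P <;> simp only [Fo, wall] at * <;> constructor <;> intro h' <;> first | exact h'.elim | trivial | skip
  all_goals first | linarith [h.1] | exact h.1
theorem Fc_wall {P : Fi n} {r z : ℝ} (h : Fc r z P) (hw : P.wall) : r = 0 := by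
  cases P <;> simp only [Fc, wall] at *
  · exact h.1
  · exact h.1

theorem Fo_Fc (hn : 0 < n) {P : Fi n} {r z : ℝ} (h : Fo r z P) : Fc r z P := by
  cases P with
  | face k =>
    obtain ⟨h0, h1, h2⟩ := h
    refine ⟨h1.le, h2.le, fun a b => ?_⟩
    by_contra hr
    push Not at hr
    rw [Y_half (by omega) (by omega) hr.le] at h1 h2
    linarith
  | page k => exact ⟨h.2.1.le, h.2.2⟩
  | fin => exact ⟨h.1.le, h.2⟩
  | apex => exact h
  | wint k => exact ⟨h.1, h.2.1.le, h.2.2.le⟩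
  | wpt k => exact h

theorem lvl_between (hn : 0 < n) {k : Fin (n + 2)} {l : ℕ} (hl : l ≤ n + 2) {r z : ℝ} (h0 : 0 ≤ r)
    (h1 : Y n k r < z) (h2 : z < Y n (k + 1) r) : z ≠ Y n l r := by
  rintro rfl
  rcases Nat.lt_or_ge k l with h | h
  · have := Y_le hn (show (k : ℕ) + 1 ≤ l by omega) hl h0; linarith
  · have := Y_le hn h (by omega) h0; linarith
theorem int_uniq (hn : 0 < n) {k l : Fin (n + 2)} {r z : ℝ} (h0 : 0 ≤ r)
    (h1 : Y n k r < z) (h2 : z < Y n (k + 1) r) (h3 : Y n l r ≤ z) (h4 : z ≤ Y n (l + 1) r) : k = l := by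
  rcases lt_trichotomy k l with h | h | h
  · have := Y_le hn (show (k : ℕ) + 1 ≤ l from h) (by omega) h0; linarith
  · exact h
  · have := Y_le hn (show (l : ℕ) + 1 ≤ k from h) (by omega) h0; linarith
theorem lvl_uniq (hn : 0 < n) {k l : Fin (n + 1)} {r : ℝ} (h0 : 0 ≤ r) (hr : r < 1 / 2)
    (h : Y n (k + 1) r = Y n (l + 1) r) : k = l := by
  rcases lt_trichotomy k l with h' | h' | h'
  · have := Y_lt hn (show (k : ℕ) + 1 < l + 1 by simpa using h') (by omega) h0 (Or.inl hr); linarith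
  · exact h'
  · have := Y_lt hn (show (l : ℕ) + 1 < k + 1 by simpa using h') (by omega) h0 (Or.inl hr); linarith

theorem Fo_dim (hn : 0 < n) {Q P : Fi n} {r z : ℝ} (h0 : 0 ≤ r) (hQ : Fo r z Q) (hP : Fc r z P) :
    Q = P ∨ Q.dim < P.dim := by
  have Z : 1 / 2 ≤ r → Y n 1 r = 0 := fun h => Y_half le_rfl (by omega) h
  cases Q with
  | face k =>
    obtain ⟨q0, q1, q2⟩ := hQ
    have lv := fun l hl => lvl_between hn (l := l) hl h0 q1 q2
    cases P with
    | face l => left; rw [int_uniq hn h0 q1 q2 hP.1 hP.2.1]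
    | page l => exact absurd hP.2 (lv _ (by omega))
    | fin => exact absurd (hP.2.trans (Z hP.1).symm) (lv _ (by omega))
    | apex => exact absurd (hP.2.trans (Z hP.1.ge).symm) (lv _ (by omega))
    | wint l => linarith [hP.1]
    | wpt l => linarith [hP.1]
  | page k =>
    obtain ⟨q0, q1, q2⟩ := hQ
    cases P with
    | face l => right; simp [dim]
    | page l => left; rw [lvl_uniq hn h0 q1 (q2.symm.trans hP.2)]
    | fin => linarith [hP.1]
    | apex => linarith [hP.1]
    | wint l => linarith [hP.1]
    | wpt l => linarith [hP.1]
  | fin =>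
    obtain ⟨q0, q1⟩ := hQ
    cases P with
    | face l => right; simp [dim]
    | page l => linarith [hP.1]
    | fin => left; rfl
    | apex => linarith [hP.1]
    | wint l => linarith [hP.1]
    | wpt l => linarith [hP.1]
  | apex =>
    obtain ⟨q0, q1⟩ := hQ
    cases P with
    | face l => right; simp [dim]
    | page l => right; simp [dim]
    | fin => right; simp [dim]
    | apex => left; rfl
    | wint l => linarith [hP.1]
    | wpt l => linarith [hP.1]
  | wint k =>
    obtain ⟨q0, q1, q2⟩ := hQ
    have lv := fun l hl => lvl_between hn (l := l) hl h0 q1 q2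
    cases P with
    | face l => right; simp [dim]
    | page l => exact absurd hP.2 (lv _ (by omega))
    | fin => linarith [hP.1]
    | apex => linarith [hP.1]
    | wint l => left; rw [int_uniq hn h0 q1 q2 hP.2.1 hP.2.2]
    | wpt l => exact absurd hP.2 (lv _ (by omega))
  | wpt k =>
    obtain ⟨q0, q1⟩ := hQ
    cases P with
    | face l => right; simp [dim]
    | page l => right; simp [dim]
    | fin => linarith [hP.1]
    | apex => linarith [hP.1]
    | wint l => right; simp [dim]
    | wpt l => left; rw [lvl_uniq hn h0 (by linarith) (q1.symm.trans hP.2)]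

theorem Fo_uniq (hn : 0 < n) {Q P : Fi n} {r z : ℝ} (h0 : 0 ≤ r) (hQ : Fo r z Q) (hP : Fo r z P) : Q = P := by
  rcases Fo_dim hn h0 hQ (Fo_Fc hn hP) with h | h
  · exact h
  · rcases Fo_dim hn h0 hP (Fo_Fc hn hQ) with h' | h'
    · exact h'.symm
    · omega

theorem Fo_ex {r z : ℝ} (h0 : 0 ≤ r) (hz : |z| ≤ 1) : ∃ Q : Fi n, Fo r z Q := by
  rw [abs_le] at hz
  have ex : ∃ k, z < Y n k r := ⟨n + 2, by rw [Y_top]; linarith⟩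
  have sp := Nat.find_spec ex
  have mn := fun m => Nat.find_min ex (m := m)
  have le := Nat.find_min' ex (m := n + 2) (by rw [Y_top]; linarith)
  set K := Nat.find ex with hK
  have K0 : K ≠ 0 := by rintro h; rw [h, Y_zero] at sp; linarith
  obtain ⟨k, hk⟩ := Nat.exists_eq_succ_of_ne_zero K0
  rw [hk] at sp le
  have lo : Y n k r ≤ z := not_lt.1 (mn k (by omega))
  rcases lo.lt_or_eq with h | h
  · rcases h0.lt_or_eq with r0 | r0
    · exact ⟨face ⟨k, by omega⟩, r0, h, sp⟩
    · exact ⟨wint ⟨k, by omega⟩, r0.symm, h, sp⟩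
  · have k0 : k ≠ 0 := by rintro rfl; rw [Y_zero] at h; linarith
    obtain ⟨j, rfl⟩ := Nat.exists_eq_succ_of_ne_zero k0
    have hj : j < n + 1 := by omega
    rcases h0.lt_or_eq with r0 | r0
    · rcases lt_trichotomy r (1 / 2) with r1 | r1 | r1
      · exact ⟨page ⟨j, hj⟩, r0, r1, h.symm⟩
      · exact ⟨apex, r1, by rw [← h, Y_half (by omega) (by omega) r1.ge]⟩
      · exact ⟨fin, r1, by rw [← h, Y_half (by omega) (by omega) r1.le]⟩
    · exact ⟨wpt ⟨j, hj⟩, r0.symm, h.symm⟩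
end Fi
end Fat
end

noncomputable section
set_option linter.unusedSectionVars false
open Classical

namespace Fat
variable {n : ℕ}
namespace Fi

/-- The meet of two fibre cells away from the wall exists. -/
def Mt (P P' : Fi n) : Prop := ∃ P'' : Fi n, ¬ P''.wall ∧ ∀ r z : ℝ, 0 ≤ r → ((Fc r z P ∧ Fc r z P') ↔ Fc r z P'')

theorem Mt.symm {P P' : Fi n} (h : Mt P P') : Mt P' P := by
  obtain ⟨Q, h1, h2⟩ := h
  exact ⟨Q, h1, fun r z h0 => by rw [and_comm]; exact h2 r z h0⟩
theorem Mt.self {P : Fi n} (h : ¬ P.wall) : Mt P P := ⟨P, h, fun r z _ => by simp⟩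

theorem half_face (k : Fin (n + 2)) {r : ℝ} (hr : 1 / 2 ≤ r) : Y n k r ≤ 0 ∧ 0 ≤ Y n (k + 1) r := by
  constructor
  · by_cases h : (k : ℕ) = 0
    · rw [h, Y_zero]; norm_num
    · rw [Y_half (by omega) (by omega) hr]
  · by_cases h : (k : ℕ) = n + 1
    · rw [h, Y_top]; norm_num
    · rw [Y_half (by omega) (by omega) hr]

theorem apex_Fc {P : Fi n} (h : ¬ P.wall) {r z : ℝ} (ha : Fc r z (apex : Fi n)) : Fc r z P := by
  obtain ⟨rfl, rfl⟩ := ha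
  cases P with
  | face k => exact ⟨(half_face k le_rfl).1, (half_face k le_rfl).2, fun _ _ => le_rfl⟩
  | page k => exact ⟨le_rfl, by rw [Y_half (by omega) (by omega) le_rfl]⟩
  | fin => exact ⟨le_rfl, rfl⟩
  | apex => exact ⟨rfl, rfl⟩
  | wint k => exact absurd trivial h
  | wpt k => exact absurd trivial h

theorem Mt_of_apex {P P' : Fi n} (h : ¬ P.wall) (h' : ¬ P'.wall)
    (H : ∀ r z : ℝ, 0 ≤ r → Fc r z P → Fc r z P' → r = 1 / 2 ∧ z = 0) : Mt P P' :=
  ⟨apex, id, fun r z h0 => ⟨fun ⟨a, b⟩ => H r z h0 a b, fun a => ⟨apex_Fc h a, apex_Fc h' a⟩⟩⟩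

theorem Mt_face (hn : 0 < n) {k l : Fin (n + 2)} (h : (k : ℕ) < l) : Mt (face k) (face l) := by
  by_cases h1 : (l : ℕ) = k + 1
  · refine ⟨page ⟨k, by omega⟩, id, fun r z h0 => ⟨?_, ?_⟩⟩
    · rintro ⟨⟨a1, a2, a3⟩, b1, b2, b3⟩
      refine ⟨?_, ?_⟩
      · by_cases k0 : (k : ℕ) = 0
        · exact b3 (by omega) (by omega)
        · exact a3 (by omega) (by omega)
      · rw [h1] at b1; exact le_antisymm a2 b1
    · rintro ⟨a, b⟩
      simp only at b
      subst b
      refine ⟨⟨Y_le hn (by omega) (by omega) h0, le_rfl, fun _ _ => a⟩, ?_, ?_, fun _ _ => a⟩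
      · rw [h1]
      · exact Y_le hn (by omega) (by omega) h0
  have key : ∀ r z : ℝ, 0 ≤ r → Fc r z (face k) → Fc r z (face l) → 1 / 2 ≤ r ∧ z = 0 := by
    rintro r z h0 ⟨a1, a2, a3⟩ ⟨b1, b2, b3⟩
    have hr : 1 / 2 ≤ r := by
      by_contra hr
      have := Y_lt hn (show (k : ℕ) + 1 < l by omega) (by omega) h0 (Or.inl (not_le.1 hr))
      linarith
    refine ⟨hr, ?_⟩
    rw [Y_half (by omega) (by omega) hr] at a2 b1
    linarith
  by_cases h2 : (k : ℕ) = 0 ∧ (l : ℕ) = n + 1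
  · refine ⟨fin, id, fun r z h0 => ⟨fun ⟨a, b⟩ => key r z h0 a b, ?_⟩⟩
    rintro ⟨a, rfl⟩
    exact ⟨⟨(half_face k a).1, (half_face k a).2, by omega⟩, (half_face l a).1, (half_face l a).2, by omega⟩
  · refine Mt_of_apex id id fun r z h0 a b => ?_
    obtain ⟨c, d⟩ := key r z h0 a b
    refine ⟨le_antisymm ?_ c, d⟩
    by_cases k0 : (k : ℕ) = 0
    · exact b.2.2 (by omega) (by omega)
    · exact a.2.2 (by omega) (by omega)

theorem Mt_face_page (hn : 0 < n) (k : Fin (n + 2)) (j : Fin (n + 1)) : Mt (face k) (page j) := by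
  by_cases h1 : (j : ℕ) = k ∨ (j : ℕ) + 1 = k
  · refine ⟨page j, id, fun r z h0 => ⟨fun h => h.2, fun h => ⟨?_, h⟩⟩⟩
    obtain ⟨a, rfl⟩ := h
    exact ⟨Y_le hn (by omega) (by omega) h0, Y_le hn (by omega) (by omega) h0, fun _ _ => a⟩
  · refine Mt_of_apex id id fun r z h0 a b => ?_
    obtain ⟨a1, a2, -⟩ := a
    obtain ⟨b1, rfl⟩ := b
    have hr : r = 1 / 2 := by
      by_contra hr
      have hr := lt_of_le_of_ne b1 hr
      rcases lt_or_ge (k : ℕ) j with h | h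
      · have := Y_lt hn (show (k : ℕ) + 1 < j + 1 by omega) (by omega) h0 (Or.inl hr); linarith
      · have := Y_lt hn (show (j : ℕ) + 1 < k by omega) (by omega) h0 (Or.inl hr); linarith
    exact ⟨hr, Y_half (by omega) (by omega) hr.ge⟩

theorem Mt_face_fin (k : Fin (n + 2)) : Mt (face k) fin := by
  by_cases h1 : (k : ℕ) = 0 ∨ (k : ℕ) = n + 1
  · refine ⟨fin, id, fun r z h0 => ⟨fun h => h.2, fun h => ⟨?_, h⟩⟩⟩
    obtain ⟨a, rfl⟩ := h
    exact ⟨(half_face k a).1, (half_face k a).2, by omega⟩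
  · exact Mt_of_apex id id fun r z h0 a b => ⟨le_antisymm (a.2.2 (by omega) (by omega)) b.1, b.2⟩

theorem Mt_page (hn : 0 < n) (k l : Fin (n + 1)) : Mt (page k) (page l) := by
  by_cases h : k = l
  · subst h; exact Mt.self id
  · refine Mt_of_apex id id fun r z h0 a b => ?_
    obtain ⟨a1, a2⟩ := a
    have hr : r = 1 / 2 := by
      by_contra hr
      exact h (lvl_uniq hn h0 (lt_of_le_of_ne a1 hr) (a2.symm.trans b.2))
    exact ⟨hr, by rw [a2, Y_half (by omega) (by omega) hr.ge]⟩
theorem Mt_page_fin (k : Fin (n + 1)) : Mt (page k) fin :=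
  Mt_of_apex id id fun _ _ _ a b => ⟨le_antisymm a.1 b.1, b.2⟩
theorem Mt_apex {P : Fi n} (h : ¬ P.wall) : Mt apex P := Mt_of_apex id h fun _ _ _ a _ => a

theorem Mt_all (hn : 0 < n) {P P' : Fi n} (h : ¬ P.wall) (h' : ¬ P'.wall) : Mt P P' := by
  cases P with
  | face k =>
    cases P' with
    | face l =>
      rcases lt_trichotomy (k : ℕ) l with g | g | g
      · exact Mt_face hn g
      · rw [Fin.ext g]; exact Mt.self id
      · exact (Mt_face hn g).symm
    | page l => exact Mt_face_page hn k l
    | fin => exact Mt_face_fin k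
    | apex => exact (Mt_apex h).symm
    | wint l => exact absurd trivial h'
    | wpt l => exact absurd trivial h'
  | page k =>
    cases P' with
    | face l => exact (Mt_face_page hn l k).symm
    | page l => exact Mt_page hn k l
    | fin => exact Mt_page_fin k
    | apex => exact (Mt_apex h).symm
    | wint l => exact absurd trivial h'
    | wpt l => exact absurd trivial h'
  | fin =>
    cases P' with
    | face l => exact (Mt_face_fin l).symm
    | page l => exact (Mt_page_fin l).symm
    | fin => exact Mt.self id
    | apex => exact (Mt_apex h).symm
    | wint l => exact absurd trivial h'
    | wpt l => exact absurd trivial h'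
  | apex => exact Mt_apex h'
  | wint l => exact absurd trivial h
  | wpt l => exact absurd trivial h

/-- Meets on the wall. -/
def Wm (S : ℝ → Prop) : Prop := (∀ z, ¬ S z) ∨ ∃ W : Fi n, W.wall ∧ ∀ z, S z ↔ Fc 0 z W

/-- Interval on the wall. -/
def IW (n a b : ℕ) (z : ℝ) : Prop := Y n a 0 ≤ z ∧ z ≤ Y n b 0

theorem Wm_IW (hn : 0 < n) {a b : ℕ} (ha : a ≤ n + 2) (hb : b ≤ n + 2) (hab : b ≤ a + 1) (h0 : a = b → 0 < a ∧ a < n + 2) :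
    Wm (n := n) (IW n a b) := by
  rcases lt_trichotomy a b with h | h | h
  · obtain rfl : b = a + 1 := by omega
    exact Or.inr ⟨wint ⟨a, by omega⟩, trivial, fun z => by simp [Fc, IW]⟩
  · subst h
    refine Or.inr ⟨wpt ⟨a - 1, by omega⟩, trivial, fun z => ?_⟩
    have : a - 1 + 1 = a := by omega
    simp only [Fc, IW, this, true_and]
    exact ⟨fun h => le_antisymm h.2 h.1, fun h => ⟨h.ge, h.le⟩⟩
  · left; rintro z ⟨h1, h2⟩
    have := Y_lt hn h ha le_rfl (Or.inl (by norm_num)); linarith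

/-- Wall shadow as a pair of levels. -/
theorem wall_IW (P : Fi n) : (∀ z, ¬ Fc 0 z P) ∨
    ∃ a b, a ≤ b ∧ b ≤ a + 1 ∧ b ≤ n + 2 ∧ (a = b → 0 < a ∧ a < n + 2) ∧ ∀ z, Fc 0 z P ↔ IW n a b z := by
  cases P with
  | face k => exact Or.inr ⟨k, k + 1, by omega, by omega, by omega, by omega, fun z => by simp [Fc, IW]⟩
  | page k => exact Or.inr ⟨k + 1, k + 1, by omega, by omega, by omega, by omega, fun z => by
      simp only [Fc, IW]; exact ⟨fun h => ⟨h.2.ge, h.2.le⟩, fun h => ⟨by norm_num, le_antisymm h.2 h.1⟩⟩⟩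
  | fin => left; rintro z ⟨h, -⟩; norm_num at h
  | apex => left; rintro z ⟨h, -⟩; norm_num at h
  | wint k => exact Or.inr ⟨k, k + 1, by omega, by omega, by omega, by omega, fun z => by simp [Fc, IW]⟩
  | wpt k => exact Or.inr ⟨k + 1, k + 1, by omega, by omega, by omega, by omega, fun z => by
      simp only [Fc, IW]; exact ⟨fun h => ⟨h.2.ge, h.2.le⟩, fun h => ⟨trivial, le_antisymm h.2 h.1⟩⟩⟩

theorem Wm_all (hn : 0 < n) (P P' : Fi n) : Wm (n := n) fun z => Fc 0 z P ∧ Fc 0 z P' := by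
  rcases wall_IW P with h | ⟨a, b, h1, h2, h3, h4, h5⟩
  · exact Or.inl fun z hz => h z hz.1
  rcases wall_IW P' with h | ⟨a', b', h1', h2', h3', h4', h5'⟩
  · exact Or.inl fun z hz => h z hz.2
  have e : (fun z => Fc 0 z P ∧ Fc 0 z P') = IW n (max a a') (min b b') := by
    funext z
    have m1 : Y n (max a a') 0 = max (Y n a 0) (Y n a' 0) := by
      rcases le_total a a' with h | h
      · rw [max_eq_right h, max_eq_right (Y_le hn h (by omega) le_rfl)]
      · rw [max_eq_left h, max_eq_left (Y_le hn h (by omega) le_rfl)]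
    have m2 : Y n (min b b') 0 = min (Y n b 0) (Y n b' 0) := by
      rcases le_total b b' with h | h
      · rw [min_eq_left h, min_eq_left (Y_le hn h (by omega) le_rfl)]
      · rw [min_eq_right h, min_eq_right (Y_le hn h (by omega) le_rfl)]
    rw [h5, h5', IW, IW, IW, m1, m2, max_le_iff, le_min_iff]
    exact propext (by tauto)
  rw [e]
  exact Wm_IW hn (by omega) (by omega) (by omega) (by omega)

end Fi
end Fat
end

noncomputable section
set_option linter.unusedSectionVars false
open Classical

namespace Fat
variable {n : ℕ}

theorem cell_pt {X : Type} [TopologicalSpace X] (a : X) : IsCell 0 ({a} : Set X) {a} := by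
  refine ⟨Fin 0 → ℝ, inferInstance, inferInstance, inferInstance, Set.univ, fun _ => a, by simp, convex_univ,
    isCompact_univ, by simp, continuousOn_const, fun x _ y _ _ => Subsingleton.elim x y, by simp, by simp⟩
theorem cell_Icc {a b : ℝ} (h : a < b) : IsCell 1 (Set.Icc a b) (Set.Ioo a b) := by
  refine ⟨ℝ, inferInstance, inferInstance, inferInstance, Set.Icc a b, id, by simp, convex_Icc a b, isCompact_Icc, ?_,
    continuousOn_id, Set.injOn_id _, by simp, by simp⟩
  rw [interior_Icc]; exact Set.nonempty_Ioo.2 h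

theorem cell_poly {m : ℕ} (a b c : Fin m → ℝ) (h : ∀ j, a j ≠ 0 ∨ b j ≠ 0) {A B : Set (ℝ × ℝ)} (hA : A ⊆ FB)
    (eA : ∀ p, p ∈ A ↔ ∀ j, 0 ≤ a j * p.1 + b j * p.2 + c j)
    (eB : ∀ p, p ∈ B ↔ ∀ j, 0 < a j * p.1 + b j * p.2 + c j) (hB : B.Nonempty) : IsCell 2 A B := by
  let l : Fin m → ℝ × ℝ →L[ℝ] ℝ := fun j =>
    a j • ContinuousLinearMap.fst ℝ ℝ ℝ + b j • ContinuousLinearMap.snd ℝ ℝ ℝ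
  have el : ∀ j p, l j p = a j * p.1 + b j * p.2 := fun j p => by simp [l]
  have eA' : A = {x | ∀ j, 0 ≤ l j x + c j} := by ext p; rw [eA]; simp only [Set.mem_ofPred_eq, el]
  have eB' : B = interior A := by
    rw [eA', poly_interior l c]
    · ext p; rw [eB]; simp only [Set.mem_ofPred_eq, el]
    · intro j hj
      have h1 := el j (1, 0)
      have h2 := el j (0, 1)
      rw [hj] at h1 h2
      simp at h1 h2
      exact absurd h1.symm (by rcases h j with h | h; exact h; exact absurd h2.symm h)
  have bd : IsCompact A := by
    refine Metric.isCompact_of_isClosed_isBounded (by rw [eA']; exact poly_closed l c) ?_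
    refine (Metric.isBounded_closedBall (x := (0 : ℝ × ℝ)) (r := 1)).subset fun p hp => ?_
    obtain ⟨h1, h2, h3⟩ := hA hp
    rw [mem_closedBall_zero_iff, Prod.norm_def]
    exact max_le (by rw [Real.norm_eq_abs, abs_of_nonneg h1]; exact h2) h3
  refine ⟨ℝ × ℝ, inferInstance, inferInstance, inferInstance, A, id, by simp, ?_, bd, ?_, continuousOn_id,
    Set.injOn_id _, by simp, by simp [eB']⟩
  · rw [eA']; exact poly_convex l c
  · rw [← eB']; exact hB

namespace Fi
/-- Closed fibre cell as a set. -/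
def A (P : Fi n) : Set (ℝ × ℝ) := {p | p ∈ FB ∧ Fc p.1 p.2 P}
/-- Open fibre cell as a set. -/
def B (P : Fi n) : Set (ℝ × ℝ) := {p | Fo p.1 p.2 P ∧ p.1 < 1 ∧ |p.2| < 1}

theorem A_sub (P : Fi n) : P.A ⊆ FB := fun _ h => h.1
theorem Fo_nonneg {P : Fi n} {r z : ℝ} (h : Fo r z P) : 0 ≤ r := by
  cases P <;> simp only [Fo] at h <;> linarith [h.1]
theorem B_sub (hn : 0 < n) (P : Fi n) : P.B ⊆ P.A := fun _ h =>
  ⟨⟨Fo_nonneg h.1, h.2.1.le, h.2.2.le⟩, Fo_Fc hn h.1⟩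

theorem cell_mid (hn : 0 < n) {k : Fin (n + 2)} (h0 : 0 < (k : ℕ)) (h1 : (k : ℕ) < n + 1) :
    IsCell 2 (A (face k)) (B (face k)) := by
  have e1 : ∀ r, Y n k r = yy n k * max 0 (1 - 2 * r) := Y_mid h0 (by omega)
  have e2 : ∀ r, Y n (k + 1) r = yy n (k + 1) * max 0 (1 - 2 * r) := Y_mid (by omega) (by omega)
  have y1 := abs_le.1 (yy_mem hn h0 h1.le)
  have y2 := abs_le.1 (yy_mem hn (show 1 ≤ (k : ℕ) + 1 by omega) (by omega))
  have y3 := yy_lt hn (show (k : ℕ) < k + 1 by omega)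
  refine cell_poly ![1, -2, 2 * yy n k, -2 * yy n (k + 1)] ![0, 0, 1, -1] ![0, 1, -yy n k, yy n (k + 1)]
    ?_ (A_sub _) ?_ ?_ ?_
  · intro j; fin_cases j <;> simp
  · rintro ⟨r, z⟩
    simp only [Fin.forall_fin_succ, A, Fc, FB, Set.mem_ofPred_eq, e1, e2, h0, h1, forall_const]
    simp
    constructor
    · rintro ⟨⟨a1, a2, a3⟩, b1, b2, b3⟩
      rw [max_eq_right (by linarith)] at b1 b2
      refine ⟨a1, by linarith, by linarith, by linarith⟩
    · rintro ⟨a1, a2, a3, a4⟩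
      rw [max_eq_right (by linarith), abs_le]
      refine ⟨⟨a1, by linarith, by nlinarith, by nlinarith⟩, by linarith, by linarith, by linarith⟩
  · rintro ⟨r, z⟩
    simp only [Fin.forall_fin_succ, B, Fo, Set.mem_ofPred_eq, e1, e2]
    simp
    constructor
    · rintro ⟨⟨a1, a2, a3⟩, b1, b2⟩
      have : 0 ≤ 1 - 2 * r := by
        by_contra h
        rw [max_eq_left (by linarith)] at a2 a3
        linarith
      rw [max_eq_right this] at a2 a3
      refine ⟨a1, by nlinarith, by linarith, by linarith⟩
    · rintro ⟨a1, a2, a3, a4⟩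
      rw [max_eq_right (by linarith), abs_lt]
      refine ⟨⟨a1, by linarith, by linarith⟩, by linarith, by nlinarith, by nlinarith⟩
  · refine ⟨(1 / 4, (yy n k + yy n (k + 1)) / 4), ⟨?_, ?_, ?_⟩, ?_, ?_⟩
    · norm_num
    · simp only [e1]; rw [max_eq_right (by norm_num)]; linarith
    · simp only [e2]; rw [max_eq_right (by norm_num)]; linarith
    · norm_num
    · simp only; rw [abs_lt]; constructor <;> linarith

theorem half_max (r z : ℝ) : (z ≤ -(1 / 2) * max 0 (1 - 2 * r) ↔ z ≤ 0 ∧ z ≤ -(1 / 2) * (1 - 2 * r)) ∧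
    (1 / 2 * max 0 (1 - 2 * r) ≤ z ↔ 0 ≤ z ∧ 1 / 2 * (1 - 2 * r) ≤ z) ∧
    (z < -(1 / 2) * max 0 (1 - 2 * r) ↔ z < 0 ∧ z < -(1 / 2) * (1 - 2 * r)) ∧
    (1 / 2 * max 0 (1 - 2 * r) < z ↔ 0 < z ∧ 1 / 2 * (1 - 2 * r) < z) := by
  rcases le_total 0 (1 - 2 * r) with h | h
  · rw [max_eq_right h]
    refine ⟨⟨fun g => ⟨by linarith, g⟩, fun g => g.2⟩, ⟨fun g => ⟨by linarith, g⟩, fun g => g.2⟩,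
      ⟨fun g => ⟨by linarith, g⟩, fun g => g.2⟩, ⟨fun g => ⟨by linarith, g⟩, fun g => g.2⟩⟩
  · rw [max_eq_left h]
    refine ⟨⟨fun g => ⟨by linarith, by linarith⟩, fun g => by linarith [g.1]⟩,
      ⟨fun g => ⟨by linarith, by linarith⟩, fun g => by linarith [g.1]⟩,
      ⟨fun g => ⟨by linarith, by linarith⟩, fun g => by linarith [g.1]⟩,
      ⟨fun g => ⟨by linarith, by linarith⟩, fun g => by linarith [g.1]⟩⟩

theorem cell_bot {k : Fin (n + 2)} (h0 : (k : ℕ) = 0) :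
    IsCell 2 (A (face k)) (B (face k)) := by
  have e2 : ∀ r, Y n 1 r = -(1 / 2) * max 0 (1 - 2 * r) := fun r => by rw [Y_mid le_rfl (by omega), yy_one]
  refine cell_poly ![1, -1, 0, 0, 1] ![0, 0, 1, -1, -1] ![0, 1, 1, 0, -(1 / 2)]
    ?_ (A_sub _) ?_ ?_ ?_
  · intro j; fin_cases j <;> simp
  · rintro ⟨r, z⟩
    simp only [Fin.forall_fin_succ, A, Fc, FB, Set.mem_ofPred_eq, h0, zero_add, Y_zero, e2, half_max]
    simp
    rw [abs_le]
    constructor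
    · rintro ⟨⟨a1, a2, a3, a4⟩, b1, b2, b3⟩
      refine ⟨by linarith, by linarith, by linarith, by linarith, by linarith⟩
    · rintro ⟨a1, a2, a3, a4, a5⟩
      refine ⟨⟨by linarith, by linarith, by linarith, by linarith⟩, by linarith, by linarith, by linarith⟩
  · rintro ⟨r, z⟩
    simp only [Fin.forall_fin_succ, B, Fo, Set.mem_ofPred_eq, h0, zero_add, Y_zero, e2, half_max]
    simp
    rw [abs_lt]
    constructor
    · rintro ⟨⟨a1, a2, a3, a4⟩, b1, b2, b3⟩
      refine ⟨by linarith, by linarith, by linarith, by linarith, by linarith⟩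
    · rintro ⟨a1, a2, a3, a4, a5⟩
      refine ⟨⟨by linarith, by linarith, by linarith, by linarith⟩, by linarith, by linarith, by linarith⟩
  · refine ⟨(1 / 2, -(1 / 2)), ⟨?_, ?_, ?_⟩, ?_, ?_⟩
    · norm_num
    · simp only [h0, Y_zero]; norm_num
    · simp only [h0, zero_add, e2]; norm_num
    · norm_num
    · simp only; rw [abs_lt]; constructor <;> norm_num

theorem cell_top (hn : 0 < n) {k : Fin (n + 2)} (h0 : (k : ℕ) = n + 1) :
    IsCell 2 (A (face k)) (B (face k)) := by
  have e2 : ∀ r, Y n (n + 1) r = 1 / 2 * max 0 (1 - 2 * r) := fun r => by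
    rw [Y_mid (by omega) (by omega), yy_last hn]
  have e3 : ∀ r, Y n (n + 1 + 1) r = 2 := fun r => Y_top r
  refine cell_poly ![1, -1, 0, 0, 1] ![0, 0, -1, 1, 1] ![0, 1, 1, 0, -(1 / 2)]
    ?_ (A_sub _) ?_ ?_ ?_
  · intro j; fin_cases j <;> simp
  · rintro ⟨r, z⟩
    simp only [Fin.forall_fin_succ, A, Fc, FB, Set.mem_ofPred_eq, h0, e3, e2, half_max]
    simp
    rw [abs_le]
    constructor
    · rintro ⟨⟨a1, a2, a3, a4⟩, ⟨b1, b2⟩, b3⟩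
      refine ⟨by linarith, by linarith, by linarith, by linarith, by linarith⟩
    · rintro ⟨a1, a2, a3, a4, a5⟩
      refine ⟨⟨by linarith, by linarith, by linarith, by linarith⟩, ⟨by linarith, by linarith⟩, by linarith⟩
  · rintro ⟨r, z⟩
    simp only [Fin.forall_fin_succ, B, Fo, Set.mem_ofPred_eq, h0, e3, e2, half_max]
    simp
    rw [abs_lt]
    constructor
    · rintro ⟨⟨a1, ⟨a2, a3⟩, a4⟩, b1, b2, b3⟩
      refine ⟨by linarith, by linarith, by linarith, by linarith, by linarith⟩
    · rintro ⟨a1, a2, a3, a4, a5⟩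
      refine ⟨⟨by linarith, ⟨by linarith, by linarith⟩, by linarith⟩, by linarith, by linarith, by linarith⟩
  · refine ⟨(1 / 2, 1 / 2), ⟨?_, ?_, ?_⟩, ?_, ?_⟩
    · norm_num
    · simp only [h0, e2]; norm_num
    · simp only [h0, e3]; norm_num
    · norm_num
    · simp only; rw [abs_lt]; constructor <;> norm_num

theorem cell_seg {f : ℝ → ℝ × ℝ} (hf : Continuous f) (hi : Function.Injective f) {a b : ℝ} (h : a < b)
    {S T : Set (ℝ × ℝ)} (hS : ∀ p, p ∈ S ↔ ∃ x, a ≤ x ∧ x ≤ b ∧ f x = p)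
    (hT : ∀ p, p ∈ T ↔ ∃ x, a < x ∧ x < b ∧ f x = p) : IsCell 1 S T := by
  have := (cell_Icc h).map hf hi
  convert this using 1
  · ext p; rw [hS]; simp [and_assoc]
  · ext p; rw [hT]; simp [and_assoc]

theorem cell (hn : 0 < n) (P : Fi n) : IsCell P.dim P.A P.B := by
  cases P with
  | face k =>
    by_cases h0 : (k : ℕ) = 0
    · exact cell_bot h0
    by_cases h1 : (k : ℕ) = n + 1
    · exact cell_top hn h1
    · exact cell_mid hn (by omega) (by omega)
  | page k =>
    have e : ∀ r, Y n (k + 1) r = yy n (k + 1) * max 0 (1 - 2 * r) := Y_mid (by omega) (by omega)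
    have ab : ∀ r, 0 ≤ r → |Y n (k + 1) r| ≤ 1 / 2 := fun r h => Y_abs hn (by omega) (by omega) h
    refine cell_seg (f := fun r => (r, Y n (k + 1) r)) (a := 0) (b := 1 / 2) ?_ ?_ (by norm_num) ?_ ?_
    · simp only [e]; fun_prop
    · intro x y h; exact (Prod.mk.inj h).1
    · rintro ⟨r, z⟩
      constructor
      · rintro ⟨⟨a1, a2, a3⟩, b1, b2⟩
        exact ⟨r, a1, b1, by simp only at b2; rw [b2]⟩
      · rintro ⟨x, a1, a2, a3⟩
        obtain ⟨rfl, rfl⟩ := Prod.mk.inj a3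
        exact ⟨⟨a1, by simp only; linarith, by linarith [ab x a1]⟩, a2, rfl⟩
    · rintro ⟨r, z⟩
      constructor
      · rintro ⟨⟨a1, a2, a3⟩, b1, b2⟩
        exact ⟨r, a1, a2, by simp only at a3; rw [a3]⟩
      · rintro ⟨x, a1, a2, a3⟩
        obtain ⟨rfl, rfl⟩ := Prod.mk.inj a3
        exact ⟨⟨a1, a2, rfl⟩, by simp only; linarith, by linarith [ab x a1.le]⟩
  | fin =>
    refine cell_seg (f := fun r => (r, 0)) (a := 1 / 2) (b := 1) (by fun_prop) ?_ (by norm_num) ?_ ?_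
    · intro x y h; exact (Prod.mk.inj h).1
    · rintro ⟨r, z⟩
      constructor
      · rintro ⟨⟨a1, a2, a3⟩, b1, b2⟩
        exact ⟨r, b1, a2, by simp only at b2; rw [b2]⟩
      · rintro ⟨x, a1, a2, a3⟩
        obtain ⟨rfl, rfl⟩ := Prod.mk.inj a3
        exact ⟨⟨by simp only; linarith, a2, by simp⟩, a1, rfl⟩
    · rintro ⟨r, z⟩
      constructor
      · rintro ⟨⟨a1, a2⟩, b1, b2⟩
        exact ⟨r, a1, b1, by simp only at a2; rw [a2]⟩
      · rintro ⟨x, a1, a2, a3⟩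
        obtain ⟨rfl, rfl⟩ := Prod.mk.inj a3
        exact ⟨⟨a1, rfl⟩, a2, by simp⟩
  | apex =>
    show IsCell 0 _ _
    convert cell_pt ((1 / 2, 0) : ℝ × ℝ) using 1
    · ext ⟨r, z⟩
      rw [Set.mem_singleton_iff, Prod.mk.injEq]
      exact ⟨fun h => h.2, fun h => ⟨⟨by simp only [h.1]; norm_num, by simp only [h.1]; norm_num, by simp only [h.2]; norm_num⟩, h⟩⟩
    · ext ⟨r, z⟩
      rw [Set.mem_singleton_iff, Prod.mk.injEq]
      exact ⟨fun h => h.1, fun h => ⟨h, by simp only [h.1]; norm_num, by simp only [h.2]; norm_num⟩⟩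
  | wint k =>
    have l : max (-1) (Y n k 0) < min 1 (Y n (k + 1) 0) := by
      rw [max_lt_iff, lt_min_iff, lt_min_iff]
      have u1 : -1 < Y n (k + 1) 0 := by
        by_cases h : (k : ℕ) = n + 1
        · rw [h, Y_top]; norm_num
        · linarith [(abs_le.1 (Y_abs hn (show 1 ≤ (k : ℕ) + 1 by omega) (by omega) le_rfl)).1]
      have u2 : Y n k 0 < 1 := by
        by_cases h : (k : ℕ) = 0
        · rw [h, Y_zero]; norm_num
        · linarith [(abs_le.1 (Y_abs hn (show 1 ≤ (k : ℕ) by omega) (by omega) le_rfl)).2]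
      exact ⟨⟨by norm_num, u1⟩, u2, Y_lt hn (by omega) (by omega) le_rfl (Or.inl (by norm_num))⟩
    refine cell_seg (f := fun z => (0, z)) (by fun_prop) ?_ l ?_ ?_
    · intro x y h; exact (Prod.mk.inj h).2
    · rintro ⟨r, z⟩
      simp only [max_le_iff, le_min_iff, Prod.mk.injEq]
      constructor
      · rintro ⟨⟨a1, a2, a3⟩, b1, b2, b3⟩
        simp only at b1 a3
        subst b1
        rw [abs_le] at a3
        exact ⟨z, ⟨a3.1, b2⟩, ⟨a3.2, b3⟩, rfl, rfl⟩
      · rintro ⟨x, a1, a2, rfl, rfl⟩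
        exact ⟨⟨le_rfl, by norm_num, abs_le.2 ⟨a1.1, a2.1⟩⟩, rfl, a1.2, a2.2⟩
    · rintro ⟨r, z⟩
      simp only [max_lt_iff, lt_min_iff, Prod.mk.injEq]
      constructor
      · rintro ⟨⟨b1, b2, b3⟩, a1, a2⟩
        simp only at b1 a2
        subst b1
        rw [abs_lt] at a2
        exact ⟨z, ⟨a2.1, b2⟩, ⟨a2.2, b3⟩, rfl, rfl⟩
      · rintro ⟨x, a1, a2, rfl, rfl⟩
        exact ⟨⟨rfl, a1.2, a2.2⟩, by norm_num, abs_lt.2 ⟨a1.1, a2.1⟩⟩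
  | wpt k =>
    have ab := Y_abs hn (show 1 ≤ (k : ℕ) + 1 by omega) (by omega) (le_refl 0)
    show IsCell 0 _ _
    convert cell_pt ((0, Y n (k + 1) 0) : ℝ × ℝ) using 1
    · ext ⟨r, z⟩
      rw [Set.mem_singleton_iff, Prod.mk.injEq]
      constructor
      · rintro ⟨-, h1, h2⟩; simp only at h1 h2; subst h1; exact ⟨rfl, h2⟩
      · rintro ⟨rfl, rfl⟩; exact ⟨⟨le_rfl, by norm_num, by linarith⟩, rfl, rfl⟩
    · ext ⟨r, z⟩
      rw [Set.mem_singleton_iff, Prod.mk.injEq]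
      constructor
      · rintro ⟨⟨h1, h2⟩, -⟩; simp only at h1 h2; subst h1; exact ⟨rfl, h2⟩
      · rintro ⟨rfl, rfl⟩; exact ⟨⟨rfl, rfl⟩, by norm_num, by linarith⟩
end Fi
end Fat
end

noncomputable section
set_option linter.unusedSectionVars false
open Classical

namespace Fat
variable {D n : ℕ}

theorem NN_iff (x : Q3) : x ∈ NN D ↔ ∃ s : Sp D, s.q = x ∧ |s.δ| < 1 / 4 ∧ |s.z| < 1 := by
  constructor
  · rintro ⟨h, c, hc, h1, h2, h3, h4⟩
    exact ⟨⟨h, ⟨c, hc⟩, dl h c x, x.2.1, zz h c x, hc, h1.le, h3, h4, h2.le⟩, pt_dl _ _ _, h1, h2⟩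
  · rintro ⟨s, rfl, h1, h2⟩
    refine ⟨s.h, s.c, s.c.2, ?_⟩
    rw [Sp.q, dl_pt, zz_pt, t_pt]
    exact ⟨h1, h2, s.ok.lo, s.ok.hi⟩

theorem NN_sp (hD : 2 ≤ D) (s : Sp D) : s.q ∈ NN D ↔ |s.δ| < 1 / 4 ∧ |s.z| < 1 := by
  rw [NN_iff]
  constructor
  · rintro ⟨s', e, h⟩
    obtain ⟨_, e1, e2⟩ := Sp.q_inv hD e
    rw [← e1, ← e2]; exact h
  · intro h; exact ⟨s, rfl, h⟩

/-- Index type of the product cells. -/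
structure JJ (D n : ℕ) : Type where
  b : Bc D
  P : Fi n
  hb : b.off ↔ ¬ P.wall

namespace JJ
theorem ext' {i j : JJ D n} (h1 : i.b = j.b) (h2 : i.P = j.P) : i = j := by
  cases i; cases j; cases h1; cases h2; rfl
/-- Dimension. -/
def d (i : JJ D n) : Fin 4 := ⟨i.P.dim + i.b.rk, by
  have h1 : i.b.rk ≤ 1 := by cases i.b <;> simp [Bc.rk]
  have h2 : i.P.dim ≤ 2 := by cases i.P <;> simp [Fi.dim]
  omega⟩
/-- Closed cell. -/
def cl (i : JJ D n) : Set Q3 := Cl i.b i.P.A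
/-- Open cell. -/
def op (i : JJ D n) : Set Q3 := Op i.b i.P.B

theorem cell (hD : 2 ≤ D) (hn : 0 < n) (i : JJ D n) : IsCell (i.d : ℕ) i.cl i.op := by
  refine Cl_cell hD i.b (i.P.cell hn) i.P.A_sub (i.P.B_sub hn) ?_ ?_
  · intro p hp
    rw [i.hb]
    by_cases h : i.P.wall
    · exact Or.inr (Fi.Fc_wall hp.2 h)
    · exact Or.inl h
  · intro p hp
    rw [i.hb, Fi.Fo_wall hp.1 (Fi.Fo_nonneg hp.1)]

theorem disj (hD : 2 ≤ D) (hn : 0 < n) (i j : JJ D n) (h : i ≠ j) : Disjoint i.op j.op := by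
  rw [Set.disjoint_left]
  rintro x ⟨s, rfl, e1, e2⟩ ⟨s', e, e1', e2'⟩
  obtain ⟨f1, f2, f3⟩ := Sp.q_inv hD e
  rw [f2, f3] at e2'
  have := Fi.Fo_uniq hn (Fi.Fo_nonneg e2.1) e2.1 e2'.1
  exact h (ext' (by rw [← e1, ← e1', f1]) this)

theorem ex (s : Sp D) : ∃ i : JJ D n, i.b = s.a ∧ Fi.Fo (4 * |s.δ|) s.z i.P := by
  obtain ⟨Q, hQ⟩ := Fi.Fo_ex (n := n) (show 0 ≤ 4 * |s.δ| by positivity) s.ok.hz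
  refine ⟨⟨s.a, Q, ?_⟩, rfl, hQ⟩
  rw [s.a_off, Fi.Fo_wall hQ (by positivity)]; simp

theorem cov (x : Q3) : x ∈ NN D ↔ ∃ i : JJ D n, x ∈ i.op := by
  rw [NN_iff]
  constructor
  · rintro ⟨s, rfl, h1, h2⟩
    obtain ⟨i, e1, e2⟩ := ex (n := n) s
    exact ⟨i, s, rfl, e1.symm, e2, by simp only; linarith, h2⟩
  · rintro ⟨i, s, rfl, e1, e2, e3, e4⟩
    simp only at e3 e4
    exact ⟨s, rfl, by linarith, e4⟩

theorem fb (s : Sp D) : (4 * |s.δ|, s.z) ∈ FB :=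
  ⟨by simp only; positivity, by simp only; linarith [s.ok.hδ], s.ok.hz⟩

theorem mem_cl (i : JJ D n) (s : Sp D) (hD : 2 ≤ D) : s.q ∈ i.cl ↔ Bc.le s.a i.b ∧ Fi.Fc (4 * |s.δ|) s.z i.P := by
  constructor
  · rintro ⟨s', e, e1, e2⟩
    obtain ⟨f1, f2, f3⟩ := Sp.q_inv hD e
    rw [← f1, ← f2, ← f3]; exact ⟨e1, e2.2⟩
  · rintro ⟨h1, h2⟩; exact ⟨s, rfl, h1, fb s, h2⟩

theorem bd (hD : 2 ≤ D) (hn : 0 < n) (i : JJ D n) (s : Sp D) (h : s.q ∈ i.cl) (ho : s.q ∉ i.op)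
    (hN : s.q ∈ NN D) : ∃ j : JJ D n, j.d < i.d ∧ s.q ∈ j.cl := by
  rw [NN_sp hD] at hN
  rw [mem_cl i s hD] at h
  obtain ⟨j, e1, e2⟩ := ex (n := n) s
  refine ⟨j, ?_, (mem_cl j s hD).2 ⟨by rw [e1]; exact Bc.le_refl _, Fi.Fo_Fc hn e2⟩⟩
  have rk := Bc.rk_le h.1
  rw [Fin.lt_def]
  change j.P.dim + j.b.rk < i.P.dim + i.b.rk
  rw [e1]
  rcases Fi.Fo_dim hn (by positivity) e2 h.2 with q | q
  · rw [q]
    rcases rk.lt_or_eq with r | r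
    · omega
    · exfalso
      have : s.a = i.b := Bc.rk_eq h.1 r (by rw [← e1, j.hb, i.hb, q])
      exact ho ⟨s, rfl, this, by rw [← q]; exact e2, by simp only; linarith [hN.1], hN.2⟩
  · omega

theorem ii (hD : 2 ≤ D) (hn : 0 < n) (i j : JJ D n) : i.cl ∩ j.cl = ∅ ∨ ∃ k : JJ D n, i.cl ∩ j.cl = k.cl := by
  have sp : ∀ (k : JJ D n) (x : Q3), x ∈ k.cl → ∃ s : Sp D, s.q = x := fun k x h => ⟨h.choose, h.choose_spec.1⟩
  have em : (∀ s : Sp D, ¬ (s.q ∈ i.cl ∧ s.q ∈ j.cl)) → i.cl ∩ j.cl = ∅ := by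
    intro h
    rw [Set.eq_empty_iff_forall_notMem]
    rintro x hx
    obtain ⟨s, rfl⟩ := sp _ _ hx.1
    exact h s hx
  have eq : ∀ k : JJ D n, (∀ s : Sp D, (s.q ∈ i.cl ∧ s.q ∈ j.cl) ↔ s.q ∈ k.cl) → i.cl ∩ j.cl = k.cl := by
    intro k h
    ext x
    constructor
    · intro hx
      obtain ⟨s, rfl⟩ := sp _ _ hx.1
      exact (h s).1 hx
    · intro hx
      obtain ⟨s, rfl⟩ := sp _ _ hx
      exact (h s).2 hx
  rcases Bc.meet hD i.b j.b with h | ⟨c, hc⟩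
  · left
    exact em fun s hs => h s.a ⟨((mem_cl i s hD).1 hs.1).1, ((mem_cl j s hD).1 hs.2).1⟩
  by_cases hoff : c.off
  · have hcc := (hc c).2 (Bc.le_refl c)
    have o1 := i.hb.1 (Bc.off_mono hcc.1 hoff)
    have o2 := j.hb.1 (Bc.off_mono hcc.2 hoff)
    obtain ⟨Q, w, hQ⟩ := Fi.Mt_all hn o1 o2
    right
    refine ⟨⟨c, Q, by simp only [hoff, w, not_false_eq_true]⟩, eq _ fun s => ?_⟩
    rw [mem_cl _ s hD, mem_cl _ s hD, mem_cl _ s hD]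
    change _ ↔ Bc.le s.a c ∧ Fi.Fc _ _ Q
    rw [← hc, ← hQ _ _ (by positivity)]; tauto
  · have z0 : ∀ s : Sp D, Bc.le s.a c → 4 * |s.δ| = 0 := by
      intro s hs
      have : ¬ s.a.off := fun h => hoff (Bc.off_mono hs h)
      rw [s.a_off, not_not] at this
      simp [this]
    rcases Fi.Wm_all hn i.P j.P with h | ⟨W, w, hW⟩
    · left
      refine em fun s hs => ?_
      rw [mem_cl _ s hD, mem_cl _ s hD] at hs
      have := z0 s ((hc _).1 ⟨hs.1.1, hs.2.1⟩)
      rw [this] at hs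
      exact h _ ⟨hs.1.2, hs.2.2⟩
    · right
      refine ⟨⟨c, W, by simp only [hoff, w, not_true]⟩, eq _ fun s => ?_⟩
      rw [mem_cl _ s hD, mem_cl _ s hD, mem_cl _ s hD]
      change _ ↔ Bc.le s.a c ∧ Fi.Fc _ _ W
      constructor
      · rintro ⟨⟨a1, a2⟩, a3, a4⟩
        have l := (hc _).1 ⟨a1, a3⟩
        rw [z0 s l] at a2 a4 ⊢
        exact ⟨l, (hW _).1 ⟨a2, a4⟩⟩
      · rintro ⟨l, a⟩
        rw [z0 s l] at a ⊢
        have := (hW _).2 a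
        have l' := (hc _).2 l
        exact ⟨⟨l'.1, this.1⟩, l'.2, this.2⟩
end JJ
end Fat
end

noncomputable section
set_option linter.unusedSectionVars false
open Classical

namespace Fat
variable {D n : ℕ}

/-- Functional `dl - v`. -/
def dv (h : Gam D) (c : ℕ) (v : ℝ) : Fin 4 → ℝ := ![-XX h - v, 1, -sl h c, 0]
/-- Functional `t - k * dl - w`. -/
def tv (h : Gam D) (c : ℕ) (k w : ℝ) : Fin 4 → ℝ := ![k * XX h - w, -k, 1 + k * sl h c, 0]
/-- Functional `ζ - m * (t - 1) - v`. -/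
def zv (m v : ℝ) : Fin 4 → ℝ := ![m - v, 0, -m, 1]

theorem aff_dv (h : Gam D) (c : ℕ) (v : ℝ) (q : Q3) : aff (dv h c v) q = dl h c q - v := by
  simp [aff, dv, dl]; ring
theorem aff_tv (h : Gam D) (c : ℕ) (k w : ℝ) (q : Q3) : aff (tv h c k w) q = q.2.1 - k * dl h c q - w := by
  simp [aff, tv, dl]; ring
theorem aff_zv (m v : ℝ) (q : Q3) : aff (zv m v) q = q.2.2 - m * (q.2.1 - 1) - v := by
  simp [aff, zv]; ring

/-- Local list of functionals. -/
def LL (h : Gam D) (c : ℕ) : Finset (Fin 4 → ℝ) :=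
  {dv h c 0, dv h c (1 / 4), dv h c (-(1 / 4)), tv h c (2 * AA h (c + 1)) 0, tv h c (-2 * AA h c) 0,
    tv h c (-2 * eta h c) (TT h c), tv h c 0 0, tv h c 0 1, zv 0 0, zv 0 (1 / 4), zv 0 (-(1 / 4)),
    zv (lam h c) 0, zv (lam h c) (1 / 4), zv (lam h c) (-(1 / 4))}
/-- The arrangement. -/
def FF (D : ℕ) : Finset (Fin 4 → ℝ) :=
  (Finset.univ.image fun j : Fin 4 => Pi.single j (1 : ℝ)) ∪
    (Finset.univ : Finset (Gam D × Fin D)).biUnion fun x => LL x.1 x.2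

theorem FF_coord : Coord (FF D) := fun j => Finset.mem_union_left _ (Finset.mem_image_of_mem _ (Finset.mem_univ j))
theorem FF_mem (h : Gam D) {c : ℕ} (hc : c < D) {a : Fin 4 → ℝ} (ha : a ∈ LL h c) : a ∈ FF D :=
  Finset.mem_union_right _ (Finset.mem_biUnion.2 ⟨(h, ⟨c, hc⟩), Finset.mem_univ _, ha⟩)

/-- Same sign. -/
def SG (x y : ℝ) : Prop := SignType.sign x = SignType.sign y
theorem SG.lt {x y : ℝ} (h : SG x y) : x < 0 ↔ y < 0 := by
  rw [← sign_eq_neg_one_iff, ← sign_eq_neg_one_iff, show SignType.sign x = _ from h]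
theorem SG.gt {x y : ℝ} (h : SG x y) : 0 < x ↔ 0 < y := by
  rw [← sign_eq_one_iff, ← sign_eq_one_iff, show SignType.sign x = _ from h]
theorem SG.eq {x y : ℝ} (h : SG x y) : x = 0 ↔ y = 0 := by
  have h : SignType.sign x = SignType.sign y := h
  exact ⟨fun e => sign_eq_zero_iff.1 (by rw [← h, sign_eq_zero_iff.2 e]),
    fun e => sign_eq_zero_iff.1 (by rw [h, sign_eq_zero_iff.2 e])⟩
theorem SG.le {x y : ℝ} (h : SG x y) : x ≤ 0 ↔ y ≤ 0 := by
  rw [← not_lt, ← not_lt, h.gt]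
theorem SG.ge {x y : ℝ} (h : SG x y) : 0 ≤ x ↔ 0 ≤ y := by
  rw [← not_lt, ← not_lt, h.lt]

/-- Points with the same sign vector. -/
def SS (D : ℕ) (p q : Q3) : Prop := ∀ a ∈ FF D, SignType.sign (aff a p) = SignType.sign (aff a q)

theorem SS.dl {p q : Q3} (H : SS D p q) (h : Gam D) {c : ℕ} (hc : c < D) :
    SG (Fat.dl h c p) (Fat.dl h c q) ∧ SG (Fat.dl h c p - 1 / 4) (Fat.dl h c q - 1 / 4) ∧
    SG (Fat.dl h c p - -(1 / 4)) (Fat.dl h c q - -(1 / 4)) := by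
  refine ⟨?_, ?_, ?_⟩
  · have := H _ (FF_mem h hc (a := dv h c 0) (by simp [LL])); rwa [aff_dv, aff_dv, sub_zero, sub_zero] at this
  · have := H _ (FF_mem h hc (a := dv h c (1 / 4)) (by simp [LL])); rwa [aff_dv, aff_dv] at this
  · have := H _ (FF_mem h hc (a := dv h c (-(1 / 4))) (by simp [LL])); rwa [aff_dv, aff_dv] at this
theorem SS.t {p q : Q3} (H : SS D p q) (h : Gam D) {c : ℕ} (hc : c < D) :
    SG p.2.1 q.2.1 ∧ SG (p.2.1 - 1) (q.2.1 - 1) ∧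
    SG (p.2.1 - low h c (Fat.dl h c p)) (q.2.1 - low h c (Fat.dl h c q)) ∧
    SG (p.2.1 - up h c (Fat.dl h c p)) (q.2.1 - up h c (Fat.dl h c q)) := by
  refine ⟨?_, ?_, ?_, ?_⟩
  · have := H _ (FF_mem h hc (a := tv h c 0 0) (by simp [LL])); rw [aff_tv, aff_tv] at this
    unfold SG; simpa using this
  · have := H _ (FF_mem h hc (a := tv h c 0 1) (by simp [LL])); rw [aff_tv, aff_tv] at this
    unfold SG; simpa using this
  · have hd := (H.dl h hc).1
    rcases le_total 0 (Fat.dl h c p) with h0 | h0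
    · rw [low_nonneg h c h0, low_nonneg h c (hd.ge.1 h0)]
      have := H _ (FF_mem h hc (a := tv h c (2 * AA h (c + 1)) 0) (by simp [LL])); rw [aff_tv, aff_tv] at this
      unfold SG; convert this using 2 <;> ring
    · rw [low_nonpos h c h0, low_nonpos h c (hd.le.1 h0)]
      have := H _ (FF_mem h hc (a := tv h c (-2 * AA h c) 0) (by simp [LL])); rw [aff_tv, aff_tv] at this
      unfold SG; convert this using 2 <;> ring
  · have := H _ (FF_mem h hc (a := tv h c (-2 * eta h c) (TT h c)) (by simp [LL])); rw [aff_tv, aff_tv] at this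
    unfold SG up; convert this using 2 <;> ring

theorem zz_aff (h : Gam D) (c : ℕ) (v : ℝ) (q : Q3) :
    (q.2.1 ≤ 1 → zz h c q - 4 * v = 4 * aff (zv 0 v) q) ∧ (1 ≤ q.2.1 → zz h c q - 4 * v = 4 * aff (zv (lam h c) v) q) := by
  constructor
  · intro ht; rw [aff_zv, zz, max_eq_right (by linarith)]; ring
  · intro ht; rw [aff_zv, zz, max_eq_left (by linarith)]; ring

theorem SS.z' {p q : Q3} (H : SS D p q) (h : Gam D) {c : ℕ} (hc : c < D) {v : ℝ}
    (h0 : zv 0 v ∈ LL h c) (h1 : zv (lam h c) v ∈ LL h c) : SG (zz h c p - 4 * v) (zz h c q - 4 * v) := by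
  have ht := (H.t h hc).2.1
  rcases le_total p.2.1 1 with g | g
  · have g' : q.2.1 ≤ 1 := by have := ht.le.1 (by linarith); linarith
    rw [(zz_aff h c v p).1 g, (zz_aff h c v q).1 g']
    unfold SG; rw [sign_mul, sign_mul, H _ (FF_mem h hc h0)]
  · have g' : 1 ≤ q.2.1 := by have := ht.ge.1 (by linarith); linarith
    rw [(zz_aff h c v p).2 g, (zz_aff h c v q).2 g']
    unfold SG; rw [sign_mul, sign_mul, H _ (FF_mem h hc h1)]
theorem SS.z {p q : Q3} (H : SS D p q) (h : Gam D) {c : ℕ} (hc : c < D) :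
    SG (zz h c p) (zz h c q) ∧ SG (zz h c p - 1) (zz h c q - 1) ∧ SG (zz h c p + 1) (zz h c q + 1) := by
  refine ⟨?_, ?_, ?_⟩
  · have := H.z' h hc (v := 0) (by simp [LL]) (by simp [LL]); simpa using this
  · have := H.z' h hc (v := 1 / 4) (by simp [LL]) (by simp [LL]); convert this using 2 <;> norm_num
  · have := H.z' h hc (v := -(1 / 4)) (by simp [LL]) (by simp [LL]); convert this using 1 <;> ring

theorem SS.symm {p q : Q3} (H : SS D p q) : SS D q p := fun a ha => (H a ha).symm

theorem NN_SL : SL (FF D) (NN D) := by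
  rintro p q H ⟨h, c, hc, h1, h2, h3, h4⟩
  have H : SS D p q := H
  obtain ⟨d0, d1, d2⟩ := H.dl h hc
  obtain ⟨z0, z1, z2⟩ := H.z h hc
  obtain ⟨t0, t1, t2, t3⟩ := H.t h hc
  rw [abs_lt] at h1 h2
  have a1 := d1.lt.1 (by linarith)
  have a2 := d2.gt.1 (by linarith)
  have a3 := z1.lt.1 (by linarith)
  have a4 := z2.gt.1 (by linarith)
  have a5 := t2.ge.1 (by linarith)
  have a6 := t3.le.1 (by linarith)
  exact ⟨h, c, hc, abs_lt.2 ⟨by linarith, by linarith⟩, abs_lt.2 ⟨by linarith, by linarith⟩, by linarith, by linarith⟩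

/-- Transport of a strip point along equality of signs. -/
theorem SS.sp (s : Sp D) {q : Q3} (H : SS D s.q q) : ∃ s' : Sp D, s'.q = q ∧ s'.a = s.a ∧
    (s.δ = 0 → s'.δ = 0) ∧ (|s.δ| = 1 / 4 → |s'.δ| = 1 / 4) ∧ SG s.z s'.z ∧ (s.z = 1 → s'.z = 1) ∧ (s.z = -1 → s'.z = -1) := by
  obtain ⟨d0, d1, d2⟩ := H.dl s.h s.c.2
  obtain ⟨z0, z1, z2⟩ := H.z s.h s.c.2
  obtain ⟨t0, t1, t2, t3⟩ := H.t s.h s.c.2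
  have hp : Fat.dl s.h s.c s.q = s.δ := dl_pt _ _ _ _ _
  have hz : zz s.h s.c s.q = s.z := zz_pt _ _ _ _ _
  have ht : s.q.2.1 = s.t := rfl
  rw [hp] at d0 d1 d2 t2 t3
  rw [hz] at z0 z1 z2
  rw [ht] at t0 t1 t2 t3
  have ok := s.ok
  have o1 := abs_le.1 ok.hδ
  have o2 := abs_le.1 ok.hz
  have b1 := d1.le.1 (by linarith)
  have b2 := d2.ge.1 (by linarith)
  have b3 := z1.le.1 (by linarith)
  have b4 := z2.ge.1 (by linarith)
  have b5 := t2.ge.1 (by linarith [ok.lo])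
  have b6 := t3.le.1 (by linarith [ok.hi])
  refine ⟨⟨s.h, s.c, Fat.dl s.h s.c q, q.2.1, zz s.h s.c q, s.c.2, abs_le.2 ⟨by linarith, by linarith⟩,
    by linarith, by linarith, abs_le.2 ⟨by linarith, by linarith⟩⟩, pt_dl _ _ _, ?_, d0.eq.1, ?_, z0, ?_, ?_⟩
  · have e1 : (q.2.1 = low s.h s.c (Fat.dl s.h s.c q)) = (s.t = low s.h s.c s.δ) := by
      exact propext ⟨fun h => sub_eq_zero.1 (t2.eq.2 (sub_eq_zero.2 h)), fun h => sub_eq_zero.1 (t2.eq.1 (sub_eq_zero.2 h))⟩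
    simp only [Sp.a, ← d0.lt, ← d0.gt, e1, ← t0.eq]
  · intro h
    simp only
    rcases eq_or_eq_neg_of_abs_eq h with h | h
    · have := d1.eq.1 (by linarith)
      rw [show Fat.dl s.h s.c q = 1 / 4 by linarith]; norm_num
    · have := d2.eq.1 (by linarith)
      rw [show Fat.dl s.h s.c q = -(1 / 4) by linarith]; norm_num
  · intro h; have := z1.eq.1 (by linarith); simp only; linarith
  · intro h; have := z2.eq.1 (by linarith); simp only; linarith

namespace Fi
theorem bdry (hn : 0 < n) {P : Fi n} {r z : ℝ} (h0 : 0 ≤ r) (hP : Fc r z P) (hb : r = 1 ∨ |z| = 1) :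
    (∃ k, P = face k) ∨ P = fin ∨ ∃ k, P = wint k := by
  cases P with
  | face k => exact Or.inl ⟨k, rfl⟩
  | fin => exact Or.inr (Or.inl rfl)
  | wint k => exact Or.inr (Or.inr ⟨k, rfl⟩)
  | page k =>
    exfalso
    have := Y_abs hn (show 1 ≤ (k : ℕ) + 1 by omega) (by omega) h0
    rw [← hP.2] at this
    rcases hb with h | h <;> linarith [hP.1]
  | apex =>
    exfalso
    have : |z| = 0 := by rw [hP.2]; simp
    rcases hb with h | h <;> linarith [hP.1]
  | wpt k =>
    exfalso
    have := Y_abs hn (show 1 ≤ (k : ℕ) + 1 by omega) (by omega) h0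
    rw [← hP.2] at this
    rcases hb with h | h <;> linarith [hP.1]

theorem end_lvl (hn : 0 < n) {k : Fin (n + 2)} {r r' z z' : ℝ} (h0 : 0 ≤ r) (h0' : 0 ≤ r')
    (h1 : Y n k r ≤ z) (h2 : z ≤ Y n (k + 1) r) (hz : |z| = 1) (e1 : z = 1 → z' = 1) (e2 : z = -1 → z' = -1) :
    ((k : ℕ) = 0 ∨ (k : ℕ) = n + 1) ∧ Y n k r' ≤ z' ∧ z' ≤ Y n (k + 1) r' := by
  rcases eq_or_eq_neg_of_abs_eq hz with h | h
  · have hk : (k : ℕ) = n + 1 := by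
      by_contra hk
      have := abs_le.1 (Y_abs hn (show 1 ≤ (k : ℕ) + 1 by omega) (by omega) h0); linarith
    have := abs_le.1 (Y_abs hn (show 1 ≤ (k : ℕ) by omega) (by omega) h0')
    refine ⟨Or.inr hk, by linarith [e1 h], ?_⟩
    rw [hk, Y_top]; linarith [e1 h]
  · have hk : (k : ℕ) = 0 := by
      by_contra hk
      have := abs_le.1 (Y_abs hn (show 1 ≤ (k : ℕ) by omega) (by omega) h0); linarith
    have := abs_le.1 (Y_abs hn (show 1 ≤ (k : ℕ) + 1 by omega) (by omega) h0')
    refine ⟨Or.inl hk, ?_, by linarith [e2 h]⟩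
    rw [hk, Y_zero]; linarith [e2 h]

theorem bdry_inv (hn : 0 < n) {P : Fi n} {r r' z z' : ℝ} (h0 : 0 ≤ r) (h0' : 0 ≤ r') (hP : Fc r z P)
    (hb : r = 1 ∨ |z| = 1) (e0 : r = 0 → r' = 0) (e1 : r = 1 → r' = 1) (ez : SG z z') (e2 : z = 1 → z' = 1)
    (e3 : z = -1 → z' = -1) (hz' : |z'| ≤ 1) : Fc r' z' P := by
  rcases bdry hn h0 hP hb with ⟨k, rfl⟩ | rfl | ⟨k, rfl⟩
  · obtain ⟨a1, a2, a3⟩ := hP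
    rcases hb with h | h
    · have r1 := e1 h
      rw [h] at a1 a2 a3
      rw [r1]
      have hk : (k : ℕ) = 0 ∨ (k : ℕ) = n + 1 := by
        by_contra hk
        have := a3 (by omega) (by omega); norm_num at this
      have y := abs_le.1 hz'
      refine ⟨?_, ?_, by omega⟩
      · rcases hk with hk | hk
        · rw [hk, Y_zero]; linarith
        · rw [Y_half (by omega) (by omega) (by norm_num)] at a1 ⊢; exact ez.ge.1 a1
      · rcases hk with hk | hk
        · rw [Y_half (by omega) (by omega) (by norm_num)] at a2 ⊢; exact ez.le.1 a2
        · rw [hk, Y_top]; linarith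
    · obtain ⟨b1, b2, b3⟩ := end_lvl hn h0 h0' a1 a2 h e2 e3
      exact ⟨b2, b3, by omega⟩
  · obtain ⟨a1, a2⟩ := hP
    rcases hb with h | h
    · exact ⟨by rw [e1 h]; norm_num, ez.eq.1 a2⟩
    · rw [a2] at h; norm_num at h
  · obtain ⟨a1, a2, a3⟩ := hP
    rcases hb with h | h
    · linarith
    · obtain ⟨b1, b2, b3⟩ := end_lvl hn h0 h0' a2 a3 h e2 e3
      exact ⟨e0 a1, b2, b3⟩
end Fi

theorem not_NN (hD : 2 ≤ D) (s : Sp D) (h : s.q ∉ NN D) : 4 * |s.δ| = 1 ∨ |s.z| = 1 := by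
  rw [NN_sp hD, not_and_or, not_lt, not_lt] at h
  rcases h with h | h
  · left; linarith [s.ok.hδ]
  · right; linarith [s.ok.hz]

theorem JJ.SL' (hD : 2 ≤ D) (hn : 0 < n) (i : JJ D n) : SL (FF D) (i.cl \ NN D) := by
  rintro p q H ⟨⟨s, rfl, h⟩, hN⟩
  have H : SS D s.q q := H
  refine ⟨?_, fun hq => hN (NN_SL q s.q H.symm hq)⟩
  have hb := not_NN hD s hN
  obtain ⟨s', rfl, ea, e0, e1, ez, e2, e3⟩ := SS.sp s H
  rw [JJ.mem_cl i s' hD, ea]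
  refine ⟨h.1, Fi.bdry_inv hn (by positivity) (by positivity) h.2.2 hb ?_ ?_ ez e2 e3 s'.ok.hz⟩
  · intro h; simp only [mul_eq_zero, abs_eq_zero, OfNat.ofNat_ne_zero, false_or] at h ⊢; exact e0 h
  · simp only; intro h; have := e1 (by linarith); linarith

end Fat
end

noncomputable section
set_option linter.unusedSectionVars false
open Classical

namespace Fat
variable {D n : ℕ}

theorem low_of_le {s : Sp D} {b : Bc D} (h : Bc.le s.a b) (hr : b.rk = 0) : s.t = low s.h s.c s.δ := by
  have key : (∃ g, s.a = Bc.R g) ∨ ∃ g, s.a = Bc.V g := by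
    cases b with
    | G g => simp [Bc.rk] at hr
    | E e => simp [Bc.rk] at hr
    | R g => rcases h with h | h; exacts [Or.inl ⟨_, h⟩, Or.inr ⟨_, h⟩]
    | V g => exact Or.inr ⟨_, h⟩
  rcases lt_trichotomy s.δ 0 with d | d | d
  · rw [Sp.a_neg d] at key
    split_ifs at key with q
    · exact q.2
    · simp at key
  · rw [Sp.a_zero d] at key
    split_ifs at key with q
    · rw [d, low_zero, q]
    · simp at key
  · rw [Sp.a_pos d] at key
    split_ifs at key with q
    · exact q.2
    · simp at key

theorem tdz_indep (h : Gam D) (c : ℕ) (k v m w : ℝ) :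
    LinearIndependent ℝ ![tv h c k 0, dv h c v, zv m w] := by
  rw [Fintype.linearIndependent_iff]
  intro g hg
  rw [Fin.sum_univ_three] at hg
  have e1 := congrFun hg 1
  have e2 := congrFun hg 2
  have e3 := congrFun hg 3
  simp [tv, dv, zv] at e1 e2 e3
  rw [e3] at e2
  have hb : g 1 = g 0 * k := by linarith
  rw [hb] at e2
  have ha : g 0 = 0 := by linear_combination e2
  intro i
  fin_cases i
  · exact ha
  · simp [hb, ha]
  · exact e3

theorem fun_ex (s : Sp D) : ∃ g : Fin 3 → Fin 4 → ℝ, LinearIndependent ℝ g ∧ (∀ j, g j ∈ FF D) ∧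
    (s.t = low s.h s.c s.δ → aff (g 0) s.q = 0) ∧ (s.δ = 0 ∨ |s.δ| = 1 / 4 → aff (g 1) s.q = 0) ∧
    (s.z = 0 ∨ |s.z| = 1 → aff (g 2) s.q = 0) := by
  have hp : Fat.dl s.h s.c s.q = s.δ := dl_pt _ _ _ _ _
  have hz : zz s.h s.c s.q = s.z := zz_pt _ _ _ _ _
  have ht : s.q.2.1 = s.t := rfl
  have hT : ∃ k, tv s.h s.c k 0 ∈ LL s.h s.c ∧ (s.t = low s.h s.c s.δ → aff (tv s.h s.c k 0) s.q = 0) := by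
    rcases le_total 0 s.δ with d | d
    · refine ⟨2 * AA s.h (s.c + 1), by simp [LL], fun e => ?_⟩
      rw [aff_tv, hp, ht, e, low_nonneg _ _ d]; ring
    · refine ⟨-2 * AA s.h s.c, by simp [LL], fun e => ?_⟩
      rw [aff_tv, hp, ht, e, low_nonpos _ _ d]; ring
  have hDl : ∃ v, dv s.h s.c v ∈ LL s.h s.c ∧ (s.δ = 0 ∨ |s.δ| = 1 / 4 → aff (dv s.h s.c v) s.q = 0) := by
    simp only [aff_dv, hp]
    by_cases h1 : s.δ = 1 / 4
    · exact ⟨1 / 4, by simp [LL], fun _ => by linarith⟩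
    by_cases h2 : s.δ = -(1 / 4)
    · exact ⟨-(1 / 4), by simp [LL], fun _ => by linarith⟩
    refine ⟨0, by simp [LL], ?_⟩
    rintro (h | h)
    · linarith
    · rcases eq_or_eq_neg_of_abs_eq h with h | h
      · exact absurd h h1
      · exact absurd h h2
  have hZ : ∃ m v, zv m v ∈ LL s.h s.c ∧ (s.z = 0 ∨ |s.z| = 1 → aff (zv m v) s.q = 0) := by
    have key : ∀ v, zv 0 v ∈ LL s.h s.c → zv (lam s.h s.c) v ∈ LL s.h s.c → (s.z = 0 ∨ |s.z| = 1 → s.z = 4 * v) →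
        ∃ m v, zv m v ∈ LL s.h s.c ∧ (s.z = 0 ∨ |s.z| = 1 → aff (zv m v) s.q = 0) := by
      intro v m0 m1 hv
      rcases le_total s.q.2.1 1 with g | g
      · refine ⟨0, v, m0, fun e => ?_⟩
        have := (zz_aff s.h s.c v s.q).1 g
        rw [hz, hv e] at this; linarith
      · refine ⟨lam s.h s.c, v, m1, fun e => ?_⟩
        have := (zz_aff s.h s.c v s.q).2 g
        rw [hz, hv e] at this; linarith
    by_cases h1 : s.z = 1
    · exact key (1 / 4) (by simp [LL]) (by simp [LL]) fun _ => by linarith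
    by_cases h2 : s.z = -1
    · exact key (-(1 / 4)) (by simp [LL]) (by simp [LL]) fun _ => by linarith
    refine key 0 (by simp [LL]) (by simp [LL]) ?_
    rintro (h | h)
    · linarith
    · rcases eq_or_eq_neg_of_abs_eq h with h | h
      · exact absurd h h1
      · exact absurd h h2
  obtain ⟨k, k1, k2⟩ := hT
  obtain ⟨v, v1, v2⟩ := hDl
  obtain ⟨m, w, m1, m2⟩ := hZ
  refine ⟨_, tdz_indep s.h s.c k v m w, ?_, k2, v2, m2⟩
  intro j
  fin_cases j
  · exact FF_mem s.h s.c.2 k1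
  · exact FF_mem s.h s.c.2 v1
  · exact FF_mem s.h s.c.2 m1

theorem JJ.out (hD : 2 ≤ D) (hn : 0 < n) (i : JJ D n) (s : Sp D) (h : s.q ∈ i.cl) (hN : s.q ∉ NN D) :
    ∃ (k : ℕ) (g : Fin k → Fin 4 → ℝ), k + (i.d : ℕ) = 4 ∧ LinearIndependent ℝ g ∧
      ∀ j, g j ∈ FF D ∧ aff (g j) s.q = 0 := by
  obtain ⟨g, li, mem, g0, g1, g2⟩ := fun_ex s
  have hb := not_NN hD s hN
  rw [JJ.mem_cl i s hD] at h
  have pick : ∀ {k : ℕ} (e : Fin k → Fin 3), Function.Injective e → k + (i.d : ℕ) = 4 →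
      (∀ j, aff (g (e j)) s.q = 0) → ∃ (k : ℕ) (g : Fin k → Fin 4 → ℝ), k + (i.d : ℕ) = 4 ∧ LinearIndependent ℝ g ∧
      ∀ j, g j ∈ FF D ∧ aff (g j) s.q = 0 := fun e he hk hz =>
    ⟨_, g ∘ e, hk, li.comp e he, fun j => ⟨mem _, hz j⟩⟩
  have hd : (i.d : ℕ) = i.P.dim + i.b.rk := rfl
  have rk : i.b.rk = 0 ∨ i.b.rk = 1 := by cases i.b <;> simp [Bc.rk]
  have hT : i.b.rk = 0 → aff (g 0) s.q = 0 := fun e => g0 (low_of_le h.1 e)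
  have one : (aff (g 1) s.q = 0 ∧ aff (g 2) s.q = 0 → i.P.dim = 1 → ∃ (k : ℕ) (g : Fin k → Fin 4 → ℝ),
      k + (i.d : ℕ) = 4 ∧ LinearIndependent ℝ g ∧ ∀ j, g j ∈ FF D ∧ aff (g j) s.q = 0) := by
    rintro ⟨a1, a2⟩ dm
    rcases rk with r | r
    · refine pick ![0, 1, 2] (by decide) (by omega) ?_
      intro j; fin_cases j
      exacts [hT r, a1, a2]
    · refine pick ![1, 2] (by decide) (by omega) ?_
      intro j; fin_cases j
      exacts [a1, a2]
  rcases Fi.bdry hn (by positivity) h.2 hb with ⟨k, hP⟩ | hP | ⟨k, hP⟩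
  · have dm : i.P.dim = 2 := by rw [hP]; rfl
    rcases hb with e | e
    · have a := g1 (Or.inr (by linarith))
      rcases rk with r | r
      · refine pick ![0, 1] (by decide) (by omega) ?_
        intro j; fin_cases j
        exacts [hT r, a]
      · refine pick ![1] (by decide) (by omega) ?_
        intro j; fin_cases j
        exact a
    · have a := g2 (Or.inr e)
      rcases rk with r | r
      · refine pick ![0, 2] (by decide) (by omega) ?_
        intro j; fin_cases j
        exacts [hT r, a]
      · refine pick ![2] (by decide) (by omega) ?_
        intro j; fin_cases j
        exact a
  · have h2 := h.2
    rw [hP] at h2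
    have z0 : s.z = 0 := h2.2
    have r1 : 4 * |s.δ| = 1 := hb.resolve_right (by rw [z0]; norm_num)
    exact one ⟨g1 (Or.inr (by linarith)), g2 (Or.inl z0)⟩ (by rw [hP]; rfl)
  · have h2 := h.2
    rw [hP] at h2
    have r0 : 4 * |s.δ| = 0 := h2.1
    have z1 : |s.z| = 1 := hb.resolve_left (by rw [r0]; norm_num)
    exact one ⟨g1 (Or.inl (by simpa using r0)), g2 (Or.inr z1)⟩ (by rw [hP]; rfl)

instance Bc.fin : Finite (Bc D) := by
  let f : (Gam D ⊕ Gam D) ⊕ (Ed D ⊕ Gam D) → Bc D :=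
    Sum.elim (Sum.elim Bc.G Bc.R) (Sum.elim Bc.E Bc.V)
  refine Finite.of_surjective f ?_
  intro b
  cases b with
  | G g => exact ⟨Sum.inl (Sum.inl g), rfl⟩
  | R g => exact ⟨Sum.inl (Sum.inr g), rfl⟩
  | E g => exact ⟨Sum.inr (Sum.inl g), rfl⟩
  | V g => exact ⟨Sum.inr (Sum.inr g), rfl⟩
instance Fi.finite : Finite (Fi n) := by
  let f : (Fin (n + 2) ⊕ Fin (n + 1)) ⊕ ((Unit ⊕ Unit) ⊕ (Fin (n + 2) ⊕ Fin (n + 1))) → Fi n :=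
    Sum.elim (Sum.elim Fi.face Fi.page) (Sum.elim (Sum.elim (fun _ => Fi.fin) (fun _ => Fi.apex)) (Sum.elim Fi.wint Fi.wpt))
  refine Finite.of_surjective f ?_
  intro b
  cases b with
  | face g => exact ⟨Sum.inl (Sum.inl g), rfl⟩
  | page g => exact ⟨Sum.inl (Sum.inr g), rfl⟩
  | fin => exact ⟨Sum.inr (Sum.inl (Sum.inl ())), rfl⟩
  | apex => exact ⟨Sum.inr (Sum.inl (Sum.inr ())), rfl⟩
  | wint g => exact ⟨Sum.inr (Sum.inr (Sum.inl g)), rfl⟩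
  | wpt g => exact ⟨Sum.inr (Sum.inr (Sum.inr g)), rfl⟩
instance JJ.fin : Finite (JJ D n) :=
  Finite.of_injective (fun i => (i.b, i.P)) fun _ _ e => JJ.ext' (congrArg Prod.fst e) (congrArg Prod.snd e)

theorem complex_ex (hD : 2 ≤ D) (hn : 0 < n) : ∃ C : FinCellulation3, C.StronglyRegular ∧
    ∀ m : Fin 4, Nat.card {i : JJ D n // i.d = m} ≤ C.count m ∧
      C.count m ≤ Nat.card {i : JJ D n // i.d = m} + Nat.card (Finset (FF D → SignType)) := by
  have : Fintype (JJ D n) := Fintype.ofFinite _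
  refine assembleQ (FF D) FF_coord JJ.d JJ.cl JJ.op (NN D) (NN_open hD) NN_SL (JJ.cell hD hn) (JJ.disj hD hn)
    JJ.cov ?_ (JJ.ii hD hn) ?_
  · intro i x hx ho
    obtain ⟨s, rfl, -⟩ := id hx
    by_cases hN : s.q ∈ NN D
    · exact Or.inl (JJ.bd hD hn i s hx ho hN)
    · exact Or.inr ⟨hN, JJ.out hD hn i s hx hN⟩
  · intro i
    refine Or.inr ⟨i.cl \ NN D, ?_, JJ.SL' hD hn i, ?_⟩
    · exact ((JJ.cell hD hn i).compact).diff (NN_open hD)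
    · rw [sdiff_idem]

end Fat
end

noncomputable section
set_option linter.unusedSectionVars false
open Classical

namespace Fat
variable {D n : ℕ}

theorem card_three : Nat.card {i : JJ D n // i.d = 3} ≤ Nat.card (Gam D) * (n + 2) := by
  let f : Gam D × Fin (n + 2) → {i : JJ D n // i.d = 3} := fun x =>
    ⟨⟨Bc.G x.1, Fi.face x.2, by simp [Bc.off, Fi.wall]⟩, rfl⟩
  have hf : Function.Surjective f := by
    rintro ⟨⟨b, P, hb⟩, hd⟩
    have hd' : P.dim + b.rk = 3 := congrArg Fin.val hd
    cases P <;> cases b <;> simp [Fi.dim, Bc.rk, Bc.off, Fi.wall] at hd' hb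
    rename_i k g _
    exact ⟨(g, k), rfl⟩
  simpa using Nat.card_le_card_of_surjective f hf

theorem card_zero : Nat.card {i : JJ D n // i.d = 0} ≤ Nat.card (Gam D) * (n + 1) + Nat.card (Gam D) := by
  let f : (Gam D × Fin (n + 1)) ⊕ Gam D → {i : JJ D n // i.d = 0} := Sum.elim
    (fun x => ⟨⟨Bc.V x.1, Fi.wpt x.2, by simp [Bc.off, Fi.wall]⟩, rfl⟩)
    (fun x => ⟨⟨Bc.R x, Fi.apex, by simp [Bc.off, Fi.wall]⟩, rfl⟩)
  have hf : Function.Surjective f := by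
    rintro ⟨⟨b, P, hb⟩, hd⟩
    have hd' : P.dim + b.rk = 0 := congrArg Fin.val hd
    cases P <;> cases b <;> simp [Fi.dim, Bc.rk, Bc.off, Fi.wall] at hd' hb
    · rename_i g _
      exact ⟨Sum.inr g, rfl⟩
    · rename_i k g _
      exact ⟨Sum.inl (g, k), rfl⟩
  simpa using Nat.card_le_card_of_surjective f hf

theorem card_one : Nat.card (Ed D) * (n + 1) ≤ Nat.card {i : JJ D n // i.d = 1} := by
  let f : Ed D × Fin (n + 1) → {i : JJ D n // i.d = 1} := fun x =>
    ⟨⟨Bc.E x.1, Fi.wpt x.2, by simp [Bc.off, Fi.wall]⟩, rfl⟩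
  have hf : Function.Injective f := by
    rintro ⟨e, k⟩ ⟨e', k'⟩ h
    have h := congrArg Subtype.val h
    have h1 : Bc.E e = Bc.E e' := congrArg JJ.b h
    have h2 : Fi.wpt k = Fi.wpt k' := congrArg JJ.P h
    injection h1 with h1; injection h2 with h2; rw [h1, h2]
  have := Nat.card_le_card_of_injective f hf
  rwa [Nat.card_prod, Nat.card_fin] at this

theorem card_two : Nat.card (Ed D) * (n + 2) ≤ Nat.card {i : JJ D n // i.d = 2} := by
  let f : Ed D × Fin (n + 2) → {i : JJ D n // i.d = 2} := fun x =>
    ⟨⟨Bc.E x.1, Fi.wint x.2, by simp [Bc.off, Fi.wall]⟩, rfl⟩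
  have hf : Function.Injective f := by
    rintro ⟨e, k⟩ ⟨e', k'⟩ h
    have h := congrArg Subtype.val h
    have h1 : Bc.E e = Bc.E e' := congrArg JJ.b h
    have h2 : Fi.wint k = Fi.wint k' := congrArg JJ.P h
    injection h1 with h1; injection h2 with h2; rw [h1, h2]
  have := Nat.card_le_card_of_injective f hf
  rwa [Nat.card_prod, Nat.card_fin] at this

theorem card_Ed : Nat.card (Gam D) * D ≤ Nat.card (Ed D) * 2 := by
  let f : Ed D × Bool → Gam D × Fin D := fun x => if x.2 then x.1.1 else (nb x.1.1.1 x.1.1.2, x.1.1.2)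
  have hf : Function.Surjective f := by
    rintro ⟨h, c⟩
    by_cases l : lft h c
    · exact ⟨(⟨(h, c), l⟩, true), by simp [f]⟩
    · exact ⟨(⟨(nb h c, c), (lft_nb h c.2).2 l⟩, false), by simp [f, nb_nb]⟩
  have := Nat.card_le_card_of_surjective f hf
  simpa only [Nat.card_prod, Nat.card_fin, Nat.card_eq_fintype_card (α := Bool), Fintype.card_bool] using this

theorem main (c : ℝ) : ∃ C : FinCellulation3, C.StronglyRegular ∧
    c * ((C.count 0 : ℝ) + (C.count 3 : ℝ)) < (C.count 1 : ℝ) + (C.count 2 : ℝ) := by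
  obtain ⟨m, hm⟩ := exists_nat_gt (4 * |c|)
  obtain ⟨D, hD, hDm⟩ : ∃ D : ℕ, 2 ≤ D ∧ m ≤ D := ⟨m + 2, by omega, by omega⟩
  set K := Nat.card (Finset (FF D → SignType)) with hK
  obtain ⟨n, hn⟩ : ∃ n : ℕ, n = 2 * K + 4 := ⟨_, rfl⟩
  obtain ⟨C, hC, hc⟩ := complex_ex (n := n) hD (by omega)
  refine ⟨C, hC, ?_⟩
  have h0 := (hc 0).2.trans (Nat.add_le_add_right card_zero _)
  have h3 := (hc 3).2.trans (Nat.add_le_add_right card_three _)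
  have h1 := card_one.trans (hc 1).1
  have h2 := card_two.trans (hc 2).1
  have hE := card_Ed (D := D)
  rw [← hK] at h0 h3
  have hN : 0 < Nat.card (Gam D) := Nat.card_pos
  generalize Nat.card (Gam D) = N at *
  generalize Nat.card (Ed D) = M at *
  have u : C.count 0 + C.count 3 ≤ N * (4 * n) := by
    calc C.count 0 + C.count 3 ≤ N * (2 * n + 4) + 2 * K := by nlinarith
      _ ≤ N * (2 * n + 4) + N * (2 * K) := by nlinarith [Nat.mul_le_mul_right (2 * K) hN]
      _ ≤ N * (4 * n) := by rw [← Nat.mul_add]; exact Nat.mul_le_mul_left _ (by omega)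
  have l : N * D * n ≤ C.count 1 + C.count 2 := by
    calc N * D * n ≤ M * 2 * n := Nat.mul_le_mul_right _ hE
      _ ≤ M * (n + 1) + M * (n + 2) := by nlinarith
      _ ≤ _ := Nat.add_le_add h1 h2
  have u' : (C.count 0 : ℝ) + C.count 3 ≤ N * (4 * n) := by exact_mod_cast u
  have l' : (N : ℝ) * D * n ≤ C.count 1 + C.count 2 := by exact_mod_cast l
  have dm : (m : ℝ) ≤ D := by exact_mod_cast hDm
  have hNn : (0 : ℝ) < N * n := by
    have : 0 < N * n := Nat.mul_pos hN (by omega)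
    exact_mod_cast this
  calc c * ((C.count 0 : ℝ) + C.count 3) ≤ |c| * ((C.count 0 : ℝ) + C.count 3) :=
        mul_le_mul_of_nonneg_right (le_abs_self c) (by positivity)
    _ ≤ |c| * (N * (4 * n)) := mul_le_mul_of_nonneg_left u' (abs_nonneg c)
    _ = (4 * |c|) * (N * n) := by ring
    _ < D * (N * n) := mul_lt_mul_of_pos_right (by linarith) hNn
    _ = N * D * n := by ring
    _ ≤ _ := l'

end Fat
end

/-- The fatness of strongly regular cellulations of the 3-sphere is
unbounded. -/
theorem fatness_of_strongly_regular_cellulations_unbounded :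
    ∀ c : ℝ, ∃ C : FinCellulation3, C.StronglyRegular ∧
      c * ((C.count 0 : ℝ) + (C.count 3 : ℝ)) < (C.count 1 : ℝ) + (C.count 2 : ℝ) := by
  exact Fat.main
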